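/- Fix integers 0 < n ≤ d. There exists δ₀ > 0, depending only on n and d, with the following property: for every Radon measure μ on ℝ^d with nonempty support Σ that is doubling and n-asymptotically optimally doubling, every ε > 0 and every compact set K ⊂ ℝ^d, there exists an integer N > 0 such that for every ball B centered at a point of Σ∩K with 2^N B ⊆ K: if β^n_μ(2^k B) ≤ δ₀/4 for all 1 ≤ k ≤ N, then bβ^n_μ(B) ≤ ε. (Here 2^k B denotes the concentric ball of 2^k times the radius of B.) -/

import Mathlib

open MeasureTheory Metric Filter Set

noncomputable section

abbrev Euc (d : ℕ) : Type := EuclideanSpace ℝ (Fin d)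

/-- The support of a measure: points all of whose closed balls have positive measure. -/
def msupport {d : ℕ} (μ : Measure (Euc d)) : Set (Euc d) :=
  {x | ∀ r : ℝ, 0 < r → 0 < μ (Metric.closedBall x r)}

/-- `φ` is a distribution function of the uniformly distributed measure `μ`. -/
def IsDistributionFunction {d : ℕ} (μ : Measure (Euc d)) (φ : ℝ → ENNReal) : Prop :=
  (msupport μ).Nonempty ∧
  (∀ r : ℝ, 0 < r → 0 < φ r ∧ φ r < ⊤) ∧
  (∀ x ∈ msupport μ, ∀ r : ℝ, 0 < r → μ (Metric.closedBall x r) = φ r)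

/-- `μ` is uniformly distributed. -/
def UniformlyDistributed {d : ℕ} (μ : Measure (Euc d)) : Prop :=
  ∃ φ : ℝ → ENNReal, IsDistributionFunction μ φ

/-- `dim₀ μ = n` : the limit of `φ(r)/rⁿ` as `r → 0⁺` exists, is finite and positive. -/
def HasDim0 (φ : ℝ → ENNReal) (n : ℕ) : Prop :=
  ∃ c : ℝ, 0 < c ∧
    Filter.Tendsto (fun r : ℝ => (φ r).toReal / r ^ n) (nhdsWithin 0 (Set.Ioi 0)) (nhds c)

/-- `dim_∞ μ = p` : the limit of `φ(r)/r^p` as `r → ∞` exists, is finite and positive. -/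
def HasDimInfty (φ : ℝ → ENNReal) (p : ℕ) : Prop :=
  ∃ c : ℝ, 0 < c ∧
    Filter.Tendsto (fun r : ℝ => (φ r).toReal / r ^ p) Filter.atTop (nhds c)

/-- The affine `n`-planes of `ℝ^d`. -/
def nPlanes (d n : ℕ) : Set (AffineSubspace ℝ (Euc d)) :=
  {L | (L : Set (Euc d)).Nonempty ∧ Module.finrank ℝ L.direction = n}

/-- Jones' beta number `β^n_μ(B(x,r))`. -/
def jonesBeta {d : ℕ} (n : ℕ) (μ : Measure (Euc d)) (x : Euc d) (r : ℝ) : ℝ :=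
  ⨅ L : nPlanes d n,
    ⨆ y : (msupport μ ∩ Metric.closedBall x r : Set (Euc d)),
      Metric.infDist y.1 (L.1 : Set (Euc d)) / r

/-- The bilateral beta number `bβ^n_μ(B(x,r))`. -/
def bilateralBeta {d : ℕ} (n : ℕ) (μ : Measure (Euc d)) (x : Euc d) (r : ℝ) : ℝ :=
  ⨅ L : nPlanes d n,
    ((⨆ y : (msupport μ ∩ Metric.closedBall x r : Set (Euc d)),
        Metric.infDist y.1 (L.1 : Set (Euc d)) / r) +
     (⨆ p : ((L.1 : Set (Euc d)) ∩ Metric.closedBall x r : Set (Euc d)),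
        Metric.infDist p.1 (msupport μ) / r))

/-- `μ` is doubling with constant `C`. -/
def DoublingWith {d : ℕ} (μ : Measure (Euc d)) (C : ℝ) : Prop :=
  ∀ x ∈ msupport μ, ∀ r : ℝ, 0 < r →
    μ (Metric.closedBall x (2 * r)) ≤ ENNReal.ofReal C * μ (Metric.closedBall x r)

/-- `μ` is doubling. -/
def Doubling {d : ℕ} (μ : Measure (Euc d)) : Prop :=
  ∃ C : ℝ, 0 < C ∧ DoublingWith μ C

/-- Weak convergence of a sequence of Radon measures. -/
def WeakConv {d : ℕ} (μs : ℕ → Measure (Euc d)) (μ : Measure (Euc d)) : Prop :=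
  ∀ f : Euc d → ℝ, Continuous f → HasCompactSupport f →
    Filter.Tendsto (fun j => ∫ x, f x ∂(μs j)) Filter.atTop (nhds (∫ x, f x ∂μ))

/-- `μ` is `n`-asymptotically optimally doubling. -/
def AsympOptDoubling {d : ℕ} (n : ℕ) (μ : Measure (Euc d)) : Prop :=
  ∀ K : Set (Euc d), IsCompact K → K ⊆ msupport μ →
    ∀ t : ℝ, t ∈ Set.Icc (1/2 : ℝ) 1 →
      Filter.Tendsto
        (fun r : ℝ => ⨆ x : K,
          |(μ (Metric.closedBall x.1 (t * r)) / μ (Metric.closedBall x.1 r)).toReal - t ^ n|)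
        (nhdsWithin 0 (Set.Ioi 0)) (nhds 0)

/-- Truncated `n`-Riesz transform `R_{r,s}μ(z)`. -/
def rieszT {d : ℕ} (n : ℕ) (μ : Measure (Euc d)) (z : Euc d) (r s : ℝ) : Euc d :=
  ∫ y in {y : Euc d | r ≤ dist y z ∧ dist y z ≤ s}, (‖y - z‖ ^ (n + 1))⁻¹ • (y - z) ∂μ

/-- `μ` is locally Ahlfors `n`-regular. -/
def LocallyAhlforsRegular {d : ℕ} (n : ℕ) (μ : Measure (Euc d)) : Prop :=
  ∀ K : Set (Euc d), IsCompact K → ∃ c : ℝ, 0 < c ∧ ∃ rK : ℝ, 0 < rK ∧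
    ∀ x ∈ msupport μ ∩ K, ∀ r : ℝ, 0 < r → r ≤ rK →
      ENNReal.ofReal (c⁻¹ * r ^ n) ≤ μ (Metric.closedBall x r) ∧
      μ (Metric.closedBall x r) ≤ ENNReal.ofReal (c * r ^ n)

/-- `μ` is locally uniformly `n`-rectifiable. -/
def LocUnifRectifiable {d : ℕ} (n : ℕ) (μ : Measure (Euc d)) : Prop :=
  LocallyAhlforsRegular n μ ∧
  ∀ K : Set (Euc d), IsCompact K →
    ∃ RK θK MK : ℝ, 0 < RK ∧ 0 < θK ∧ 0 < MK ∧
      ∀ x ∈ msupport μ ∩ K, ∀ R : ℝ, 0 < R → R ≤ RK →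
        ∃ g : EuclideanSpace ℝ (Fin n) → Euc d,
          LipschitzWith (Real.toNNReal MK) g ∧
          ENNReal.ofReal (θK * R ^ n) ≤ μ (Metric.closedBall x R ∩ Set.range g)

namespace FlatnessPropagation

open scoped Topology ENNReal

section

/-- `ν` has the origin in its support and every ball of radius `r` centered on its support has
measure `r ^ n`. -/
structure Unif {d : ℕ} (n : ℕ) (ν : Measure (Euc d)) : Prop where
  pos : 0 < n
  zero_mem : (0 : Euc d) ∈ msupport ν
  ball : ∀ x ∈ msupport ν, ∀ r : ℝ, 0 < r → ν (closedBall x r) = ENNReal.ofReal (r ^ n)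

/-- The law of the distance to a point of the support of a measure satisfying `Unif n`. -/
def radial (n : ℕ) : Measure ℝ :=
  (volume.restrict (Ioi 0)).withDensity fun r => ENNReal.ofReal (n * r ^ (n - 1))

variable {d n : ℕ} {ν : Measure (Euc d)}

theorem isClosed_msupport (μ : Measure (Euc d)) : IsClosed (msupport μ) := by
  rw [← isOpen_compl_iff, Metric.isOpen_iff]
  intro x hx
  simp only [msupport, mem_compl_iff, mem_ofPred_eq, not_forall, not_lt, nonpos_iff_eq_zero] at hx
  obtain ⟨r, hr, h0⟩ := hx
  refine ⟨r / 2, by positivity, fun y hy => ?_⟩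
  simp only [msupport, mem_compl_iff, mem_ofPred_eq, not_forall, not_lt, nonpos_iff_eq_zero]
  refine ⟨r / 2, by positivity, measure_mono_null (closedBall_subset_closedBall' ?_) h0⟩
  rw [mem_ball] at hy; linarith

theorem measure_compl_msupport (μ : Measure (Euc d)) : μ (msupport μ)ᶜ = 0 := by
  refine measure_null_of_locally_null _ fun x hx => ?_
  simp only [msupport, mem_compl_iff, mem_ofPred_eq, not_forall, not_lt, nonpos_iff_eq_zero] at hx
  obtain ⟨r, hr, h0⟩ := hx
  exact ⟨closedBall x r, mem_nhdsWithin_of_mem_nhds (closedBall_mem_nhds x hr), h0⟩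

theorem ae_mem_msupport (μ : Measure (Euc d)) : ∀ᵐ x ∂μ, x ∈ msupport μ :=
  measure_compl_msupport μ

theorem Unif.isLocallyFinite (h : Unif n ν) : IsLocallyFiniteMeasure ν := by
  refine ⟨fun x => ⟨closedBall 0 (‖x‖ + 1), ?_, ?_⟩⟩
  · refine mem_of_superset (closedBall_mem_nhds x one_pos) (closedBall_subset_closedBall' ?_)
    simp [add_comm]
  · rw [h.ball 0 h.zero_mem _ (by positivity)]; exact ENNReal.ofReal_lt_top

theorem radial_Iic (hn : 0 < n) (b : ℝ) : radial n (Iic b) = ENNReal.ofReal (max b 0 ^ n) := by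
  rw [radial, withDensity_apply _ measurableSet_Iic, Measure.restrict_restrict measurableSet_Iic,
    inter_comm, Ioi_inter_Iic]
  rcases le_or_gt b 0 with hb | hb
  · simp [hb, hn.ne']
  · rw [← ofReal_integral_eq_lintegral_ofReal]
    · rw [← intervalIntegral.integral_of_le hb.le, intervalIntegral.integral_const_mul, integral_pow,
        max_eq_left hb.le]
      congr 1
      have : n - 1 + 1 = n := by omega
      have h2 : ((n - 1 : ℕ) : ℝ) + 1 = n := by exact_mod_cast this
      rw [this, h2]; simp [hn.ne']; field_simp
    · exact ((continuous_const.mul (continuous_pow _)).intervalIntegrable 0 b).1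
    · refine (ae_restrict_iff' measurableSet_Ioc).2 (Eventually.of_forall fun x hx => ?_)
      have := hx.1.le
      positivity

theorem Unif.measure_dist_le (h : Unif n ν) {x : Euc d} (hx : x ∈ msupport ν) (b : ℝ) :
    ν (closedBall x b) = ENNReal.ofReal (max b 0 ^ n) := by
  rcases lt_or_ge 0 b with hb | hb
  · rw [h.ball x hx b hb, max_eq_left hb.le]
  · rw [max_eq_right hb, zero_pow h.pos.ne', ENNReal.ofReal_zero]
    refine le_antisymm (ge_of_tendsto (f := fun r : ℝ => ENNReal.ofReal (r ^ n)) (x := 𝓝[>] 0) ?_ ?_) zero_le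
    · have : Tendsto (fun r : ℝ => ENNReal.ofReal (r ^ n)) (𝓝 0) (𝓝 (ENNReal.ofReal (0 ^ n))) :=
        (ENNReal.continuous_ofReal.comp (continuous_pow n)).tendsto 0
      rw [zero_pow h.pos.ne', ENNReal.ofReal_zero] at this
      exact this.mono_left nhdsWithin_le_nhds
    · filter_upwards [self_mem_nhdsWithin] with r hr
      rw [← h.ball x hx r hr]
      exact measure_mono (closedBall_subset_closedBall (hb.trans (le_of_lt hr)))

theorem Unif.map_dist (h : Unif n ν) {x : Euc d} (hx : x ∈ msupport ν) :
    ν.map (fun z => dist z x) = radial n := by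
  have hm : Measurable fun z : Euc d => dist z x := (continuous_id.dist continuous_const).measurable
  have key : ∀ b, ν.map (fun z => dist z x) (Iic b) = radial n (Iic b) := fun b => by
    rw [Measure.map_apply hm measurableSet_Iic, radial_Iic h.pos, ← h.measure_dist_le hx]; rfl
  have fin : ∀ b, radial n (Iic b) ≠ ∞ := fun b => by
    rw [radial_Iic h.pos]; exact ENNReal.ofReal_ne_top
  refine Measure.ext_of_Ioc' _ _ (fun a b _ => ?_) fun a b hab => ?_
  · exact ne_top_of_le_ne_top (by rw [key]; exact fin b) (measure_mono Ioc_subset_Iic_self)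
  · have : Ioc a b = Iic b \ Iic a := by ext; simp [and_comm]
    rw [this, measure_sdiff (Iic_subset_Iic.2 hab.le) measurableSet_Iic.nullMeasurableSet
      (by rw [key]; exact fin a), measure_sdiff (Iic_subset_Iic.2 hab.le)
      measurableSet_Iic.nullMeasurableSet (fin a), key, key]

theorem Unif.integral_dist (h : Unif n ν) {x : Euc d} (hx : x ∈ msupport ν) {g : ℝ → ℝ}
    (hg : Continuous g) : ∫ z, g (dist z x) ∂ν = ∫ r, g r ∂radial n := by
  have hm : AEMeasurable (fun z : Euc d => dist z x) ν := by fun_prop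
  rw [← h.map_dist hx, integral_map hm hg.aestronglyMeasurable]

theorem Unif.integrable_dist (h : Unif n ν) {x : Euc d} (hx : x ∈ msupport ν) {g : ℝ → ℝ}
    (hg : Continuous g) (hi : Integrable g (radial n)) : Integrable (fun z => g (dist z x)) ν := by
  have hm : AEMeasurable (fun z : Euc d => dist z x) ν := by fun_prop
  rw [← h.map_dist hx, integrable_map_measure hg.aestronglyMeasurable hm] at hi
  exact hi

theorem integrable_radial_iff {g : ℝ → ℝ} : Integrable g (radial n) ↔
    IntegrableOn (fun r => n * r ^ (n - 1) * g r) (Ioi 0) := by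
  rw [radial, integrable_withDensity_iff_integrable_smul₀' (by fun_prop)
    (Eventually.of_forall fun _ => ENNReal.ofReal_lt_top), IntegrableOn]
  refine integrable_congr ((ae_restrict_iff' measurableSet_Ioi).2 (Eventually.of_forall fun x hx => ?_))
  have : (0 : ℝ) < x := hx
  simp only [smul_eq_mul]
  rw [ENNReal.toReal_ofReal (by positivity)]

theorem integral_radial (g : ℝ → ℝ) : ∫ r, g r ∂radial n =
    ∫ r in Ioi 0, n * r ^ (n - 1) * g r := by
  rw [radial, integral_withDensity_eq_integral_toReal_smul (by fun_prop)
    (Eventually.of_forall fun _ => ENNReal.ofReal_lt_top)]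
  refine setIntegral_congr_fun measurableSet_Ioi fun x hx => ?_
  have : (0 : ℝ) < x := hx
  simp only [smul_eq_mul]
  rw [ENNReal.toReal_ofReal (by positivity)]

theorem integrable_radial_exp (n : ℕ) (a : ℝ) :
    Integrable (fun r => Real.exp (a * r) * Real.exp (-r ^ 2)) (radial n) := by
  rw [integrable_radial_iff]
  have h1 : IntegrableOn (fun r : ℝ => n * Real.exp (a ^ 2 / 2) * (r ^ ((n - 1 : ℕ) : ℝ) *
      Real.exp (-(1 / 2) * r ^ 2))) (Ioi 0) :=
    ((integrable_rpow_mul_exp_neg_mul_sq (b := 1 / 2) (by norm_num)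
      (s := ((n - 1 : ℕ) : ℝ)) (by have : (0 : ℝ) ≤ ((n - 1 : ℕ) : ℝ) := by positivity
                                   linarith)).const_mul _).integrableOn
  refine h1.mono' (by fun_prop) ((ae_restrict_iff' measurableSet_Ioi).2
    (Eventually.of_forall fun r hr => ?_))
  have hr : (0 : ℝ) < r := hr
  rw [Real.norm_of_nonneg (by positivity), ← Real.exp_add, Real.rpow_natCast]
  have : Real.exp (a * r + -r ^ 2) ≤ Real.exp (a ^ 2 / 2) * Real.exp (-(1 / 2) * r ^ 2) := by
    rw [← Real.exp_add]
    exact Real.exp_le_exp.2 (by nlinarith [sq_nonneg (a - r)])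
  calc (n : ℝ) * r ^ (n - 1) * Real.exp (a * r + -r ^ 2)
      ≤ n * r ^ (n - 1) * (Real.exp (a ^ 2 / 2) * Real.exp (-(1 / 2) * r ^ 2)) := by gcongr
    _ = _ := by ring

/-- The total Gaussian mass of a measure satisfying `Unif n`. -/
def gaussMass (n : ℕ) : ℝ := ∫ r, Real.exp (-r ^ 2) ∂radial n

theorem integral_radial_gauss (hn : 0 < n) (k : ℕ) :
    ∫ r, r ^ k * Real.exp (-r ^ 2) ∂radial n = n / 2 * Real.Gamma ((n + k) / 2) := by
  rw [integral_radial]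
  have h1 : (0 : ℝ) ≤ ((n - 1 + k : ℕ) : ℝ) := by positivity
  have h := integral_rpow_mul_exp_neg_mul_rpow (p := 2) (q := ((n - 1 + k : ℕ) : ℝ)) (b := 1)
    (by norm_num) (by linarith) one_pos
  have h2 : ((n - 1 + k : ℕ) : ℝ) + 1 = n + k := by
    rw [show (n : ℝ) + k = ((n + k : ℕ) : ℝ) by push_cast; ring]
    exact_mod_cast (by omega : n - 1 + k + 1 = n + k)
  rw [h2] at h
  simp only [Real.one_rpow, one_mul] at h
  calc _ = ∫ r in Ioi (0 : ℝ), n * (r ^ ((n - 1 + k : ℕ) : ℝ) * Real.exp (-1 * r ^ (2 : ℝ))) := by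
        refine setIntegral_congr_fun measurableSet_Ioi fun x hx => ?_
        simp only [Real.rpow_natCast, Real.rpow_two, pow_add]
        ring_nf
    _ = _ := by rw [integral_const_mul, h]; ring

theorem gaussMass_pos (hn : 0 < n) : 0 < gaussMass n := by
  have := integral_radial_gauss hn 0
  simp only [pow_zero, one_mul, Nat.cast_zero, add_zero] at this
  rw [gaussMass, this]
  have : (0 : ℝ) < n := by exact_mod_cast hn
  have := Real.Gamma_pos_of_pos (half_pos this)
  positivity

theorem integral_radial_sq (hn : 0 < n) :
    ∫ r, r ^ 2 * Real.exp (-r ^ 2) ∂radial n = n / 2 * gaussMass n := by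
  have := integral_radial_gauss hn 0
  simp only [pow_zero, one_mul, Nat.cast_zero, add_zero] at this
  have hn' : (0 : ℝ) < n := by exact_mod_cast hn
  rw [integral_radial_gauss hn, gaussMass, this, Nat.cast_ofNat,
    show ((n : ℝ) + 2) / 2 = n / 2 + 1 by ring, Real.Gamma_add_one (by positivity)]

end

section

variable {d n : ℕ} {ν : Measure (Euc d)}

/-- Continuous functions of at most exponential growth. -/
structure ExpGrowth (f : Euc d → ℝ) : Prop where
  cont : Continuous f
  bound : ∃ C a : ℝ, 0 ≤ C ∧ 0 ≤ a ∧ ∀ z, |f z| ≤ C * Real.exp (a * ‖z‖)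

namespace ExpGrowth

variable {f g : Euc d → ℝ}

theorem const (c : ℝ) : ExpGrowth fun _ : Euc d => c :=
  ⟨continuous_const, |c|, 0, abs_nonneg c, le_rfl, fun z => by simp⟩

theorem add (hf : ExpGrowth f) (hg : ExpGrowth g) : ExpGrowth fun z => f z + g z := by
  obtain ⟨hf, C, a, hC, ha, h⟩ := hf
  obtain ⟨hg, C', a', hC', ha', h'⟩ := hg
  refine ⟨hf.add hg, C + C', a + a', by positivity, by positivity, fun z => ?_⟩
  have h1 : Real.exp (a * ‖z‖) ≤ Real.exp ((a + a') * ‖z‖) := by gcongr; linarith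
  have h2 : Real.exp (a' * ‖z‖) ≤ Real.exp ((a + a') * ‖z‖) := by gcongr; linarith
  calc |f z + g z| ≤ |f z| + |g z| := abs_add_le _ _
    _ ≤ C * Real.exp (a * ‖z‖) + C' * Real.exp (a' * ‖z‖) := add_le_add (h z) (h' z)
    _ ≤ C * Real.exp ((a + a') * ‖z‖) + C' * Real.exp ((a + a') * ‖z‖) := by gcongr
    _ = _ := by ring

theorem mul (hf : ExpGrowth f) (hg : ExpGrowth g) : ExpGrowth fun z => f z * g z := by
  obtain ⟨hf, C, a, hC, ha, h⟩ := hf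
  obtain ⟨hg, C', a', hC', ha', h'⟩ := hg
  refine ⟨hf.mul hg, C * C', a + a', by positivity, by positivity, fun z => ?_⟩
  rw [abs_mul]
  calc |f z| * |g z| ≤ (C * Real.exp (a * ‖z‖)) * (C' * Real.exp (a' * ‖z‖)) :=
        mul_le_mul (h z) (h' z) (abs_nonneg _) (by positivity)
    _ = _ := by rw [add_mul, Real.exp_add]; ring

theorem neg (hf : ExpGrowth f) : ExpGrowth fun z => -f z := by
  simpa using (const (-1)).mul hf

theorem sub (hf : ExpGrowth f) (hg : ExpGrowth g) : ExpGrowth fun z => f z - g z := by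
  simpa [sub_eq_add_neg] using hf.add hg.neg

theorem pow (hf : ExpGrowth f) (k : ℕ) : ExpGrowth fun z => f z ^ k := by
  induction k with
  | zero => simpa using const 1
  | succ k ih => simpa [pow_succ] using ih.mul hf

theorem sum {ι : Type*} (s : Finset ι) {f : ι → Euc d → ℝ} (hf : ∀ i ∈ s, ExpGrowth (f i)) :
    ExpGrowth fun z => ∑ i ∈ s, f i z := by
  classical
  induction s using Finset.induction_on with
  | empty => simpa using const 0
  | insert i s hi ih =>
    simp only [Finset.sum_insert hi]
    exact (hf i (by simp)).add (ih fun j hj => hf j (by simp [hj]))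

theorem norm : ExpGrowth fun z : Euc d => ‖z‖ :=
  ⟨continuous_norm, 1, 1, by simp, by simp, fun z => by
    rw [abs_norm, one_mul, one_mul]; linarith [Real.add_one_le_exp ‖z‖]⟩

theorem inner_right (x : Euc d) : ExpGrowth fun z => inner ℝ z x := by
  refine ⟨by fun_prop, ‖x‖, 1, by positivity, by simp, fun z => ?_⟩
  have := abs_real_inner_le_norm z x
  have h2 := Real.add_one_le_exp ‖z‖
  rw [one_mul]
  nlinarith [norm_nonneg x, norm_nonneg z]

theorem inner_left (x : Euc d) : ExpGrowth fun z => inner ℝ x z := by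
  simpa [real_inner_comm] using inner_right x

theorem exp_inner (c : ℝ) (x : Euc d) : ExpGrowth fun z => Real.exp (c * inner ℝ z x) := by
  refine ⟨by fun_prop, 1, |c| * ‖x‖, by simp, by positivity, fun z => ?_⟩
  rw [abs_of_pos (Real.exp_pos _), one_mul, Real.exp_le_exp]
  calc c * inner ℝ z x ≤ |c * inner ℝ z x| := le_abs_self _
    _ ≤ |c| * (‖z‖ * ‖x‖) := by
        rw [abs_mul]; gcongr; exact abs_real_inner_le_norm z x
    _ = _ := by ring

theorem comp_smul (hf : ExpGrowth f) (c : ℝ) : ExpGrowth fun z => f (c • z) := by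
  obtain ⟨hf, C, a, hC, ha, h⟩ := hf
  refine ⟨by fun_prop, C, a * |c|, hC, by positivity, fun z => ?_⟩
  simpa [norm_smul, mul_assoc] using h (c • z)

end ExpGrowth

/-- The Gaussian probability measure attached to a measure satisfying `Unif n`. -/
def gam (n : ℕ) (ν : Measure (Euc d)) : Measure (Euc d) :=
  ν.withDensity fun z => ENNReal.ofReal (Real.exp (-‖z‖ ^ 2) / gaussMass n)

/-- Moments of exponentials of the norm for the Gaussian probability measure. -/
def expMom (n : ℕ) (a : ℝ) : ℝ :=
  (∫ r, Real.exp (a * r) * Real.exp (-r ^ 2) ∂radial n) / gaussMass n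

theorem expMom_nonneg (n : ℕ) (a : ℝ) : 0 ≤ expMom n a :=
  div_nonneg (integral_nonneg fun _ => by positivity) (integral_nonneg fun _ => by positivity)

theorem Unif.gaussMass_pos (h : Unif n ν) : 0 < gaussMass n := FlatnessPropagation.gaussMass_pos h.pos

theorem Unif.integrable_gam_iff (h : Unif n ν) {f : Euc d → ℝ} :
    Integrable f (gam n ν) ↔ Integrable (fun z => f z * Real.exp (-‖z‖ ^ 2)) ν := by
  have hp := h.gaussMass_pos
  rw [gam, integrable_withDensity_iff_integrable_smul₀' (by fun_prop)
    (Eventually.of_forall fun _ => ENNReal.ofReal_lt_top)]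
  have : ∀ z : Euc d, (ENNReal.ofReal (Real.exp (-‖z‖ ^ 2) / gaussMass n)).toReal • f z =
      (gaussMass n)⁻¹ * (f z * Real.exp (-‖z‖ ^ 2)) := fun z => by
    rw [ENNReal.toReal_ofReal (by positivity), smul_eq_mul]; ring
  simp only [this]
  exact ⟨fun H => by simpa [hp.ne'] using H.const_mul (gaussMass n), fun H => H.const_mul _⟩

theorem Unif.integral_gam (h : Unif n ν) (f : Euc d → ℝ) :
    ∫ z, f z ∂gam n ν = (∫ z, f z * Real.exp (-‖z‖ ^ 2) ∂ν) / gaussMass n := by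
  have hp := h.gaussMass_pos
  rw [gam, integral_withDensity_eq_integral_toReal_smul (by fun_prop)
    (Eventually.of_forall fun _ => ENNReal.ofReal_lt_top), div_eq_inv_mul, ← integral_const_mul]
  congr 1 with z
  rw [ENNReal.toReal_ofReal (by positivity), smul_eq_mul]; ring

theorem Unif.integrable_exp (h : Unif n ν) (a : ℝ) :
    Integrable (fun z => Real.exp (a * ‖z‖)) (gam n ν) := by
  rw [h.integrable_gam_iff]
  simpa using h.integrable_dist h.zero_mem (by fun_prop) (integrable_radial_exp n a)

theorem Unif.integral_exp (h : Unif n ν) (a : ℝ) :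
    ∫ z, Real.exp (a * ‖z‖) ∂gam n ν = expMom n a := by
  rw [h.integral_gam, expMom]
  have := h.integral_dist h.zero_mem (g := fun r => Real.exp (a * r) * Real.exp (-r ^ 2))
    (by fun_prop)
  simp only [dist_zero_right] at this
  rw [this]

theorem Unif.integrable (h : Unif n ν) {f : Euc d → ℝ} (hf : ExpGrowth f) :
    Integrable f (gam n ν) := by
  obtain ⟨hf, C, a, hC, ha, hb⟩ := hf
  exact ((h.integrable_exp a).const_mul C).mono' hf.aestronglyMeasurable (Eventually.of_forall hb)

theorem Unif.abs_integral_le (h : Unif n ν) {f : Euc d → ℝ} {C a : ℝ}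
    (hb : ∀ z, |f z| ≤ C * Real.exp (a * ‖z‖)) : |∫ z, f z ∂gam n ν| ≤ C * expMom n a := by
  rw [← h.integral_exp, ← integral_const_mul]
  rw [← Real.norm_eq_abs]
  exact norm_integral_le_of_norm_le ((h.integrable_exp a).const_mul C) (Eventually.of_forall hb)

theorem Unif.isProbabilityMeasure (h : Unif n ν) : IsProbabilityMeasure (gam n ν) := by
  have h1 : ∫ _, (1 : ℝ) ∂gam n ν = 1 := by
    have := h.integral_exp 0
    simp only [zero_mul, Real.exp_zero] at this
    rw [this, expMom]
    simp only [zero_mul, Real.exp_zero, one_mul]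
    exact div_self h.gaussMass_pos.ne'
  simp only [integral_const, smul_eq_mul, mul_one, measureReal_def] at h1
  exact ⟨(ENNReal.toReal_eq_one_iff _).1 h1⟩

theorem Unif.integral_norm_sq (h : Unif n ν) : ∫ z, ‖z‖ ^ 2 ∂gam n ν = n / 2 := by
  rw [h.integral_gam]
  have := h.integral_dist h.zero_mem (g := fun r => r ^ 2 * Real.exp (-r ^ 2)) (by fun_prop)
  simp only [dist_zero_right] at this
  rw [this, integral_radial_sq h.pos, mul_div_assoc, div_self h.gaussMass_pos.ne', mul_one]

theorem gam_absolutelyContinuous (n : ℕ) (ν : Measure (Euc d)) : gam n ν ≪ ν :=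
  withDensity_absolutelyContinuous _ _

theorem Unif.ae_mem (_h : Unif n ν) : ∀ᵐ z ∂gam n ν, z ∈ msupport ν :=
  (gam_absolutelyContinuous n ν).ae_le (ae_mem_msupport ν)

theorem Unif.mgf (h : Unif n ν) {x : Euc d} (hx : x ∈ msupport ν) :
    ∫ z, Real.exp (2 * inner ℝ z x) ∂gam n ν = Real.exp (‖x‖ ^ 2) := by
  rw [h.integral_gam]
  have h1 : ∀ z, Real.exp (2 * inner ℝ z x) * Real.exp (-‖z‖ ^ 2) =
      Real.exp (‖x‖ ^ 2) * Real.exp (-dist z x ^ 2) := fun z => by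
    rw [← Real.exp_add, ← Real.exp_add, dist_eq_norm, norm_sub_sq_real]; ring_nf
  simp only [h1]
  rw [integral_const_mul, h.integral_dist hx (g := fun r => Real.exp (-r ^ 2)) (by fun_prop),
    ← gaussMass, mul_div_assoc, div_self h.gaussMass_pos.ne', mul_one]

/-- The rescaling of `ν` by the factor `τ`, normalized to preserve `Unif n`. -/
def scl (n : ℕ) (τ : ℝ) (ν : Measure (Euc d)) : Measure (Euc d) :=
  ENNReal.ofReal (τ ^ n) • ν.map (τ • ·)

theorem scl_closedBall {τ : ℝ} (hτ : 0 < τ) (ν : Measure (Euc d)) (x : Euc d) (r : ℝ) :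
    scl n τ ν (closedBall x r) = ENNReal.ofReal (τ ^ n) * ν (closedBall (τ⁻¹ • x) (τ⁻¹ * r)) := by
  have hm : Measurable fun z : Euc d => τ • z := by fun_prop
  rw [scl, Measure.smul_apply, smul_eq_mul, Measure.map_apply hm measurableSet_closedBall,
    preimage_smul₀ hτ.ne', smul_closedBall' (inv_ne_zero hτ.ne'), Real.norm_of_nonneg (by positivity)]

theorem mem_msupport_scl {τ : ℝ} (hτ : 0 < τ) {x : Euc d} :
    x ∈ msupport (scl n τ ν) ↔ τ⁻¹ • x ∈ msupport ν := by
  have h0 : ENNReal.ofReal (τ ^ n) ≠ 0 := by simp; positivity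
  simp only [msupport, mem_ofPred_eq, scl_closedBall hτ, pos_iff_ne_zero, ne_eq, mul_eq_zero, h0,
    false_or]
  refine ⟨fun H r hr => ?_, fun H r hr => H _ (by positivity)⟩
  simpa [hτ.ne'] using H (τ * r) (by positivity)

theorem smul_mem_msupport_scl {τ : ℝ} (hτ : 0 < τ) {x : Euc d} (hx : x ∈ msupport ν) :
    τ • x ∈ msupport (scl n τ ν) := by
  rw [mem_msupport_scl hτ, smul_smul, inv_mul_cancel₀ hτ.ne', one_smul]; exact hx

theorem Unif.scl (h : Unif n ν) {τ : ℝ} (hτ : 0 < τ) : Unif n (scl n τ ν) := by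
  refine ⟨h.pos, (mem_msupport_scl hτ).2 (by simpa using h.zero_mem), fun x hx r hr => ?_⟩
  rw [scl_closedBall hτ, h.ball _ ((mem_msupport_scl hτ).1 hx) _ (by positivity),
    ← ENNReal.ofReal_mul (by positivity), ← mul_pow, mul_inv_cancel_left₀ hτ.ne']

theorem integral_scl {τ : ℝ} (hτ : 0 < τ) (f : Euc d → ℝ) :
    ∫ z, f z ∂scl n τ ν = τ ^ n * ∫ z, f (τ • z) ∂ν := by
  have he : MeasurableEmbedding fun z : Euc d => τ • z :=
    (Homeomorph.smulOfNeZero τ hτ.ne').measurableEmbedding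
  rw [FlatnessPropagation.scl, integral_smul_measure, he.integral_map,
    ENNReal.toReal_ofReal (by positivity), smul_eq_mul]

theorem Unif.mgf_scl (h : Unif n ν) {τ : ℝ} (hτ : 0 < τ) {x : Euc d} (hx : x ∈ msupport ν) :
    ∫ z, Real.exp (2 * (τ * inner ℝ z x)) ∂gam n (FlatnessPropagation.scl n τ ν) =
      Real.exp (τ ^ 2 * ‖x‖ ^ 2) := by
  have := (h.scl hτ).mgf (smul_mem_msupport_scl hτ hx)
  simpa [inner_smul_right, norm_smul, mul_pow] using this

theorem abs_exp_sub_sum_le (t : ℝ) (m : ℕ) :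
    |Real.exp t - ∑ k ∈ Finset.range m, t ^ k / k.factorial| ≤ |t| ^ m * Real.exp |t| := by
  have := Complex.norm_exp_sub_sum_le_norm_mul_exp (t : ℂ) m
  rw [Complex.norm_real, Real.norm_eq_abs] at this
  rw [← Real.norm_eq_abs, ← Complex.norm_real]
  push_cast
  exact this

/-- A bound for Taylor remainders of exponential moments. -/
theorem Unif.taylor (h : Unif n ν) (x : Euc d) (m : ℕ) {τ : ℝ} (hτ : 0 ≤ τ) (hτ1 : τ ≤ 1) :
    |∫ z, Real.exp (2 * (τ * inner ℝ z x)) ∂gam n ν -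
      ∑ k ∈ Finset.range m, (2 * τ) ^ k / k.factorial * ∫ z, inner ℝ z x ^ k ∂gam n ν| ≤
      m.factorial * expMom n (4 * ‖x‖) * τ ^ m := by
  have hk : ∀ k ∈ Finset.range m,
      ExpGrowth (fun z : Euc d => (2 * τ) ^ k / k.factorial * inner ℝ z x ^ k) := fun k _ =>
    (ExpGrowth.const _).mul ((ExpGrowth.inner_right x).pow k)
  have he : ExpGrowth (fun z : Euc d => Real.exp (2 * (τ * inner ℝ z x))) := by
    simpa [mul_assoc] using ExpGrowth.exp_inner (2 * τ) x
  simp only [← integral_const_mul]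
  rw [← integral_finsetSum _ fun k hk' => h.integrable (hk k hk'),
    ← integral_sub (h.integrable he) (h.integrable (ExpGrowth.sum _ hk))]
  rw [show m.factorial * expMom n (4 * ‖x‖) * τ ^ m = m.factorial * τ ^ m * expMom n (4 * ‖x‖) by
    ring]
  refine h.abs_integral_le fun z => ?_
  have e1 : ∀ k, (2 * τ) ^ k / k.factorial * inner ℝ z x ^ k =
      (2 * (τ * inner ℝ z x)) ^ k / k.factorial := fun k => by ring
  simp only [e1]
  refine (abs_exp_sub_sum_le _ m).trans ?_
  set A := ‖z‖ * ‖x‖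
  have hA : 0 ≤ A := by positivity
  have h1 : |2 * (τ * inner ℝ z x)| ≤ τ * (2 * A) := by
    rw [abs_mul, abs_mul, abs_of_nonneg hτ, abs_two]
    have := abs_real_inner_le_norm z x
    nlinarith
  have h2 : τ * (2 * A) ≤ 2 * A := by nlinarith
  have h3 : (2 * A) ^ m ≤ m.factorial * Real.exp (2 * A) := by
    have := Real.pow_div_factorial_le_exp (2 * A) (by positivity) m
    rwa [div_le_iff₀' (by positivity)] at this
  calc |2 * (τ * inner ℝ z x)| ^ m * Real.exp |2 * (τ * inner ℝ z x)|
      ≤ (τ * (2 * A)) ^ m * Real.exp (2 * A) := by gcongr; linarith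
    _ = τ ^ m * (2 * A) ^ m * Real.exp (2 * A) := by rw [mul_pow]
    _ ≤ τ ^ m * (m.factorial * Real.exp (2 * A)) * Real.exp (2 * A) := by gcongr
    _ = m.factorial * τ ^ m * (Real.exp (2 * A) * Real.exp (2 * A)) := by ring
    _ = _ := by rw [← Real.exp_add]; ring_nf; simp only [A]; ring_nf

end

section

variable {d n : ℕ}

theorem exists_ultralimit {ι E : Type*} [PseudoMetricSpace E] [ProperSpace E] (U : Ultrafilter ι)
    {f : ι → E} {x : E} {M : ℝ} (hM : ∀ᶠ i in U, dist (f i) x ≤ M) :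
    ∃ a, Tendsto f U (𝓝 a) := by
  have h := (isCompact_closedBall x M).ultrafilter_le_nhds (U.map f)
    (by rw [le_principal_iff]; exact hM)
  obtain ⟨a, -, ha⟩ := h
  exact ⟨a, ha⟩

theorem exists_ultralimit_real {ι : Type*} (U : Ultrafilter ι)
    {f : ι → ℝ} {M : ℝ} (hM : ∀ᶠ i in U, |f i| ≤ M) : ∃ a, Tendsto f U (𝓝 a) :=
  exists_ultralimit U (x := 0) (M := M) (by simpa using hM)

/-- A continuous cutoff function equal to `1` on `closedBall x a` and to `0` outside
`closedBall x b`. -/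
def tent (x : Euc d) (a b : ℝ) (z : Euc d) : ℝ := max 0 (min 1 ((b - dist z x) / (b - a)))

theorem continuous_tent (x : Euc d) (a b : ℝ) : Continuous (tent x a b) := by
  unfold tent; fun_prop

theorem tent_nonneg (x : Euc d) (a b : ℝ) (z : Euc d) : 0 ≤ tent x a b z := le_max_left _ _

theorem tent_le_one (x : Euc d) (a b : ℝ) (z : Euc d) : tent x a b z ≤ 1 :=
  max_le zero_le_one (min_le_left _ _)

theorem tent_eq_one {x : Euc d} {a b : ℝ} (hab : a < b) {z : Euc d} (hz : dist z x ≤ a) :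
    tent x a b z = 1 := by
  have : 1 ≤ (b - dist z x) / (b - a) := by rw [one_le_div (by linarith)]; linarith
  rw [tent, min_eq_left this, max_eq_right zero_le_one]

theorem tent_eq_zero {x : Euc d} {a b : ℝ} (hab : a < b) {z : Euc d} (hz : b ≤ dist z x) :
    tent x a b z = 0 := by
  have : (b - dist z x) / (b - a) ≤ 0 := div_nonpos_of_nonpos_of_nonneg (by linarith) (by linarith)
  exact max_eq_left ((min_le_right _ _).trans this)

theorem hasCompactSupport_tent (x : Euc d) {a b : ℝ} (hab : a < b) :
    HasCompactSupport (tent x a b) :=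
  HasCompactSupport.intro (isCompact_closedBall x b) fun z hz =>
    tent_eq_zero hab (by rw [mem_closedBall, not_le] at hz; exact hz.le)

theorem integral_tent_le {μ : Measure (Euc d)} [IsLocallyFiniteMeasure μ] (x : Euc d) {a b : ℝ}
    (hab : a < b) : ∫ z, tent x a b z ∂μ ≤ μ.real (closedBall x b) := by
  rw [← integral_indicator_one measurableSet_closedBall]
  refine integral_mono ((continuous_tent x a b).integrable_of_hasCompactSupport
    (hasCompactSupport_tent x hab)) ((integrable_indicator_iff measurableSet_closedBall).2
    (integrableOn_const (isCompact_closedBall x b).measure_lt_top.ne)) fun z => ?_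
  by_cases hz : z ∈ closedBall x b
  · simpa [hz] using tent_le_one x a b z
  · simp only [hz, not_false_eq_true, indicator_of_notMem]
    rw [mem_closedBall, not_le] at hz
    exact (tent_eq_zero hab hz.le).le

theorem le_integral_tent {μ : Measure (Euc d)} [IsLocallyFiniteMeasure μ] (x : Euc d) {a b : ℝ}
    (hab : a < b) : μ.real (closedBall x a) ≤ ∫ z, tent x a b z ∂μ := by
  rw [← integral_indicator_one measurableSet_closedBall]
  refine integral_mono ((integrable_indicator_iff measurableSet_closedBall).2
    (integrableOn_const (isCompact_closedBall x a).measure_lt_top.ne))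
    ((continuous_tent x a b).integrable_of_hasCompactSupport
    (hasCompactSupport_tent x hab)) fun z => ?_
  by_cases hz : z ∈ closedBall x a
  · simp [hz, tent_eq_one hab (mem_closedBall.1 hz)]
  · simpa [hz] using tent_nonneg x a b z

/-- Uniform density bounds along a filter for a family of measures. -/
structure AsympUnif {ι : Type*} (n : ℕ) (F : Filter ι) (ν : ι → Measure (Euc d)) : Prop where
  pos : 0 < n
  locFin : ∀ i, IsLocallyFiniteMeasure (ν i)
  zero_mem : ∀ᶠ i in F, 0 ∈ msupport (ν i)
  ball : ∀ R r : ℝ, 0 < r → ∀ ε : ℝ, 0 < ε → ∀ᶠ i in F, ∀ x ∈ msupport (ν i) ∩ closedBall 0 R,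
    |(ν i).real (closedBall x r) - r ^ n| ≤ ε

open scoped CompactlySupported in
theorem AsympUnif.exists_weakLimit {ι : Type*} {U : Ultrafilter ι} {ν : ι → Measure (Euc d)}
    (h : AsympUnif n U ν) : ∃ lam : Measure (Euc d), IsLocallyFiniteMeasure lam ∧
      ∀ f : Euc d → ℝ, Continuous f → HasCompactSupport f →
        Tendsto (fun i => ∫ z, f z ∂ν i) U (𝓝 (∫ z, f z ∂lam)) := by
  have := h.locFin
  have hex : ∀ f : C_c(Euc d, ℝ), ∃ a, Tendsto (fun i => ∫ z, f z ∂ν i) U (𝓝 a) := by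
    intro f
    obtain ⟨R, hR⟩ := f.hasCompactSupport'.isCompact.isBounded.subset_closedBall (0 : Euc d)
    have hR' : ∀ z ∉ closedBall (0 : Euc d) (max R 1), f z = 0 := fun z hz =>
      image_eq_zero_of_notMem_tsupport fun hz' =>
        hz (closedBall_subset_closedBall (le_max_left _ _) (hR hz'))
    obtain ⟨C, hC⟩ := f.hasCompactSupport'.exists_bound_of_continuous f.continuous
    refine exists_ultralimit_real U (M := C * (max R 1 ^ n + 1)) ?_
    filter_upwards [h.zero_mem, h.ball 0 (max R 1) (by positivity) 1 one_pos] with i hi0 hi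
    have h1 := hi 0 ⟨hi0, by simp⟩
    rw [← setIntegral_eq_integral_of_forall_compl_eq_zero hR', ← Real.norm_eq_abs]
    refine (norm_setIntegral_le_of_norm_le_const (C := C)
      (isCompact_closedBall _ _).measure_lt_top fun z _ => hC z).trans ?_
    have hC0 : 0 ≤ C := (norm_nonneg _).trans (hC 0)
    gcongr
    linarith [(abs_le.1 h1).2]
  choose L hL using hex
  have hinner : ∀ (f : C_c(Euc d, ℝ)) i, Integrable f (ν i) := fun f i =>
    f.continuous.integrable_of_hasCompactSupport f.hasCompactSupport'
  let Λ : C_c(Euc d, ℝ) →ₚ[ℝ] ℝ := PositiveLinearMap.mk₀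
    { toFun := L
      map_add' := fun f g => tendsto_nhds_unique (hL (f + g)) (by
        simpa only [CompactlySupportedContinuousMap.coe_add, Pi.add_apply,
          integral_add (hinner f _) (hinner g _)] using (hL f).add (hL g))
      map_smul' := fun c f => tendsto_nhds_unique (hL (c • f)) (by
        simpa only [CompactlySupportedContinuousMap.coe_smul, Pi.smul_apply, smul_eq_mul,
          integral_const_mul, RingHom.id_apply] using (hL f).const_mul c) }
    fun f hf => ge_of_tendsto' (hL f) fun i => integral_nonneg hf
  refine ⟨RealRMK.rieszMeasure Λ, inferInstance, fun f hf hfc => ?_⟩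
  have := RealRMK.integral_rieszMeasure Λ ⟨⟨f, hf⟩, hfc⟩
  exact (congrArg 𝓝 this).symm ▸ hL ⟨⟨f, hf⟩, hfc⟩

theorem AsympUnif.exists_limit {ι : Type*} {U : Ultrafilter ι} {ν : ι → Measure (Euc d)}
    (h : AsympUnif n U ν) : ∃ lam : Measure (Euc d), Unif n lam ∧
      (∀ f : Euc d → ℝ, Continuous f → HasCompactSupport f →
        Tendsto (fun i => ∫ z, f z ∂ν i) U (𝓝 (∫ z, f z ∂lam))) ∧
      ∀ x, x ∈ msupport lam ↔ ∀ ε > 0, ∀ᶠ i in U, ∃ y ∈ msupport (ν i), dist y x < ε := by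
  have := h.locFin
  obtain ⟨lam, hlam, hf⟩ := h.exists_weakLimit
  have ht : ∀ (x : Euc d) {a b : ℝ}, a < b → Tendsto (fun i => ∫ z, tent x a b z ∂ν i) U
      (𝓝 (∫ z, tent x a b z ∂lam)) := fun x a b hab =>
    hf _ (continuous_tent x a b) (hasCompactSupport_tent x hab)
  have fin : ∀ i (x : Euc d) r, ν i (closedBall x r) ≠ ∞ := fun i x r =>
    (isCompact_closedBall x r).measure_lt_top.ne
  have finl : ∀ (x : Euc d) r, lam (closedBall x r) ≠ ∞ := fun x r =>
    (isCompact_closedBall x r).measure_lt_top.ne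
  have hs : ∀ x, x ∈ msupport lam → ∀ ε > 0, ∀ᶠ i in U, ∃ y ∈ msupport (ν i), dist y x < ε := by
    intro x hx ε hε
    by_contra hcon
    rw [← Ultrafilter.eventually_not] at hcon
    have h0 : ∫ z, tent x (ε / 2) ε z ∂lam = 0 := by
      refine tendsto_nhds_unique (ht x (by linarith)) (tendsto_const_nhds.congr' ?_)
      filter_upwards [hcon] with i hi
      push Not at hi
      refine (integral_eq_zero_of_ae ?_).symm
      filter_upwards [ae_mem_msupport (ν i)] with z hz
      exact tent_eq_zero (by linarith) (hi z hz)
    have h1 := le_integral_tent (μ := lam) x (a := ε / 2) (b := ε) (by linarith)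
    have h2 : 0 < lam.real (closedBall x (ε / 2)) :=
      ENNReal.toReal_pos (hx _ (by linarith)).ne' (finl _ _)
    linarith
  have hn := h.pos
  have up : ∀ x, (∀ ε > 0, ∀ᶠ i in U, ∃ y ∈ msupport (ν i), dist y x < ε) → ∀ a b ε : ℝ, 0 < a →
      a < b → 0 < ε → lam.real (closedBall x a) ≤ b ^ n + ε := by
    intro x hx a b ε ha hab hε
    refine (le_integral_tent x (b := (a + b) / 2) (by linarith)).trans
      (le_of_tendsto (ht x (by linarith)) ?_)
    filter_upwards [hx ((b - a) / 2) (by linarith),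
      h.ball (‖x‖ + (b - a) / 2) b (by linarith) ε hε] with i ⟨y, hy, hyx⟩ hi
    have := hi y ⟨hy, by
      rw [mem_closedBall, dist_zero_right]; have := norm_le_norm_add_norm_sub x y
      rw [dist_eq_norm] at hyx; linarith [norm_sub_rev x y]⟩
    refine (integral_tent_le x (by linarith)).trans ((measureReal_mono ?_ (fin _ _ _)).trans
      (by linarith [(abs_le.1 this).2] : (ν i).real (closedBall y b) ≤ _))
    refine closedBall_subset_closedBall' ?_
    rw [dist_comm]; linarith
  have low : ∀ x, (∀ ε > 0, ∀ᶠ i in U, ∃ y ∈ msupport (ν i), dist y x < ε) → ∀ a b ε : ℝ, 0 < a →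
      a < b → 0 < ε → a ^ n - ε ≤ lam.real (closedBall x b) := by
    intro x hx a b ε ha hab hε
    refine (ge_of_tendsto (ht x (a := (a + b) / 2) (by linarith)) ?_).trans
      (integral_tent_le x (b := b) (by linarith))
    filter_upwards [hx ((b - a) / 2) (by linarith),
      h.ball (‖x‖ + (b - a) / 2) a (by linarith) ε hε] with i ⟨y, hy, hyx⟩ hi
    have := hi y ⟨hy, by
      rw [mem_closedBall, dist_zero_right]; have := norm_le_norm_add_norm_sub x y
      rw [dist_eq_norm] at hyx; linarith [norm_sub_rev x y]⟩
    refine (by linarith [(abs_le.1 this).1] : _ ≤ (ν i).real (closedBall y a)).trans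
      ((measureReal_mono ?_ (fin _ _ _)).trans (le_integral_tent x (by linarith)))
    refine closedBall_subset_closedBall' ?_
    linarith
  have hsupp : ∀ x, x ∈ msupport lam ↔ ∀ ε > 0, ∀ᶠ i in U, ∃ y ∈ msupport (ν i), dist y x < ε := by
    refine fun x => ⟨hs x, fun hx r hr => ?_⟩
    have h1 := low x hx (r / 2) r ((r / 2) ^ n / 2) (by linarith) (by linarith) (by positivity)
    have h2 : 0 < (r / 2) ^ n / 2 := by positivity
    exact (ENNReal.toReal_pos_iff.1 (lt_of_lt_of_le (by linarith) h1)).1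
  refine ⟨lam, ⟨hn, ?_, fun x hx r hr => ?_⟩, hf, hsupp⟩
  · rw [hsupp]
    intro ε hε
    filter_upwards [h.zero_mem] with i hi
    exact ⟨0, hi, by simpa⟩
  · have hx' := hs x hx
    rw [← ENNReal.ofReal_toReal (finl x r)]
    congr 1
    change lam.real (closedBall x r) = _
    apply le_antisymm
    · have hc : Tendsto (fun t : ℝ => (r + t) ^ n + t) (𝓝[>] 0) (𝓝 ((r + 0) ^ n + 0)) :=
        Tendsto.mono_left (Continuous.tendsto (by fun_prop) 0) nhdsWithin_le_nhds
      rw [add_zero, add_zero] at hc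
      refine ge_of_tendsto hc ?_
      filter_upwards [self_mem_nhdsWithin] with t ht
      exact up x hx' r (r + t) t hr (by linarith [mem_Ioi.1 ht]) ht
    · have hc : Tendsto (fun t : ℝ => (r - t) ^ n - t) (𝓝[>] 0) (𝓝 ((r - 0) ^ n - 0)) :=
        Tendsto.mono_left (Continuous.tendsto (by fun_prop) 0) nhdsWithin_le_nhds
      rw [sub_zero, sub_zero] at hc
      refine le_of_tendsto hc ?_
      filter_upwards [Ioo_mem_nhdsGT hr] with t ht
      exact low x hx' (r - t) r t (by linarith [ht.2]) (by linarith [ht.1]) ht.1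

theorem Unif.asympUnif {ι : Type*} (hn : 0 < n) {F : Filter ι} {ν : ι → Measure (Euc d)}
    (h : ∀ i, Unif n (ν i)) : AsympUnif n F ν := by
  refine ⟨hn, fun i => (h i).isLocallyFinite, Eventually.of_forall fun i => (h i).zero_mem,
    fun R r hr ε hε => Eventually.of_forall fun i x hx => ?_⟩
  rw [measureReal_def, (h i).ball x hx.1 r hr, ENNReal.toReal_ofReal (by positivity), sub_self,
    abs_zero]
  exact hε.le

theorem Unif.tendsto_gam {ι : Type*} {F : Filter ι} {ν : ι → Measure (Euc d)}
    {lam : Measure (Euc d)} (h : ∀ i, Unif n (ν i)) (hl : Unif n lam)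
    (hf : ∀ f : Euc d → ℝ, Continuous f → HasCompactSupport f →
        Tendsto (fun i => ∫ z, f z ∂ν i) F (𝓝 (∫ z, f z ∂lam))) {f : Euc d → ℝ}
    (hfg : ExpGrowth f) :
    Tendsto (fun i => ∫ z, f z ∂gam n (ν i)) F (𝓝 (∫ z, f z ∂gam n lam)) := by
  obtain ⟨C, a, hC, ha, hb⟩ := hfg.bound
  have tEG : ∀ R, ExpGrowth (tent (0 : Euc d) R (R + 1)) := fun R =>
    ⟨continuous_tent _ _ _, 1, 0, by simp, by simp, fun z => by
      rw [abs_of_nonneg (tent_nonneg _ _ _ _)]; simpa using tent_le_one _ _ _ _⟩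
  have key : ∀ R, ∀ μ : Measure (Euc d), Unif n μ →
      |∫ z, f z ∂gam n μ - ∫ z, f z * tent 0 R (R + 1) z ∂gam n μ| ≤
        C * Real.exp (-R) * expMom n (a + 1) := by
    intro R μ hμ
    rw [← integral_sub (hμ.integrable hfg) (hμ.integrable (hfg.mul (tEG R)))]
    refine hμ.abs_integral_le fun z => ?_
    rw [show f z - f z * tent 0 R (R + 1) z = f z * (1 - tent 0 R (R + 1) z) by ring, abs_mul,
      abs_of_nonneg (sub_nonneg.2 (tent_le_one _ _ _ _))]
    have h2 : 1 - tent 0 R (R + 1) z ≤ Real.exp (‖z‖ - R) := by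
      rcases le_or_gt ‖z‖ R with hz | hz
      · rw [tent_eq_one (by linarith) (by simpa using hz), sub_self]; positivity
      · have := Real.one_le_exp (x := ‖z‖ - R) (by linarith)
        linarith [tent_nonneg 0 R (R + 1) z]
    calc |f z| * (1 - tent 0 R (R + 1) z) ≤ C * Real.exp (a * ‖z‖) * Real.exp (‖z‖ - R) :=
          mul_le_mul (hb z) h2 (sub_nonneg.2 (tent_le_one _ _ _ _)) (by positivity)
      _ = _ := by
          rw [mul_assoc, mul_assoc, ← Real.exp_add, ← Real.exp_add]; ring_nf
  have hcut : ∀ R, Tendsto (fun i => ∫ z, f z * tent 0 R (R + 1) z ∂gam n (ν i)) F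
      (𝓝 (∫ z, f z * tent 0 R (R + 1) z ∂gam n lam)) := by
    intro R
    have hc := (tEG R).cont
    have hfc := hfg.cont
    rw [hl.integral_gam]
    simp only [(h _).integral_gam]
    refine (hf _ (by fun_prop) ?_).div_const _
    exact ((hasCompactSupport_tent 0 (by linarith : R < R + 1)).mul_left (f := f)).mul_right
  rw [Metric.tendsto_nhds]
  intro ε hε
  obtain ⟨R, hR⟩ : ∃ R : ℝ, C * Real.exp (-R) * expMom n (a + 1) < ε / 3 := by
    have : Tendsto (fun R : ℝ => C * Real.exp (-R) * expMom n (a + 1)) atTop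
        (𝓝 (C * 0 * expMom n (a + 1))) :=
      ((Real.tendsto_exp_neg_atTop_nhds_zero).const_mul C).mul_const _
    rw [mul_zero, zero_mul] at this
    exact (this.eventually (gt_mem_nhds (by linarith))).exists
  filter_upwards [Metric.tendsto_nhds.1 (hcut R) (ε / 3) (by linarith)] with i hi
  have h1 := key R (ν i) (h i)
  have h2 := key R lam hl
  rw [Real.dist_eq] at hi ⊢
  rw [abs_lt] at *
  rw [abs_le] at h1 h2
  constructor <;> linarith [h1.1, h1.2, h2.1, h2.2, hi.1, hi.2]

end

section

variable {d n : ℕ}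

theorem msupport_eq_of_subset {lam : Measure (Euc d)} (h : Unif n lam)
    (V : Submodule ℝ (Euc d)) (hV : Module.finrank ℝ V = n) (hs : msupport lam ⊆ V) :
    msupport lam = V := by
  have := h.isLocallyFinite
  refine hs.antisymm fun x₀ hx₀ => ?_
  by_contra hx
  obtain ⟨δ, hδ, hball⟩ := Metric.isOpen_iff.1 (isClosed_msupport lam).isOpen_compl x₀ hx
  set ε := δ / 2 with hε
  have hε0 : 0 < ε := by positivity
  set r := ‖x₀‖ + 2 * ε with hr
  have hr0 : 0 < r := by positivity
  set κ : ℝ≥0∞ := volume (closedBall (0 : V) 1) with hκ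
  have hκ0 : κ ≠ 0 := (measure_closedBall_pos _ _ one_pos).ne'
  have hκt : κ ≠ ∞ := (isCompact_closedBall _ _).measure_lt_top.ne
  have hvol : ∀ (x : V) {ρ : ℝ}, 0 ≤ ρ → volume (closedBall x ρ) = ENNReal.ofReal (ρ ^ n) * κ := by
    intro x ρ hρ
    rw [Measure.addHaar_closedBall' _ _ hρ, hV]
  obtain ⟨t, ρ, htc, hts, htr, hcov, hdisj⟩ := Besicovitch.exists_disjoint_closedBall_covering_ae lam
    (fun _ => univ) (msupport lam ∩ ball 0 r) (fun x _ δ hδ => by simpa using hδ)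
    (fun x => min ε (r - ‖x‖)) (fun x hx => by
      have := hx.2; rw [mem_ball, dist_zero_right] at this
      exact lt_min hε0 (by linarith))
  have hρ0 : ∀ x ∈ t, 0 < ρ x := fun x hx => (htr x hx).2.1
  have hρ1 : ∀ x ∈ t, ρ x < ε ∧ ρ x < r - ‖x‖ := fun x hx => lt_min_iff.1 (htr x hx).2.2
  have h1 : lam (ball 0 r) ≤ ∑' x : t, ENNReal.ofReal (ρ x ^ n) := by
    calc lam (ball 0 r) ≤ lam (((msupport lam ∩ ball 0 r) \ ⋃ x ∈ t, closedBall x (ρ x)) ∪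
          (msupport lam)ᶜ ∪ ⋃ x ∈ t, closedBall x (ρ x)) := by
          refine measure_mono fun z hz => ?_
          by_cases h1 : z ∈ msupport lam <;> by_cases h2 : z ∈ ⋃ x ∈ t, closedBall x (ρ x) <;>
            simp only [mem_union, Set.mem_sdiff, mem_inter_iff, mem_compl_iff, h1, h2, hz] <;> tauto
      _ ≤ 0 + 0 + lam (⋃ x ∈ t, closedBall x (ρ x)) := by
          refine (measure_union_le _ _).trans (add_le_add ((measure_union_le _ _).trans
            (add_le_add hcov.le (measure_compl_msupport lam).le)) le_rfl)
      _ ≤ ∑' x : t, lam (closedBall x.1 (ρ x)) := by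
          rw [zero_add, zero_add]; exact measure_biUnion_le lam htc _
      _ = _ := tsum_congr fun x => h.ball _ (hts x.2).1 _ (hρ0 x x.2)
  have hcount : Countable t := htc
  have h2 : (∑' x : t, ENNReal.ofReal (ρ x ^ n)) * κ + ENNReal.ofReal (ε ^ n) * κ ≤
      ENNReal.ofReal (r ^ n) * κ := by
    have e : ∀ x : t, ENNReal.ofReal (ρ x ^ n) * κ =
        volume (closedBall (⟨x.1, hs (hts x.2).1⟩ : V) (ρ x)) := fun x => (hvol _ (hρ0 x x.2).le).symm
    rw [← ENNReal.tsum_mul_right, tsum_congr e, ← hvol ⟨x₀, hx₀⟩ hε0.le, ← hvol 0 hr0.le,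
      ← measure_iUnion ?_ fun _ => measurableSet_closedBall, ← measure_union ?_
        measurableSet_closedBall]
    · refine measure_mono (union_subset (iUnion_subset fun x => ?_) ?_)
      · refine closedBall_subset_closedBall' ?_
        have := hρ1 x x.2
        rw [dist_zero_right, Submodule.coe_norm]; linarith
      · refine closedBall_subset_closedBall' ?_
        rw [dist_zero_right, Submodule.coe_norm]; linarith
    · rw [disjoint_iUnion_left]
      refine fun x => closedBall_disjoint_closedBall ?_
      rw [Subtype.dist_eq]
      have h3 := (hρ1 x x.2).1
      by_contra h4
      refine hball ?_ (hts x.2).1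
      rw [mem_ball]; linarith
    · intro x y hxy
      have := hdisj x.2 y.2 fun e => hxy (Subtype.ext e)
      have := this.preimage ((↑) : V → Euc d)
      exact this
  have h3 : ∀ r' : ℝ, 0 < r' → r' < r → r' ^ n + ε ^ n ≤ r ^ n := by
    intro r' h0 hlt
    have h4 : ENNReal.ofReal (r' ^ n) * κ + ENNReal.ofReal (ε ^ n) * κ ≤
        ENNReal.ofReal (r ^ n) * κ := by
      refine le_trans ?_ h2
      gcongr
      rw [← h.ball 0 h.zero_mem r' h0]
      exact (measure_mono (closedBall_subset_ball hlt)).trans h1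
    rw [← add_mul, ENNReal.mul_le_mul_iff_left hκ0 hκt, ← ENNReal.ofReal_add (by positivity)
      (by positivity), ENNReal.ofReal_le_ofReal_iff (by positivity)] at h4
    exact h4
  have h5 : Tendsto (fun r' : ℝ => r' ^ n + ε ^ n) (𝓝[<] r) (𝓝 (r ^ n + ε ^ n)) :=
    Tendsto.mono_left (Continuous.tendsto (by fun_prop) r) nhdsWithin_le_nhds
  have h6 := le_of_tendsto h5 (by
    filter_upwards [Ioo_mem_nhdsLT hr0] with r' hr' using h3 r' hr'.1 hr'.2)
  have : 0 < ε ^ n := by positivity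
  linarith

end

section

variable {d n : ℕ}

theorem msupport_subset_of_ae {μ : Measure (Euc d)} {s : Set (Euc d)} (hs : IsClosed s)
    (h : ∀ᵐ z ∂μ, z ∈ s) : msupport μ ⊆ s := by
  intro x hx
  by_contra hxs
  obtain ⟨δ, hδ, hb⟩ := Metric.isOpen_iff.1 hs.isOpen_compl x hxs
  have h1 : μ (closedBall x (δ / 2)) = 0 :=
    measure_mono_null ((closedBall_subset_ball (by linarith)).trans hb) h
  exact (hx (δ / 2) (by linarith)).ne' h1

theorem Unif.absolutelyContinuous_gam {ν : Measure (Euc d)} (h : Unif n ν) : ν ≪ gam n ν := by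
  have := h.gaussMass_pos
  exact withDensity_absolutelyContinuous' (by fun_prop) (Eventually.of_forall fun z => by
    simp only [ne_eq, ENNReal.ofReal_eq_zero, not_le]; positivity)

/-- The component of `z` orthogonal to the orthonormal family `v`. -/
def res (v : Fin n → Euc d) (z : Euc d) : Euc d := z - ∑ a, inner ℝ (v a) z • v a

theorem continuous_res (v : Fin n → Euc d) : Continuous (res v) := by
  unfold res; fun_prop

theorem inner_res {v : Fin n → Euc d} (hv : Orthonormal ℝ v) (a : Fin n) (z : Euc d) :
    inner ℝ (v a) (res v z) = 0 := by
  rw [res, inner_sub_right, hv.inner_right_fintype, sub_self]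

theorem norm_res_sq {v : Fin n → Euc d} (hv : Orthonormal ℝ v) (z : Euc d) :
    ‖res v z‖ ^ 2 = ‖z‖ ^ 2 - ∑ a, inner ℝ (v a) z ^ 2 := by
  have h1 : inner ℝ (res v z) (res v z) = inner ℝ z (res v z) := by
    have e : inner ℝ (∑ a, inner ℝ (v a) z • v a) (res v z) = 0 := by
      rw [sum_inner]
      simp only [inner_smul_left, inner_res hv, mul_zero, Finset.sum_const_zero]
    conv_lhs => enter [2]; rw [res]
    rw [inner_sub_left, e, sub_zero]
  rw [← real_inner_self_eq_norm_sq, h1, res, inner_sub_right, inner_sum, real_inner_self_eq_norm_sq]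
  congr 2 with a
  rw [inner_smul_right, real_inner_comm z]; ring

theorem sum_inner_sq_le {v : Fin n → Euc d} (hv : Orthonormal ℝ v) (z : Euc d) :
    ∑ a, inner ℝ (v a) z ^ 2 ≤ ‖z‖ ^ 2 := by
  have := norm_res_sq hv z
  nlinarith [sq_nonneg ‖res v z‖]

theorem res_eq_zero_iff {v : Fin n → Euc d} (hv : Orthonormal ℝ v) (z : Euc d) :
    res v z = 0 ↔ z ∈ Submodule.span ℝ (range v) := by
  constructor
  · intro h
    rw [res, sub_eq_zero] at h
    rw [h]
    exact Submodule.sum_mem _ fun a _ => Submodule.smul_mem _ _ (Submodule.subset_span ⟨a, rfl⟩)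
  · intro h
    obtain ⟨c, rfl⟩ := (Submodule.mem_span_range_iff_exists_fun ℝ).1 h
    rw [res, sub_eq_zero]
    refine Finset.sum_congr rfl fun a _ => ?_
    rw [hv.inner_right_fintype]

theorem finrank_span_orthonormal {v : Fin n → Euc d} (hv : Orthonormal ℝ v) :
    Module.finrank ℝ (Submodule.span ℝ (range v)) = n := by
  rw [finrank_span_eq_card hv.linearIndependent, Fintype.card_fin]

theorem ExpGrowth.norm_res_sq {v : Fin n → Euc d} (hv : Orthonormal ℝ v) :
    ExpGrowth fun z => ‖res v z‖ ^ 2 := by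
  simp only [FlatnessPropagation.norm_res_sq hv]
  exact (ExpGrowth.norm.pow 2).sub (ExpGrowth.sum _ fun a _ => (ExpGrowth.inner_left _).pow 2)

theorem Unif.exists_limit {ι : Type*} (U : Ultrafilter ι) {ν : ι → Measure (Euc d)}
    (h : ∀ i, Unif n (ν i)) : ∃ lam : Measure (Euc d), Unif n lam ∧
      (∀ f, ExpGrowth f → Tendsto (fun i => ∫ z, f z ∂gam n (ν i)) U (𝓝 (∫ z, f z ∂gam n lam))) ∧
      ∀ x, x ∈ msupport lam ↔ ∀ ε > 0, ∀ᶠ i in U, ∃ y ∈ msupport (ν i), dist y x < ε := by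
  obtain ⟨i, -⟩ := U.nonempty_of_mem univ_mem
  obtain ⟨lam, hl, hf, hs⟩ := (Unif.asympUnif (F := (U : Filter ι)) (h i).pos h).exists_limit
  exact ⟨lam, hl, fun f hfg => Unif.tendsto_gam h hl hf hfg, hs⟩

theorem Unif.msupport_eq_span {lam : Measure (Euc d)} (h : Unif n lam) {v : Fin n → Euc d}
    (hv : Orthonormal ℝ v) (h0 : ∫ z, ‖res v z‖ ^ 2 ∂gam n lam = 0) :
    msupport lam = Submodule.span ℝ (range v) := by
  refine msupport_eq_of_subset h _ (finrank_span_orthonormal hv)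
    (msupport_subset_of_ae (Submodule.closed_of_finiteDimensional _) ?_)
  rw [integral_eq_zero_iff_of_nonneg (fun _ => by positivity)
    (h.integrable (ExpGrowth.norm_res_sq hv))] at h0
  filter_upwards [h.absolutelyContinuous_gam.ae_le h0] with z hz
  simp only [Pi.zero_apply] at hz
  exact (res_eq_zero_iff hv z).1 (by simpa using hz)

theorem exists_plane_limit {ι : Type*} (U : Ultrafilter ι) {ν : ι → Measure (Euc d)}
    (h : ∀ i, Unif n (ν i)) {v : Fin n → Euc d} (hv : Orthonormal ℝ v)
    (h0 : Tendsto (fun i => ∫ z, ‖res v z‖ ^ 2 ∂gam n (ν i)) U (𝓝 0)) :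
    ∃ lam : Measure (Euc d), Unif n lam ∧ msupport lam = Submodule.span ℝ (range v) ∧
      (∀ f, ExpGrowth f → Tendsto (fun i => ∫ z, f z ∂gam n (ν i)) U (𝓝 (∫ z, f z ∂gam n lam))) ∧
      ∀ x ∈ Submodule.span ℝ (range v), ∀ ε > 0,
        ∀ᶠ i in U, ∃ y ∈ msupport (ν i), dist y x < ε := by
  obtain ⟨lam, hl, hf, hs⟩ := Unif.exists_limit U h
  have h1 := tendsto_nhds_unique (hf _ (ExpGrowth.norm_res_sq hv)) h0
  have h2 := hl.msupport_eq_span hv h1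
  exact ⟨lam, hl, h2, hf, fun x hx => (hs x).1 (by rw [h2]; exact hx)⟩

theorem coeff_eq_zero_of_bound (m : ℕ) : ∀ (a : ℕ → ℝ) (C : ℝ),
    (∀ τ : ℝ, 0 < τ → τ ≤ 1 → |∑ k ∈ Finset.range m, a k * τ ^ k| ≤ C * τ ^ m) →
    ∀ k < m, a k = 0 := by
  induction m with
  | zero => intro a C _ k hk; omega
  | succ m ih =>
    intro a C h
    have h0 : a 0 = 0 := by
      have t1 : Tendsto (fun τ : ℝ => ∑ k ∈ Finset.range (m + 1), a k * τ ^ k) (𝓝[>] 0)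
          (𝓝 (∑ k ∈ Finset.range (m + 1), a k * (0 : ℝ) ^ k)) :=
        Tendsto.mono_left (Continuous.tendsto (by fun_prop) 0) nhdsWithin_le_nhds
      have t2 : Tendsto (fun τ : ℝ => C * τ ^ (m + 1)) (𝓝[>] 0) (𝓝 (C * 0 ^ (m + 1))) :=
        Tendsto.mono_left (Continuous.tendsto (by fun_prop) 0) nhdsWithin_le_nhds
      have t3 := le_of_tendsto_of_tendsto t1.abs t2 (by
        filter_upwards [Ioo_mem_nhdsGT one_pos] with τ hτ using h τ hτ.1 hτ.2.le)
      rw [Finset.sum_range_succ'] at t3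
      simpa using t3
    intro k hk
    rcases k with _ | k
    · exact h0
    · refine ih (fun k => a (k + 1)) C (fun τ hτ hτ1 => ?_) k (by omega)
      have := h τ hτ hτ1
      rw [Finset.sum_range_succ', h0] at this
      simp only [zero_mul, add_zero, pow_succ, ← mul_assoc] at this
      rw [← Finset.sum_mul, abs_mul, abs_of_pos hτ] at this
      exact le_of_mul_le_mul_right this hτ

theorem Unif.moment_two_four {lam : Measure (Euc d)} (h : Unif n lam) {V : Submodule ℝ (Euc d)}
    (hV : msupport lam = V) {x : Euc d} (hx : x ∈ V) :
    ∫ z, inner ℝ z x ^ 2 ∂gam n lam = ‖x‖ ^ 2 / 2 ∧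
      ∫ z, inner ℝ z x ^ 4 ∂gam n lam = 3 / 4 * (‖x‖ ^ 2) ^ 2 := by
  set m : ℕ → ℝ := fun k => ∫ z, inner ℝ z x ^ k ∂gam n lam with hm
  set c : ℕ → ℝ := fun k => 2 ^ k / k.factorial * m k -
    (if k = 0 then 1 else if k = 2 then ‖x‖ ^ 2 else if k = 4 then (‖x‖ ^ 2) ^ 2 / 2 else 0) with hc
  have key := coeff_eq_zero_of_bound 5 c
    (Nat.factorial 5 * expMom n (4 * ‖x‖) + (‖x‖ ^ 2) ^ 3 * Real.exp (‖x‖ ^ 2)) (by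
    intro τ hτ hτ1
    have h1 := h.taylor x 5 hτ.le hτ1
    have h2 : ∫ z, Real.exp (2 * (τ * inner ℝ z x)) ∂gam n lam = Real.exp (τ ^ 2 * ‖x‖ ^ 2) := by
      have := h.mgf (x := τ • x) (by rw [hV]; exact V.smul_mem _ hx)
      simpa [inner_smul_right, norm_smul, mul_pow] using this
    rw [h2] at h1
    have h3 := abs_exp_sub_sum_le (τ ^ 2 * ‖x‖ ^ 2) 3
    have h4 : |τ ^ 2 * ‖x‖ ^ 2| ^ 3 * Real.exp |τ ^ 2 * ‖x‖ ^ 2| ≤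
        (‖x‖ ^ 2) ^ 3 * Real.exp (‖x‖ ^ 2) * τ ^ 5 := by
      rw [abs_of_nonneg (by positivity)]
      have : τ ^ 2 * ‖x‖ ^ 2 ≤ ‖x‖ ^ 2 :=
      mul_le_of_le_one_left (by positivity) (pow_le_one₀ hτ.le hτ1)
      calc (τ ^ 2 * ‖x‖ ^ 2) ^ 3 * Real.exp (τ ^ 2 * ‖x‖ ^ 2)
          ≤ (τ ^ 2 * ‖x‖ ^ 2) ^ 3 * Real.exp (‖x‖ ^ 2) := by gcongr
        _ = (‖x‖ ^ 2) ^ 3 * Real.exp (‖x‖ ^ 2) * τ ^ 5 * τ := by ring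
        _ ≤ _ := mul_le_of_le_one_right (by positivity) hτ1
    have h5 : ∑ k ∈ Finset.range 5, c k * τ ^ k =
        ∑ k ∈ Finset.range 5, (2 * τ) ^ k / k.factorial * m k -
        ∑ k ∈ Finset.range 3, (τ ^ 2 * ‖x‖ ^ 2) ^ k / k.factorial := by
      simp [Finset.sum_range_succ, hc, Nat.factorial]; ring
    rw [h5, add_mul]
    rw [abs_le] at h1 h3 ⊢
    constructor <;> linarith [h1.1, h1.2, h3.1, h3.2])
  constructor
  · have := key 2 (by norm_num)
    simp only [hc, hm, Nat.factorial] at this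
    norm_num at this
    linarith
  · have := key 4 (by norm_num)
    simp only [hc, hm, Nat.factorial] at this
    norm_num at this
    linarith

end

section

variable {d n : ℕ}

theorem Unif.moment_pair {lam : Measure (Euc d)} (h : Unif n lam) {V : Submodule ℝ (Euc d)}
    (hV : msupport lam = V) {x y : Euc d} (hx : x ∈ V) (hy : y ∈ V) :
    ∫ z, inner ℝ z x * inner ℝ z y ∂gam n lam = inner ℝ x y / 2 := by
  have e : ∀ z : Euc d, inner ℝ z x * inner ℝ z y =
      1 / 4 * (inner ℝ z (x + y) ^ 2 - inner ℝ z (x - y) ^ 2) := fun z => by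
    rw [inner_add_right, inner_sub_right]; ring
  simp only [e]
  rw [integral_const_mul, integral_sub (h.integrable ((ExpGrowth.inner_right _).pow _))
    (h.integrable ((ExpGrowth.inner_right _).pow _)), (h.moment_two_four hV (V.add_mem hx hy)).1,
    (h.moment_two_four hV (V.sub_mem hx hy)).1, norm_add_sq_real, norm_sub_sq_real]
  ring

theorem Unif.moment_sq_sq {lam : Measure (Euc d)} (h : Unif n lam) {V : Submodule ℝ (Euc d)}
    (hV : msupport lam = V) {x y : Euc d} (hx : x ∈ V) (hy : y ∈ V) :
    ∫ z, inner ℝ z x ^ 2 * inner ℝ z y ^ 2 ∂gam n lam =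
      1 / 4 * (‖x‖ ^ 2 * ‖y‖ ^ 2 + 2 * inner ℝ x y ^ 2) := by
  have e : ∀ z : Euc d, inner ℝ z x ^ 2 * inner ℝ z y ^ 2 =
      1 / 12 * (inner ℝ z (x + y) ^ 4 + inner ℝ z (x - y) ^ 4) -
        1 / 6 * (inner ℝ z x ^ 4 + inner ℝ z y ^ 4) := fun z => by
    rw [inner_add_right, inner_sub_right]; ring
  have i4 : ∀ x : Euc d, Integrable (fun z => inner ℝ z x ^ 4) (gam n lam) := fun x =>
    h.integrable ((ExpGrowth.inner_right _).pow _)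
  simp only [e]
  have i8 : ∀ (c : ℝ) (x y : Euc d), Integrable
      (fun z => c * (inner ℝ z x ^ 4 + inner ℝ z y ^ 4)) (gam n lam) := fun c x y =>
    ((i4 x).add (i4 y)).const_mul c
  rw [integral_sub (i8 _ _ _) (i8 _ _ _),
    integral_const_mul, integral_const_mul, integral_add (i4 _) (i4 _), integral_add (i4 _) (i4 _),
    (h.moment_two_four hV (V.add_mem hx hy)).2, (h.moment_two_four hV (V.sub_mem hx hy)).2,
    (h.moment_two_four hV hx).2, (h.moment_two_four hV hy).2, norm_add_sq_real, norm_sub_sq_real]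
  ring

theorem Unif.moment_sq_pair {lam : Measure (Euc d)} (h : Unif n lam) {V : Submodule ℝ (Euc d)}
    (hV : msupport lam = V) {x y w : Euc d} (hx : x ∈ V) (hy : y ∈ V) (hw : w ∈ V) :
    ∫ z, inner ℝ z x ^ 2 * (inner ℝ z y * inner ℝ z w) ∂gam n lam =
      1 / 4 * (‖x‖ ^ 2 * inner ℝ y w + 2 * (inner ℝ x y * inner ℝ x w)) := by
  have e : ∀ z : Euc d, inner ℝ z x ^ 2 * (inner ℝ z y * inner ℝ z w) =
      1 / 4 * (inner ℝ z x ^ 2 * inner ℝ z (y + w) ^ 2 - inner ℝ z x ^ 2 * inner ℝ z (y - w) ^ 2) :=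
    fun z => by rw [inner_add_right, inner_sub_right]; ring
  have i4 : ∀ y : Euc d, Integrable (fun z => inner ℝ z x ^ 2 * inner ℝ z y ^ 2) (gam n lam) :=
    fun y => h.integrable (((ExpGrowth.inner_right _).pow _).mul ((ExpGrowth.inner_right _).pow _))
  simp only [e]
  rw [integral_const_mul, integral_sub (i4 _) (i4 _), h.moment_sq_sq hV hx (V.add_mem hy hw),
    h.moment_sq_sq hV hx (V.sub_mem hy hw), norm_add_sq_real, norm_sub_sq_real, inner_add_right,
    inner_sub_right]
  ring

theorem Unif.moment_pair_pair {lam : Measure (Euc d)} (h : Unif n lam) {V : Submodule ℝ (Euc d)}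
    (hV : msupport lam = V) {x u y w : Euc d} (hx : x ∈ V) (hu : u ∈ V) (hy : y ∈ V) (hw : w ∈ V) :
    ∫ z, inner ℝ z x * inner ℝ z u * (inner ℝ z y * inner ℝ z w) ∂gam n lam =
      1 / 4 * (inner ℝ x u * inner ℝ y w + inner ℝ x y * inner ℝ u w +
        inner ℝ x w * inner ℝ u y) := by
  have e : ∀ z : Euc d, inner ℝ z x * inner ℝ z u * (inner ℝ z y * inner ℝ z w) =
      1 / 4 * (inner ℝ z (x + u) ^ 2 * (inner ℝ z y * inner ℝ z w) -
        inner ℝ z (x - u) ^ 2 * (inner ℝ z y * inner ℝ z w)) :=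
    fun z => by rw [inner_add_right, inner_sub_right]; ring
  have i4 : ∀ x : Euc d, Integrable (fun z => inner ℝ z x ^ 2 * (inner ℝ z y * inner ℝ z w))
      (gam n lam) := fun x => h.integrable (((ExpGrowth.inner_right _).pow _).mul
        ((ExpGrowth.inner_right _).mul (ExpGrowth.inner_right _)))
  simp only [e]
  rw [integral_const_mul, integral_sub (i4 _) (i4 _), h.moment_sq_pair hV (V.add_mem hx hu) hy hw,
    h.moment_sq_pair hV (V.sub_mem hx hu) hy hw, norm_add_sq_real, norm_sub_sq_real,
    inner_add_left, inner_sub_left, inner_add_left, inner_sub_left]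
  ring

/-- The Kronecker symbol. -/
def kr (a b : Fin n) : ℝ := if a = b then 1 else 0

theorem inner_eq_kr {v : Fin n → Euc d} (hv : Orthonormal ℝ v) (a b : Fin n) :
    inner ℝ (v a) (v b) = kr a b := orthonormal_iff_ite.1 hv a b

section
variable {ι : Type*} {F : Filter ι} {ν : ι → Measure (Euc d)} {v : Fin n → Euc d}

theorem eventually_of_ultrafilter {p : ι → Prop} (h : ∀ U : Ultrafilter ι, ↑U ≤ F →
    ∀ᶠ i in U, p i) : ∀ᶠ i in F, p i :=
  mem_iff_ultrafilter.2 h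

theorem exists_plane_limit_of_eventually (U : Ultrafilter ι)
    (h : ∀ᶠ i in U, Unif n (ν i)) (hv : Orthonormal ℝ v)
    (h0 : Tendsto (fun i => ∫ z, ‖res v z‖ ^ 2 ∂gam n (ν i)) U (𝓝 0)) :
    ∃ lam : Measure (Euc d), Unif n lam ∧ msupport lam = Submodule.span ℝ (range v) ∧
      (∀ f, ExpGrowth f → Tendsto (fun i => ∫ z, f z ∂gam n (ν i)) U (𝓝 (∫ z, f z ∂gam n lam))) ∧
      ∀ x ∈ Submodule.span ℝ (range v), ∀ ε > 0,
        ∀ᶠ i in U, ∃ y ∈ msupport (ν i), dist y x < ε := by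
  classical
  obtain ⟨i₀, hi₀⟩ := h.exists
  set ν' : ι → Measure (Euc d) := fun i => if Unif n (ν i) then ν i else ν i₀ with hν'
  have hU : ∀ i, Unif n (ν' i) := fun i => by
    by_cases hi : Unif n (ν i)
    · simp [hν', hi]
    · simpa [hν', hi] using hi₀
  have he : ν' =ᶠ[U] ν := h.mono fun i hi => by simp [hν', hi]
  obtain ⟨lam, h1, h2, h3, h4⟩ := exists_plane_limit U hU hv
    (h0.congr' (he.mono fun i hi => by simp only [hi]))
  refine ⟨lam, h1, h2, fun f hf => (h3 f hf).congr' (he.mono fun i hi => by simp only [hi]),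
    fun x hx ε hε => ?_⟩
  filter_upwards [h4 x hx ε hε, he] with i hi hi'
  rwa [hi'] at hi

theorem tendsto_moment_pair (h : ∀ᶠ i in F, Unif n (ν i)) (hv : Orthonormal ℝ v)
    (h0 : Tendsto (fun i => ∫ z, ‖res v z‖ ^ 2 ∂gam n (ν i)) F (𝓝 0)) (a b : Fin n) :
    Tendsto (fun i => ∫ z, inner ℝ z (v a) * inner ℝ z (v b) ∂gam n (ν i)) F
      (𝓝 (kr a b / 2)) := by
  rw [tendsto_iff_ultrafilter]
  intro U hU
  obtain ⟨lam, h1, h2, h3, -⟩ := exists_plane_limit_of_eventually U (h.filter_mono hU) hv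
    (h0.mono_left hU)
  have := h3 _ ((ExpGrowth.inner_right (v a)).mul (ExpGrowth.inner_right (v b)))
  rwa [h1.moment_pair h2 (Submodule.subset_span ⟨a, rfl⟩) (Submodule.subset_span ⟨b, rfl⟩),
    inner_eq_kr hv] at this

theorem tendsto_moment_four (h : ∀ᶠ i in F, Unif n (ν i)) (hv : Orthonormal ℝ v)
    (h0 : Tendsto (fun i => ∫ z, ‖res v z‖ ^ 2 ∂gam n (ν i)) F (𝓝 0)) (a b c e : Fin n) :
    Tendsto (fun i => ∫ z, inner ℝ z (v a) * inner ℝ z (v b) *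
      (inner ℝ z (v c) * inner ℝ z (v e)) ∂gam n (ν i)) F
      (𝓝 (1 / 4 * (kr a b * kr c e + kr a c * kr b e + kr a e * kr b c))) := by
  rw [tendsto_iff_ultrafilter]
  intro U hU
  obtain ⟨lam, h1, h2, h3, -⟩ := exists_plane_limit_of_eventually U (h.filter_mono hU) hv
    (h0.mono_left hU)
  have := h3 _ (((ExpGrowth.inner_right (v a)).mul (ExpGrowth.inner_right (v b))).mul
    ((ExpGrowth.inner_right (v c)).mul (ExpGrowth.inner_right (v e))))
  have hm : ∀ a, v a ∈ Submodule.span ℝ (range v) := fun a => Submodule.subset_span ⟨a, rfl⟩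
  rwa [h1.moment_pair_pair h2 (hm a) (hm b) (hm c) (hm e), inner_eq_kr hv, inner_eq_kr hv,
    inner_eq_kr hv, inner_eq_kr hv, inner_eq_kr hv, inner_eq_kr hv] at this

theorem eventually_exists_near (h : ∀ᶠ i in F, Unif n (ν i)) (hv : Orthonormal ℝ v)
    (h0 : Tendsto (fun i => ∫ z, ‖res v z‖ ^ 2 ∂gam n (ν i)) F (𝓝 0)) {x : Euc d}
    (hx : x ∈ Submodule.span ℝ (range v)) {ε : ℝ} (hε : 0 < ε) :
    ∀ᶠ i in F, ∃ y ∈ msupport (ν i), dist y x < ε := by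
  refine eventually_of_ultrafilter fun U hU => ?_
  obtain ⟨lam, -, -, -, h4⟩ := exists_plane_limit_of_eventually U (h.filter_mono hU) hv
    (h0.mono_left hU)
  exact h4 x hx ε hε

end

theorem tendsto_orthonormal {ι : Type*} {F : Filter ι} [F.NeBot] {v : ι → Fin n → Euc d}
    (hv : ∀ᶠ i in F, Orthonormal ℝ (v i)) {w : Fin n → Euc d}
    (h : ∀ a, Tendsto (fun i => v i a) F (𝓝 (w a))) : Orthonormal ℝ w := by
  rw [orthonormal_iff_ite]
  intro a b
  refine tendsto_nhds_unique ((h a).inner (h b)) (tendsto_const_nhds.congr' ?_)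
  filter_upwards [hv] with i hi
  exact (orthonormal_iff_ite.1 hi a b).symm

theorem exists_ultralimit_orthonormal {ι : Type*} (U : Ultrafilter ι) {v : ι → Fin n → Euc d}
    (hv : ∀ᶠ i in U, Orthonormal ℝ (v i)) : ∃ w : Fin n → Euc d, Orthonormal ℝ w ∧
      ∀ a, Tendsto (fun i => v i a) U (𝓝 (w a)) := by
  have : ∀ a, ∃ w, Tendsto (fun i => v i a) U (𝓝 w) := fun a =>
    exists_ultralimit U (x := 0) (M := 1) (hv.mono fun i hi => by simp [hi.1 a])
  choose w hw using this
  exact ⟨w, tendsto_orthonormal hv hw, hw⟩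

theorem abs_inner_sq_sub_le {x y : Euc d} (hx : ‖x‖ = 1) (hy : ‖y‖ = 1) (z : Euc d) :
    |inner ℝ x z ^ 2 - inner ℝ y z ^ 2| ≤ 2 * ‖x - y‖ * ‖z‖ ^ 2 := by
  have e : inner ℝ x z ^ 2 - inner ℝ y z ^ 2 = inner ℝ (x - y) z * inner ℝ (x + y) z := by
    rw [inner_sub_left, inner_add_left]; ring
  rw [e, abs_mul]
  have h1 := abs_real_inner_le_norm (x - y) z
  have h2 := abs_real_inner_le_norm (x + y) z
  have h3 : ‖x + y‖ ≤ 2 := (norm_add_le _ _).trans (by linarith)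
  calc |inner ℝ (x - y) z| * |inner ℝ (x + y) z| ≤ (‖x - y‖ * ‖z‖) * (2 * ‖z‖) := by
        gcongr; exact h2.trans (by gcongr)
    _ = _ := by ring

/-- Comparison of the mean squared distances to two planes. -/
theorem Unif.integral_res_le {ν : Measure (Euc d)} (h : Unif n ν) {v w : Fin n → Euc d}
    (hv : Orthonormal ℝ v) (hw : Orthonormal ℝ w) :
    ∫ z, ‖res w z‖ ^ 2 ∂gam n ν ≤ ∫ z, ‖res v z‖ ^ 2 ∂gam n ν + n * ∑ a, ‖v a - w a‖ := by
  have h1 : ∀ z, ‖res w z‖ ^ 2 ≤ ‖res v z‖ ^ 2 + (2 * ∑ a, ‖v a - w a‖) * ‖z‖ ^ 2 := by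
    intro z
    rw [norm_res_sq hv, norm_res_sq hw, Finset.mul_sum, Finset.sum_mul]
    have : ∑ a, (inner ℝ (v a) z ^ 2 - inner ℝ (w a) z ^ 2) ≤
        ∑ a, 2 * ‖v a - w a‖ * ‖z‖ ^ 2 := Finset.sum_le_sum fun a _ =>
      (le_abs_self _).trans (abs_inner_sq_sub_le (hv.1 a) (hw.1 a) z)
    rw [Finset.sum_sub_distrib] at this
    linarith
  have i1 := h.integrable (ExpGrowth.norm_res_sq hv)
  have i2 : Integrable (fun z : Euc d => (2 * ∑ a, ‖v a - w a‖) * ‖z‖ ^ 2) (gam n ν) :=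
    (h.integrable (ExpGrowth.norm.pow 2)).const_mul _
  refine (integral_mono (h.integrable (ExpGrowth.norm_res_sq hw)) (i1.add i2) h1).trans ?_
  simp only [Pi.add_apply]
  rw [integral_add i1 i2, integral_const_mul, h.integral_norm_sq]
  linarith

/-- The support of a measure satisfying `Unif n` which is close to an `n`-plane in the mean comes
close to every point of the unit ball of that plane. -/
theorem exists_flat_threshold (d n : ℕ) {ε : ℝ} (hε : 0 < ε) : ∃ η : ℝ, 0 < η ∧
    ∀ ν : Measure (Euc d), Unif n ν → ∀ v : Fin n → Euc d, Orthonormal ℝ v →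
      ∫ z, ‖res v z‖ ^ 2 ∂gam n ν ≤ η → ∀ x ∈ Submodule.span ℝ (range v), ‖x‖ ≤ 1 →
        ∃ y ∈ msupport ν, ‖y - x‖ ≤ ε := by
  by_contra! hcon
  have hpos : ∀ k : ℕ, (0 : ℝ) < 1 / (k + 1) := fun k => by positivity
  choose ν hν v hv hdef x hx hx1 hfar using fun k : ℕ => hcon (1 / (k + 1)) (hpos k)
  obtain ⟨w, hw, hvw⟩ := exists_ultralimit_orthonormal (hyperfilter ℕ) (Eventually.of_forall hv)
  obtain ⟨p, hp⟩ := exists_ultralimit (hyperfilter ℕ) (f := x) (x := 0) (M := 1)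
    (Eventually.of_forall fun k => by simpa using hx1 k)
  have hzero : Tendsto (fun k : ℕ => (1 : ℝ) / (k + 1)) (hyperfilter ℕ) (𝓝 0) :=
    tendsto_one_div_add_atTop_nhds_zero_nat.mono_left Nat.hyperfilter_le_atTop
  have hsum : Tendsto (fun k => (n : ℝ) * ∑ a, ‖v k a - w a‖) (hyperfilter ℕ) (𝓝 0) := by
    have h1 : Tendsto (fun k => (n : ℝ) * ∑ a, ‖v k a - w a‖) (hyperfilter ℕ)
        (𝓝 ((n : ℝ) * ∑ a, ‖w a - w a‖)) :=
      (tendsto_finsetSum _ fun a _ => ((hvw a).sub_const (w a)).norm).const_mul _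
    simpa using h1
  have h0 : Tendsto (fun k => ∫ z, ‖res w z‖ ^ 2 ∂gam n (ν k)) (hyperfilter ℕ) (𝓝 0) := by
    have h2 := hzero.add hsum
    rw [add_zero] at h2
    exact squeeze_zero (fun k => integral_nonneg fun z => by positivity) (fun k =>
      ((hν k).integral_res_le (hv k) hw).trans (by gcongr; exact hdef k)) h2
  have hpw : p ∈ Submodule.span ℝ (range w) := by
    rw [← res_eq_zero_iff hw]
    have h1 : Tendsto (fun k => res (v k) (x k)) (hyperfilter ℕ) (𝓝 (res w p)) :=
      hp.sub (tendsto_finsetSum _ fun a _ => ((hvw a).inner hp).smul (hvw a))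
    have h2 : ∀ k, res (v k) (x k) = 0 := fun k => (res_eq_zero_iff (hv k) _).2 (hx k)
    simp only [h2] at h1
    exact (tendsto_nhds_unique h1 tendsto_const_nhds)
  obtain ⟨k, ⟨y, hy, hyp⟩, hk⟩ := ((eventually_exists_near (Eventually.of_forall hν) hw h0 hpw
    (half_pos hε)).and ((Metric.tendsto_nhds.1 hp) (ε / 2) (half_pos hε))).exists
  have h3 := hfar k y hy
  rw [← dist_eq_norm] at h3
  have := dist_triangle_right y (x k) p
  linarith

end

section

variable {d n : ℕ}

theorem exists_preimage_of_tendsto {ι I W : Type*} [AddCommGroup W] [Module ℝ W]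
    [FiniteDimensional ℝ W] (Ψ : W →ₗ[ℝ] I → ℝ) {F : Filter ι} [F.NeBot] {w : ι → W} {g : I → ℝ}
    (h : ∀ i, Tendsto (fun k => Ψ (w k) i) F (𝓝 (g i))) : ∃ w, Ψ w = g := by
  have hc : IsClosed (LinearMap.range Ψ : Set (I → ℝ)) := Submodule.closed_of_finiteDimensional _
  have := hc.mem_of_tendsto (tendsto_pi_nhds.2 h) (Eventually.of_forall fun k => ⟨w k, rfl⟩)
  exact this

/-- The multiset of indices on which nearly extremal weights concentrate. -/
theorem weights_concentrate {q p : Fin d → ℝ} {η : ℝ} (hn : 0 < n)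
    (hq2 : ∑ i, q i ^ 2 = n) (hp0 : ∀ i, 0 ≤ p i) (hp1 : ∀ i, p i ≤ 1)
    (hps : ∑ i, p i = n) (hqp : n - 2 * η ≤ ∑ i, q i * p i) (h1 : η ≤ 1 / 16)
    (h2 : 8 * η * d < 1) :
    (Finset.univ.filter fun i => 1 / 2 ≤ p i).card = n ∧
      (∀ i, 1 / 2 ≤ p i → 1 - p i ≤ 8 * η) ∧ ∀ i, ¬ 1 / 2 ≤ p i → q i ≤ 1 := by
  have hn' : (1 : ℝ) ≤ n := by exact_mod_cast hn
  have hpp : ∑ i, p i ^ 2 ≤ n := by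
    rw [← hps]; exact Finset.sum_le_sum fun i _ => by nlinarith [hp0 i, hp1 i]
  have hcs := Finset.sum_mul_sq_le_sq_mul_sq Finset.univ q p
  rw [hq2] at hcs
  have hqp' : ∑ i, (q i - p i) ^ 2 = n - 2 * ∑ i, q i * p i + ∑ i, p i ^ 2 := by
    rw [← hq2, Finset.mul_sum, ← Finset.sum_sub_distrib, ← Finset.sum_add_distrib]
    exact Finset.sum_congr rfl fun i _ => by ring
  have hη : 0 ≤ η := by
    have : 0 ≤ ∑ i, (q i - p i) ^ 2 := Finset.sum_nonneg fun i _ => sq_nonneg _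
    linarith
  have hp2 : n - 4 * η ≤ ∑ i, p i ^ 2 := by
    have : (n - 2 * η) ^ 2 ≤ (∑ i, q i * p i) ^ 2 := by
      apply pow_le_pow_left₀ _ hqp; linarith
    have h3 : (n : ℝ) * (n - 4 * η) ≤ n * ∑ i, p i ^ 2 := by nlinarith
    exact le_of_mul_le_mul_left h3 (by linarith)
  have hvar : ∀ i, p i * (1 - p i) ≤ 4 * η := fun i => by
    have h3 : ∑ i, p i * (1 - p i) ≤ 4 * η := by
      have : ∑ i, p i * (1 - p i) = ∑ i, p i - ∑ i, p i ^ 2 := by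
        rw [← Finset.sum_sub_distrib]; exact Finset.sum_congr rfl fun i _ => by ring
      linarith
    exact (Finset.single_le_sum (f := fun i => p i * (1 - p i)) (fun j _ =>
      mul_nonneg (hp0 j) (by linarith [hp1 j])) (Finset.mem_univ i)).trans h3
  have hT : ∀ i, 1 / 2 ≤ p i → 1 - p i ≤ 8 * η := fun i hi => by nlinarith [hvar i, hp1 i]
  have hT' : ∀ i, ¬ 1 / 2 ≤ p i → p i ≤ 8 * η := fun i hi => by
    push Not at hi; nlinarith [hvar i, hp0 i]
  refine ⟨?_, hT, fun i hi => ?_⟩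
  · have h3 : |((Finset.univ.filter fun i => 1 / 2 ≤ p i).card : ℝ) - n| < 1 := by
      rw [Finset.card_filter, ← hps]
      push_cast
      rw [← Finset.sum_sub_distrib]
      refine (Finset.abs_sum_le_sum_abs _ _).trans_lt (lt_of_le_of_lt (Finset.sum_le_sum
        (g := fun _ => 8 * η) fun i _ => ?_) ?_)
      · split_ifs with hi
        · rw [abs_of_nonneg (by linarith [hp1 i])]; exact hT i hi
        · rw [zero_sub, abs_neg, abs_of_nonneg (hp0 i)]; exact hT' i hi
      · simp only [Finset.sum_const, Finset.card_univ, Fintype.card_fin, nsmul_eq_mul]; linarith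
    rw [abs_lt] at h3
    have h4 : ((Finset.univ.filter fun i => 1 / 2 ≤ p i).card : ℝ) < n + 1 := by linarith [h3.2]
    have h5 : (n : ℝ) < (Finset.univ.filter fun i => 1 / 2 ≤ p i).card + 1 := by linarith [h3.1]
    have h4' : (Finset.univ.filter fun i => 1 / 2 ≤ p i).card < n + 1 := by exact_mod_cast h4
    have h5' : n < (Finset.univ.filter fun i => 1 / 2 ≤ p i).card + 1 := by exact_mod_cast h5
    omega
  · have h3 : (q i - p i) ^ 2 ≤ 4 * η := by
      refine (Finset.single_le_sum (f := fun i => (q i - p i) ^ 2) (fun j _ => sq_nonneg _)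
        (Finset.mem_univ i)).trans ?_
      rw [hqp']; linarith
    have h4 := hT' i hi
    nlinarith

theorem weights_eq_indicator {q : Fin d → ℝ} {ρ : ℝ} {T : Finset (Fin d)} (hT : T.card = n)
    (hqs : ∑ i, q i = n) (hq0 : ∀ i, 0 ≤ q i) (hq1 : ∀ i ∉ T, q i ≤ 1) (hρ : ρ ≤ 1 / 2)
    (hρn : 8 * n * ρ ^ 2 < 1)
    (hy : ∀ i ∈ T, ∃ y : Fin d → ℝ, ∑ j, (q j - 1) * y j ^ 2 = 0 ∧ |y i - 1| ≤ ρ ∧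
      ∀ j, j ≠ i → |y j| ≤ ρ) : ∀ i, q i = if i ∈ T then 1 else 0 := by
  classical
  set S := ∑ j ∈ T, |q j - 1| with hS
  have hS0 : 0 ≤ S := Finset.sum_nonneg fun _ _ => abs_nonneg _
  have hlow : ∀ i ∈ T, -(4 * ρ ^ 2 * S) ≤ q i - 1 := by
    intro i hi
    obtain ⟨y, hy0, hyi, hyj⟩ := hy i hi
    rw [← Finset.add_sum_erase _ _ (Finset.mem_univ i)] at hy0
    have h1 : ∑ j ∈ Finset.univ.erase i, (q j - 1) * y j ^ 2 ≤ ρ ^ 2 * S := by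
      have h2 : ∀ j ∈ Finset.univ.erase i, (q j - 1) * y j ^ 2 ≤
          if j ∈ T then |q j - 1| * ρ ^ 2 else 0 := by
        intro j hj
        have hyj2 : y j ^ 2 ≤ ρ ^ 2 := sq_le_sq.2 ((hyj j (Finset.ne_of_mem_erase hj)).trans
          (le_abs_self _))
        split_ifs with hjT
        · exact mul_le_mul (le_abs_self _) hyj2 (sq_nonneg _) (abs_nonneg _)
        · exact mul_nonpos_of_nonpos_of_nonneg (by linarith [hq1 j hjT]) (sq_nonneg _)
      refine (Finset.sum_le_sum h2).trans ((Finset.sum_le_sum_of_subset_of_nonneg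
        (Finset.erase_subset _ _) fun j _ _ => by positivity).trans ?_)
      rw [Finset.sum_ite_mem, Finset.univ_inter, ← Finset.sum_mul, mul_comm]
    have hyi' : 1 / 4 ≤ y i ^ 2 := by
      rw [abs_le] at hyi
      nlinarith [hyi.1]
    by_contra hc
    push Not at hc
    have hneg : q i - 1 < 0 := lt_of_lt_of_le hc (by have : 0 ≤ 4 * ρ ^ 2 * S := by positivity
                                                     linarith)
    nlinarith
  have hTsum : ∑ i ∈ T, (q i - 1) ≤ 0 := by
    rw [Finset.sum_sub_distrib, Finset.sum_const, hT, nsmul_eq_mul, mul_one, sub_nonpos, ← hqs]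
    exact Finset.sum_le_sum_of_subset_of_nonneg (Finset.subset_univ _) fun i _ _ => hq0 i
  have hSle : S ≤ 8 * n * ρ ^ 2 * S := by
    have h1 : ∀ i ∈ T, |q i - 1| ≤ (q i - 1) + 8 * ρ ^ 2 * S := fun i hi => by
      have := hlow i hi
      have h0 : 0 ≤ 4 * ρ ^ 2 * S := by positivity
      rw [abs_le]; constructor <;> linarith
    have := Finset.sum_le_sum h1
    rw [Finset.sum_add_distrib, Finset.sum_const, hT, nsmul_eq_mul] at this
    linarith
  have hSz : S = 0 := by nlinarith
  have hq1' : ∀ i ∈ T, q i = 1 := fun i hi => by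
    have := (Finset.sum_eq_zero_iff_of_nonneg fun _ _ => abs_nonneg _).1 hSz i hi
    rw [abs_eq_zero] at this; linarith
  have hrest : ∑ i ∈ Tᶜ, q i = 0 := by
    have h1 := Finset.sum_add_sum_compl T q
    rw [Finset.sum_congr rfl hq1', Finset.sum_const, hT, hqs, nsmul_eq_mul, mul_one] at h1
    linarith
  intro i
  split_ifs with hi
  · exact hq1' i hi
  · exact (Finset.sum_eq_zero_iff_of_nonneg fun j _ => hq0 j).1 hrest i (by simpa using hi)

theorem exists_diagonalization {ι : Type*} (U : Ultrafilter ι) {ν : ι → Measure (Euc d)}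
    (h : ∀ᶠ i in U, Unif n (ν i)) :
    ∃ (e : OrthonormalBasis (Fin d) ℝ (Euc d)) (q : Fin d → ℝ), ∀ x y,
      Tendsto (fun i => 2 * ∫ z, inner ℝ z x * inner ℝ z y ∂gam n (ν i)) U
        (𝓝 (∑ a, q a * (inner ℝ (e a) x * inner ℝ (e a) y))) := by
  have hex : ∀ x y, ∃ c, Tendsto (fun i => 2 * ∫ z, inner ℝ z x * inner ℝ z y ∂gam n (ν i)) U
      (𝓝 c) := by
    intro x y
    obtain ⟨C, a, hC, ha, hb⟩ := ((ExpGrowth.inner_right x).mul (ExpGrowth.inner_right y)).bound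
    refine exists_ultralimit_real U (M := 2 * (C * expMom n a)) (h.mono fun i hi => ?_)
    rw [abs_mul, abs_two]
    gcongr
    exact hi.abs_integral_le hb
  choose B hB using hex
  have hsymm : ∀ x y, B x y = B y x := fun x y =>
    tendsto_nhds_unique (hB x y) (by simpa only [mul_comm (inner ℝ _ x)] using hB y x)
  have hadd : ∀ x x' y, B (x + x') y = B x y + B x' y := fun x x' y => by
    refine tendsto_nhds_unique (hB _ y) (((hB x y).add (hB x' y)).congr' (h.mono fun i hi => ?_))
    rw [← mul_add, ← integral_add]
    · simp only [inner_add_right, add_mul]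
    · exact hi.integrable ((ExpGrowth.inner_right x).mul (ExpGrowth.inner_right y))
    · exact hi.integrable ((ExpGrowth.inner_right x').mul (ExpGrowth.inner_right y))
  have hsmul : ∀ (c : ℝ) x y, B (c • x) y = c * B x y := fun c x y => by
    refine tendsto_nhds_unique (hB _ y) (((hB x y).const_mul c).congr' (h.mono fun i hi => ?_))
    simp only [inner_smul_right, mul_assoc]
    rw [integral_const_mul]; ring
  let L : Euc d →ₗ[ℝ] Euc d :=
    { toFun := fun x => WithLp.toLp 2 fun i => B x (EuclideanSpace.single i 1)
      map_add' := fun x y => by ext i; simp [hadd]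
      map_smul' := fun c x => by ext i; simp [hsmul] }
  let Bl : Euc d → Euc d →ₗ[ℝ] ℝ := fun x =>
    { toFun := B x
      map_add' := fun y y' => by rw [hsymm, hadd, hsymm y, hsymm y']
      map_smul' := fun c y => by rw [hsymm, hsmul, hsymm y]; rfl }
  have hL : ∀ x y, inner ℝ (L x) y = B x y := by
    intro x y
    have hy : y = ∑ i, y i • EuclideanSpace.single i (1 : ℝ) := by
      simpa using ((EuclideanSpace.basisFun (Fin d) ℝ).sum_repr y).symm
    have h1 : B x y = ∑ i, y i * B x (EuclideanSpace.single i 1) := by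
      change Bl x y = _
      conv_lhs => rw [hy]
      rw [map_sum]
      simp only [map_smul, smul_eq_mul]; rfl
    rw [h1, PiLp.inner_apply]
    simp [L]
  have hLs : L.IsSymmetric := fun x y => by
    rw [hL, real_inner_comm, hL, hsymm]
  have hd : Module.finrank ℝ (Euc d) = d := by simp
  refine ⟨hLs.eigenvectorBasis hd, hLs.eigenvalues hd, fun x y => ?_⟩
  have hval : B x y = ∑ a, hLs.eigenvalues hd a * (inner ℝ (hLs.eigenvectorBasis hd a) x *
      inner ℝ (hLs.eigenvectorBasis hd a) y) := by
    rw [← hL, ← (hLs.eigenvectorBasis hd).sum_inner_mul_inner]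
    refine Finset.sum_congr rfl fun a _ => ?_
    rw [hLs, hLs.apply_eigenvectorBasis, inner_smul_right, real_inner_comm x]
    simp [mul_assoc]
  rw [← hval]
  exact hB x y

end

section

variable {d n : ℕ}

theorem abs_inner_le_exp (x z : Euc d) : |inner ℝ z x| ≤ ‖x‖ * Real.exp (1 * ‖z‖) := by
  refine (abs_real_inner_le_norm _ _).trans ?_
  rw [mul_comm]
  refine mul_le_mul_of_nonneg_left ?_ (norm_nonneg _)
  have := Real.add_one_le_exp (1 * ‖z‖)
  linarith

theorem Unif.abs_integral_inner_le {ν : Measure (Euc d)} (h : Unif n ν) (x : Euc d) :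
    |∫ z, inner ℝ z x ∂gam n ν| ≤ ‖x‖ * expMom n 1 :=
  h.abs_integral_le (abs_inner_le_exp x)

/-- Every point of the support of a uniform measure, looked at from far away, satisfies a
quadratic equation up to a small error. -/
theorem Unif.abs_quadratic_le {ν : Measure (Euc d)} (h : Unif n ν) {x : Euc d}
    (hx : x ∈ msupport ν) : ∃ C : ℝ, 0 ≤ C ∧ ∀ τ : ℝ, 0 < τ → τ ≤ 1 →
      |2 / τ * ∫ z, inner ℝ z x ∂gam n (FlatnessPropagation.scl n τ ν) +
        2 * ∫ z, inner ℝ z x ^ 2 ∂gam n (FlatnessPropagation.scl n τ ν) - ‖x‖ ^ 2| ≤ C * τ := by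
  refine ⟨6 * expMom n (4 * ‖x‖) + (‖x‖ ^ 2) ^ 2 * Real.exp (‖x‖ ^ 2), by
    have := expMom_nonneg n (4 * ‖x‖); positivity, fun τ hτ hτ1 => ?_⟩
  have hs := h.scl hτ
  have := hs.isProbabilityMeasure
  have h1 := hs.taylor x 3 hτ.le hτ1
  rw [h.mgf_scl hτ hx] at h1
  have h2 := abs_exp_sub_sum_le (τ ^ 2 * ‖x‖ ^ 2) 2
  simp only [Finset.sum_range_succ, Finset.sum_range_zero, Nat.factorial] at h1 h2
  simp only [pow_zero, pow_one, integral_const, probReal_univ, smul_eq_mul] at h1 h2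
  set m1 := ∫ z, inner ℝ z x ∂gam n (FlatnessPropagation.scl n τ ν)
  set m2 := ∫ z, inner ℝ z x ^ 2 ∂gam n (FlatnessPropagation.scl n τ ν)
  have h3 : |τ ^ 2 * ‖x‖ ^ 2| ^ 2 * Real.exp |τ ^ 2 * ‖x‖ ^ 2| ≤
      (‖x‖ ^ 2) ^ 2 * Real.exp (‖x‖ ^ 2) * τ ^ 3 := by
    rw [abs_of_nonneg (by positivity)]
    have e1 : Real.exp (τ ^ 2 * ‖x‖ ^ 2) ≤ Real.exp (‖x‖ ^ 2) :=
      Real.exp_le_exp.2 (mul_le_of_le_one_left (by positivity) (pow_le_one₀ hτ.le hτ1))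
    have e2 : (τ ^ 2 * ‖x‖ ^ 2) ^ 2 ≤ (‖x‖ ^ 2) ^ 2 * τ ^ 3 := by
      have : τ ^ 4 ≤ τ ^ 3 := pow_le_pow_of_le_one hτ.le hτ1 (by norm_num)
      nlinarith [sq_nonneg (‖x‖ ^ 2)]
    calc _ ≤ ((‖x‖ ^ 2) ^ 2 * τ ^ 3) * Real.exp (‖x‖ ^ 2) := by gcongr
      _ = _ := by ring
  have h4 : |2 * τ * m1 + 2 * τ ^ 2 * m2 - τ ^ 2 * ‖x‖ ^ 2| ≤
      (6 * expMom n (4 * ‖x‖) + (‖x‖ ^ 2) ^ 2 * Real.exp (‖x‖ ^ 2)) * τ ^ 3 := by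
    have h2' := h2.trans h3
    rw [abs_le] at h1 h2' ⊢
    push_cast at h1 h2'
    constructor <;> nlinarith
  have h5 : 2 / τ * m1 + 2 * m2 - ‖x‖ ^ 2 =
      (2 * τ * m1 + 2 * τ ^ 2 * m2 - τ ^ 2 * ‖x‖ ^ 2) / τ ^ 2 := by
    field_simp
  rw [h5, abs_div, abs_of_pos (by positivity : 0 < τ ^ 2), div_le_iff₀ (by positivity)]
  linarith

theorem Unif.tendsto_linear_part {ν : Measure (Euc d)} (h : Unif n ν) {ι : Type*} {F : Filter ι}
    {τ : ι → ℝ} (hτ : Tendsto τ F (𝓝[>] 0)) {x : Euc d} (hx : x ∈ msupport ν) {Q : ℝ}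
    (hQ : Tendsto (fun i => 2 * ∫ z, inner ℝ z x ^ 2 ∂gam n (FlatnessPropagation.scl n (τ i) ν)) F
      (𝓝 Q)) :
    Tendsto (fun i => 2 / τ i * ∫ z, inner ℝ z x ∂gam n (FlatnessPropagation.scl n (τ i) ν)) F
      (𝓝 (‖x‖ ^ 2 - Q)) := by
  obtain ⟨C, hC, hb⟩ := h.abs_quadratic_le hx
  have h0 : Tendsto τ F (𝓝 0) := hτ.mono_right nhdsWithin_le_nhds
  have hpos : ∀ᶠ i in F, 0 < τ i := hτ.eventually self_mem_nhdsWithin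
  have hle : ∀ᶠ i in F, τ i ≤ 1 := h0.eventually (eventually_le_nhds (by norm_num))
  have h1 : Tendsto (fun i => 2 / τ i * ∫ z, inner ℝ z x ∂gam n (FlatnessPropagation.scl n (τ i) ν) +
        2 * ∫ z, inner ℝ z x ^ 2 ∂gam n (FlatnessPropagation.scl n (τ i) ν) - ‖x‖ ^ 2) F (𝓝 0) := by
    refine squeeze_zero_norm' ?_ (by simpa using h0.const_mul C)
    filter_upwards [hpos, hle] with i a b
    exact hb _ a b
  have h2 := (h1.add_const (‖x‖ ^ 2)).sub hQ
  refine (h2.congr fun i => ?_).trans (by rw [zero_add])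
  ring

theorem quadric_scl {ν : Measure (Euc d)} {e : Fin d → Euc d} {q : Fin d → ℝ} {b : Euc d}
    (h : ∀ x ∈ msupport ν, ∑ a, q a * inner ℝ (e a) x ^ 2 + inner ℝ b x = ‖x‖ ^ 2)
    {τ : ℝ} (hτ : 0 < τ) {x : Euc d} (hx : x ∈ msupport (scl n τ ν)) :
    ∑ a, q a * inner ℝ (e a) x ^ 2 + τ * inner ℝ b x = ‖x‖ ^ 2 := by
  have := h _ ((mem_msupport_scl hτ).1 hx)
  simp only [inner_smul_right, norm_smul, mul_pow, norm_inv, Real.norm_eq_abs] at this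
  rw [abs_of_pos hτ] at this
  have hs : ∑ a, q a * (τ⁻¹ ^ 2 * inner ℝ (e a) x ^ 2) =
      τ⁻¹ ^ 2 * ∑ a, q a * inner ℝ (e a) x ^ 2 := by
    rw [Finset.mul_sum]; exact Finset.sum_congr rfl fun a _ => by ring
  rw [hs] at this
  field_simp at this
  linarith

/-- Asymptotically at infinity, the support of a uniform measure is contained in a quadric. -/
theorem Unif.exists_quadric {ν : Measure (Euc d)} (h : Unif n ν) {ι : Type*} (U : Ultrafilter ι)
    {τ : ι → ℝ} (hτ : Tendsto τ U (𝓝[>] 0)) :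
    ∃ (e : OrthonormalBasis (Fin d) ℝ (Euc d)) (q : Fin d → ℝ) (b : Euc d),
      (∀ x y, Tendsto (fun i => 2 * ∫ z, inner ℝ z x * inner ℝ z y
        ∂gam n (FlatnessPropagation.scl n (τ i) ν)) U
        (𝓝 (∑ a, q a * (inner ℝ (e a) x * inner ℝ (e a) y)))) ∧
      (∀ a, 0 ≤ q a) ∧ ∑ a, q a = n ∧ ∑ a, q a ^ 2 = n ∧
      ∀ x ∈ msupport ν, ∑ a, q a * inner ℝ (e a) x ^ 2 + inner ℝ b x = ‖x‖ ^ 2 := by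
  have h0 : Tendsto τ U (𝓝 0) := hτ.mono_right nhdsWithin_le_nhds
  have hpos : ∀ᶠ i in U, 0 < τ i := hτ.eventually self_mem_nhdsWithin
  have hu : ∀ᶠ i in U, Unif n (FlatnessPropagation.scl n (τ i) ν) := hpos.mono fun i hi => h.scl hi
  obtain ⟨e, q, he⟩ := exists_diagonalization U hu
  have hdiag : ∀ a, Tendsto (fun i => 2 * ∫ z, inner ℝ z (e a) ^ 2
      ∂gam n (FlatnessPropagation.scl n (τ i) ν)) U (𝓝 (q a)) := by
    intro a
    have := he (e a) (e a)
    have h2 : ∑ c, q c * (inner ℝ (e c) (e a) * inner ℝ (e c) (e a)) = q a := by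
      simp [e.inner_eq_ite]
    rw [h2] at this
    refine this.congr fun i => ?_
    simp only [sq]
  have hsum : ∑ a, q a = n := by
    have h1 := tendsto_finsetSum Finset.univ fun a _ => hdiag a
    refine tendsto_nhds_unique h1 (tendsto_const_nhds.congr' ?_)
    filter_upwards [hu] with i hi
    rw [← Finset.mul_sum, ← integral_finsetSum _ fun a _ =>
      hi.integrable ((ExpGrowth.inner_right (e a)).pow 2)]
    have : ∀ z : Euc d, ∑ a, inner ℝ z (e a) ^ 2 = ‖z‖ ^ 2 := fun z => by
      rw [← e.sum_sq_norm_inner_left z]; simp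
    simp only [this, hi.integral_norm_sq]
    ring
  have hb : ∃ b : Euc d, ∀ x ∈ msupport ν,
      inner ℝ b x = ‖x‖ ^ 2 - ∑ a, q a * inner ℝ (e a) x ^ 2 := by
    let Ψ : Euc d →ₗ[ℝ] (msupport ν → ℝ) :=
      { toFun := fun b x => inner ℝ b x.1
        map_add' := fun a b => by ext x; simp [inner_add_left]
        map_smul' := fun c b => by ext x; simp [inner_smul_left] }
    obtain ⟨b, hb⟩ := exists_preimage_of_tendsto Ψ (F := (U : Filter ι))
      (w := fun i => (2 / τ i) • ∫ z, z ∂gam n (FlatnessPropagation.scl n (τ i) ν))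
      (g := fun x => ‖x.1‖ ^ 2 - ∑ a, q a * inner ℝ (e a) x.1 ^ 2) (by
        rintro ⟨x, hx⟩
        have hQ := he x x
        simp only [← sq] at hQ
        refine (h.tendsto_linear_part hτ hx hQ).congr' ?_
        filter_upwards [hu] with i hi
        have hinner : Integrable (fun z : Euc d => z) (gam n (FlatnessPropagation.scl n (τ i) ν)) :=
          (integrable_norm_iff (by fun_prop)).1 (hi.integrable ExpGrowth.norm)
        have := integral_inner (𝕜 := ℝ) hinner x
        simp only [Ψ, LinearMap.coe_mk, AddHom.coe_mk, inner_smul_left]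
        rw [real_inner_comm, ← this]
        simp [real_inner_comm])
    exact ⟨b, fun x hx => congrFun hb ⟨x, hx⟩⟩
  obtain ⟨b, hb⟩ := hb
  refine ⟨e, q, b, he, fun a => ge_of_tendsto' (hdiag a) fun i => ?_, hsum, ?_,
    fun x hx => by rw [hb x hx]; ring⟩
  · exact mul_nonneg zero_le_two (integral_nonneg fun z => sq_nonneg _)
  have h1 := tendsto_finsetSum Finset.univ fun a _ => (hdiag a).const_mul (q a)
  have h2 : Tendsto (fun i => 2 * (τ i * ∫ z, inner ℝ z b
      ∂gam n (FlatnessPropagation.scl n (τ i) ν))) U (𝓝 0) := by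
    have : Tendsto (fun i => 2 * (τ i * (‖b‖ * expMom n 1))) U (𝓝 0) := by
      simpa using (h0.mul_const (‖b‖ * expMom n 1)).const_mul 2
    refine squeeze_zero_norm' ?_ this
    filter_upwards [hu, hpos] with i hi hp
    rw [Real.norm_eq_abs, abs_mul, abs_mul, abs_of_pos hp, abs_two]
    have := hi.abs_integral_inner_le b
    gcongr
  have h3 := h1.add h2
  have h4 : Tendsto (fun _ : ι => (n : ℝ)) U (𝓝 (∑ a, q a * q a + 0)) := by
    refine h3.congr' ?_
    filter_upwards [hu, hpos] with i hi hp
    have hi1 : ∀ a ∈ Finset.univ, Integrable (fun z => q a * inner ℝ z (e a) ^ 2)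
        (gam n (FlatnessPropagation.scl n (τ i) ν)) := fun a _ =>
      (hi.integrable ((ExpGrowth.inner_right (e a)).pow 2)).const_mul _
    have hi2 : Integrable (fun z => τ i * inner ℝ z b)
        (gam n (FlatnessPropagation.scl n (τ i) ν)) :=
      (hi.integrable (ExpGrowth.inner_right b)).const_mul _
    have key : ∫ z, (∑ a, q a * inner ℝ z (e a) ^ 2) + τ i * inner ℝ z b
        ∂gam n (FlatnessPropagation.scl n (τ i) ν) = n / 2 := by
      rw [← hi.integral_norm_sq]
      refine integral_congr_ae ?_
      filter_upwards [hi.ae_mem] with z hz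
      have := quadric_scl (fun x hx => by rw [hb x hx]; ring) hp hz
      simpa only [real_inner_comm z] using this
    rw [integral_add (integrable_finsetSum _ hi1) hi2, integral_finsetSum _ hi1] at key
    simp only [integral_const_mul] at key
    have : ∀ a, q a * (2 * ∫ z, inner ℝ z (e a) ^ 2 ∂gam n (FlatnessPropagation.scl n (τ i) ν)) =
        2 * (q a * ∫ z, inner ℝ z (e a) ^ 2 ∂gam n (FlatnessPropagation.scl n (τ i) ν)) :=
      fun a => by ring
    simp only [this, ← Finset.mul_sum]
    linarith
  simpa [sq] using tendsto_nhds_unique h4 tendsto_const_nhds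

end

section

variable {d n : ℕ}

theorem res_smul (v : Fin n → Euc d) (c : ℝ) (z : Euc d) : res v (c • z) = c • res v z := by
  simp [res, inner_smul_right, smul_sub, Finset.smul_sum, smul_smul]

theorem res_add (v : Fin n → Euc d) (x y : Euc d) : res v (x + y) = res v x + res v y := by
  simp only [res, inner_add_right, add_smul, Finset.sum_add_distrib]
  abel

theorem sub_res_mem_span (v : Fin n → Euc d) (x : Euc d) :
    x - res v x ∈ Submodule.span ℝ (range v) := by
  rw [res, sub_sub_cancel]
  exact Submodule.sum_mem _ fun a _ => Submodule.smul_mem _ _ (Submodule.subset_span ⟨a, rfl⟩)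

theorem inner_res_of_mem_span {v : Fin n → Euc d} (hv : Orthonormal ℝ v) {x : Euc d}
    (hx : x ∈ Submodule.span ℝ (range v)) (z : Euc d) : inner ℝ x (res v z) = 0 := by
  induction hx using Submodule.span_induction with
  | mem y hy => obtain ⟨a, rfl⟩ := hy; exact inner_res hv a z
  | zero => simp
  | add y w _ _ h1 h2 => simp [inner_add_left, h1, h2]
  | smul c y _ h1 => simp [inner_smul_left, h1]

theorem norm_res_le {v : Fin n → Euc d} (hv : Orthonormal ℝ v) (z : Euc d) : ‖res v z‖ ≤ ‖z‖ := by
  have h1 := norm_res_sq hv z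
  have h2 : 0 ≤ ∑ a, inner ℝ (v a) z ^ 2 := Finset.sum_nonneg fun a _ => sq_nonneg _
  exact (sq_le_sq₀ (norm_nonneg _) (norm_nonneg _)).1 (by linarith)

theorem norm_sub_res_le {v : Fin n → Euc d} (hv : Orthonormal ℝ v) (z : Euc d) :
    ‖z - res v z‖ ≤ ‖z‖ := by
  have h1 := inner_res_of_mem_span hv (sub_res_mem_span v z) z
  have h2 := norm_add_sq_real (z - res v z) (res v z)
  rw [h1, sub_add_cancel] at h2
  exact (sq_le_sq₀ (norm_nonneg _) (norm_nonneg _)).1 (by nlinarith [sq_nonneg ‖res v z‖])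

theorem Unif.integral_res_le_of_near {ν : Measure (Euc d)} (h : Unif n ν) {v : Fin n → Euc d}
    (hv : Orthonormal ℝ v) {A δ : ℝ} (hA : 0 ≤ A)
    (hf : ∀ z ∈ msupport ν, ‖z‖ < A → ‖res v z‖ ≤ δ * A) :
    ∫ z, ‖res v z‖ ^ 2 ∂gam n ν ≤ (δ * A) ^ 2 + 2 * Real.exp (-A) * expMom n 2 := by
  have := h.isProbabilityMeasure
  have h1 : ∫ z, ((δ * A) ^ 2 + 2 * Real.exp (-A) * Real.exp (2 * ‖z‖)) ∂gam n ν =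
      (δ * A) ^ 2 + 2 * Real.exp (-A) * expMom n 2 := by
    rw [integral_add (integrable_const _) ((h.integrable_exp 2).const_mul _), integral_const_mul,
      h.integral_exp]
    simp
  rw [← h1]
  refine integral_mono_ae (h.integrable (ExpGrowth.norm_res_sq hv))
    ((integrable_const _).add ((h.integrable_exp 2).const_mul _)) ?_
  filter_upwards [h.ae_mem] with z hz
  by_cases hzA : ‖z‖ < A
  · have := hf z hz hzA
    have h2 : ‖res v z‖ ^ 2 ≤ (δ * A) ^ 2 := pow_le_pow_left₀ (norm_nonneg _) this 2
    have : 0 < 2 * Real.exp (-A) * Real.exp (2 * ‖z‖) := by positivity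
    linarith
  · have h2 : ‖res v z‖ ^ 2 ≤ ‖z‖ ^ 2 := pow_le_pow_left₀ (norm_nonneg _) (norm_res_le hv z) 2
    have h3 := Real.quadratic_le_exp_of_nonneg (norm_nonneg z)
    have h4 : Real.exp ‖z‖ ≤ Real.exp (-A) * Real.exp (2 * ‖z‖) := by
      rw [← Real.exp_add]
      exact Real.exp_le_exp.2 (by linarith)
    have : 0 ≤ (δ * A) ^ 2 := sq_nonneg _
    have := norm_nonneg z
    nlinarith

/-- If a uniform measure is sufficiently flat at infinity, its support is contained in a
paraboloid over an `n`-plane. -/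
theorem exists_paraboloid_threshold (d : ℕ) (hn : 0 < n) : ∃ η : ℝ, 0 < η ∧
    ∀ ν : Measure (Euc d), Unif n ν → ∀ τ : ℕ → ℝ, Tendsto τ atTop (𝓝[>] 0) →
      ∀ v : ℕ → Fin n → Euc d, (∀ k, Orthonormal ℝ (v k)) →
      (∀ k, ∫ z, ‖res (v k) z‖ ^ 2 ∂gam n (scl n (τ k) ν) ≤ η) →
      ∃ (e : Fin n → Euc d) (b : Euc d), Orthonormal ℝ e ∧
        ∀ z ∈ msupport ν, ‖res e z‖ ^ 2 = inner ℝ b z := by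
  have hn' : (1 : ℝ) ≤ n := by exact_mod_cast hn
  obtain ⟨η₀, hη₀, hflat⟩ := exists_flat_threshold d n (ε := 1 / (8 * n)) (by positivity)
  set η := min (η₀ / 2) (min (1 / (512 * (n : ℝ) ^ 2)) (min (1 / (16 * (d + 1))) (1 / 16)))
    with hηdef
  have hη : 0 < η := by positivity
  have ha1 : 2 * η ≤ η₀ := by
    have : η ≤ η₀ / 2 := min_le_left _ _
    linarith
  have ha2 : η ≤ 1 / (512 * (n : ℝ) ^ 2) := (min_le_right _ _).trans (min_le_left _ _)
  have ha3 : 8 * η * d < 1 := by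
    have h1 : η ≤ 1 / (16 * ((d : ℝ) + 1)) :=
      (min_le_right _ _).trans ((min_le_right _ _).trans (min_le_left _ _))
    rw [le_div_iff₀ (by positivity)] at h1
    nlinarith
  have ha4 : η ≤ 1 / 16 := (min_le_right _ _).trans ((min_le_right _ _).trans (min_le_right _ _))
  refine ⟨η, hη, fun ν h τ hτ v hv hdef => ?_⟩
  let U : Ultrafilter ℕ := hyperfilter ℕ
  have hUle : (U : Filter ℕ) ≤ atTop := by
    rw [← Nat.cofinite_eq_atTop]; exact hyperfilter_le_cofinite
  have hτU : Tendsto τ U (𝓝[>] 0) := hτ.mono_left hUle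
  have hτ0 : Tendsto τ U (𝓝 0) := hτU.mono_right nhdsWithin_le_nhds
  have hpos : ∀ᶠ i in U, 0 < τ i := hτU.eventually self_mem_nhdsWithin
  have hu : ∀ᶠ i in U, Unif n (scl n (τ i) ν) := hpos.mono fun i hi => h.scl hi
  obtain ⟨e, q, b, hdiag, hq0, hqs, hq2, hquad⟩ := h.exists_quadric U hτU
  obtain ⟨w, hw, hvw⟩ := exists_ultralimit_orthonormal U (Eventually.of_forall hv)
  -- defects with respect to the limit plane
  have hdw : ∀ᶠ k in U, ∫ z, ‖res w z‖ ^ 2 ∂gam n (scl n (τ k) ν) ≤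
      η + n * ∑ a, ‖v k a - w a‖ := by
    filter_upwards [hu] with k hk
    have := hk.integral_res_le (hv k) hw
    linarith [hdef k]
  have hlim0 : Tendsto (fun k => η + n * ∑ a, ‖v k a - w a‖) U (𝓝 η) := by
    have h1 : Tendsto (fun k => ∑ a, ‖v k a - w a‖) U (𝓝 (∑ a : Fin n, ‖w a - w a‖)) :=
      tendsto_finsetSum _ fun a _ => ((hvw a).sub_const _).norm
    simpa using (h1.const_mul (n : ℝ)).const_add η
  have hdw2 : ∀ᶠ k in U, ∫ z, ‖res w z‖ ^ 2 ∂gam n (scl n (τ k) ν) ≤ η₀ := by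
    filter_upwards [hdw, hlim0.eventually (eventually_lt_nhds (b := 2 * η) (by linarith))]
      with k h1 h2
    linarith
  let p : Fin d → ℝ := fun i => ∑ a, inner ℝ (w a) (e i) ^ 2
  have hp0 : ∀ i, 0 ≤ p i := fun i => Finset.sum_nonneg fun a _ => sq_nonneg _
  have hp1 : ∀ i, p i ≤ 1 := fun i => by
    have := sum_inner_sq_le hw (e i)
    simpa [p] using this
  have hps : ∑ i, p i = n := by
    simp only [p]
    rw [Finset.sum_comm]
    have : ∀ a, ∑ i, inner ℝ (w a) (e i) ^ 2 = 1 := fun a => by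
      have h1 := e.sum_sq_norm_inner_left (w a)
      rw [hw.1 a] at h1
      simpa using h1
    simp [this]
  have hqp : n - 2 * η ≤ ∑ i, q i * p i := by
    have h1 : Tendsto (fun k => n - ∑ a, 2 * ∫ z, inner ℝ z (w a) * inner ℝ z (w a)
        ∂gam n (scl n (τ k) ν)) U
        (𝓝 (n - ∑ a, ∑ i, q i * (inner ℝ (e i) (w a) * inner ℝ (e i) (w a)))) :=
      (tendsto_finsetSum _ fun a _ => hdiag (w a) (w a)).const_sub _
    have h2 : ∑ a, ∑ i, q i * (inner ℝ (e i) (w a) * inner ℝ (e i) (w a)) = ∑ i, q i * p i := by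
      rw [Finset.sum_comm]
      refine Finset.sum_congr rfl fun i _ => ?_
      rw [Finset.mul_sum]
      exact Finset.sum_congr rfl fun a _ => by rw [real_inner_comm, sq]
    rw [h2] at h1
    have h3 := le_of_tendsto_of_tendsto h1 (hlim0.const_mul 2) (by
      filter_upwards [hdw, hu] with k hk1 hk2
      have hi : ∀ a ∈ Finset.univ, Integrable (fun z => inner ℝ (w a) z ^ 2)
          (gam n (scl n (τ k) ν)) :=
        fun a _ => hk2.integrable ((ExpGrowth.inner_left (w a)).pow 2)
      have : ∫ z, ‖res w z‖ ^ 2 ∂gam n (scl n (τ k) ν) =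
          n / 2 - ∑ a, ∫ z, inner ℝ z (w a) * inner ℝ z (w a) ∂gam n (scl n (τ k) ν) := by
        simp only [norm_res_sq hw]
        rw [integral_sub (hk2.integrable (ExpGrowth.norm.pow 2)) (integrable_finsetSum _ hi),
          integral_finsetSum _ hi, hk2.integral_norm_sq]
        simp only [sq, real_inner_comm]
      simp only [← Finset.mul_sum]
      linarith)
    linarith
  obtain ⟨hT, hTp, hTq⟩ := weights_concentrate hn hq2 hp0 hp1 hps hqp ha4 ha3
  set T := Finset.univ.filter fun i => 1 / 2 ≤ p i with hTdef
  have hmem : ∀ i, i ∈ T ↔ 1 / 2 ≤ p i := fun i => by simp [hTdef]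
  have hind := weights_eq_indicator (ρ := 1 / (4 * n)) hT hqs hq0
    (fun i hi => hTq i fun h' => hi ((hmem i).2 h')) (by
      rw [div_le_div_iff₀ (by positivity) (by positivity)]; linarith) (by
      rw [div_pow, mul_pow, one_pow, mul_one_div, div_lt_one (by positivity)]
      nlinarith) (by
    intro i hi
    have hpi := hTp i ((hmem i).1 hi)
    have hx := sub_res_mem_span w (e i)
    have hxn : ‖e i - res w (e i)‖ ≤ 1 := by simpa using norm_sub_res_le hw (e i)
    have hxe : ‖res w (e i)‖ ≤ 1 / (8 * n) := by
      have h1 := norm_res_sq hw (e i)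
      rw [e.norm_eq_one] at h1
      refine (sq_le_sq₀ (norm_nonneg _) (by positivity)).1 ?_
      have h2 : ‖res w (e i)‖ ^ 2 = 1 - p i := by rw [h1]; simp [p]
      have h3 : 8 * η ≤ (1 / (8 * (n : ℝ))) ^ 2 := by
        have : (1 / (8 * (n : ℝ))) ^ 2 = 8 * (1 / (512 * (n : ℝ) ^ 2)) := by
          field_simp; norm_num
        linarith
      linarith
    have hex : ∀ᶠ k in U, ∃ y ∈ msupport (scl n (τ k) ν), ‖y - e i‖ ≤ 1 / (4 * n) := by
      filter_upwards [hu, hdw2] with k h1 h2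
      obtain ⟨y, hy, hyx⟩ := hflat _ h1 w hw h2 _ hx hxn
      refine ⟨y, hy, ?_⟩
      have h3 : y - e i = (y - (e i - res w (e i))) - res w (e i) := by abel
      rw [h3]
      refine (norm_sub_le _ _).trans ?_
      have : 1 / (4 * (n : ℝ)) = 1 / (8 * n) + 1 / (8 * n) := by field_simp; norm_num
      linarith
    have hch : ∀ k, ∃ y, (∃ y ∈ msupport (scl n (τ k) ν), ‖y - e i‖ ≤ 1 / (4 * n)) →
        y ∈ msupport (scl n (τ k) ν) ∧ ‖y - e i‖ ≤ 1 / (4 * n) := fun k => by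
      by_cases hk : ∃ y ∈ msupport (scl n (τ k) ν), ‖y - e i‖ ≤ 1 / (4 * n)
      · obtain ⟨y, hy⟩ := hk
        exact ⟨y, fun _ => hy⟩
      · exact ⟨0, fun h => absurd h hk⟩
    choose y hy using hch
    have hy' := hex.mono fun k hk => hy k hk
    obtain ⟨y', hyy⟩ := exists_ultralimit U (f := y) (x := e i) (M := 1 / (4 * n))
      (hy'.mono fun k hk => by rw [dist_eq_norm]; exact hk.2)
    have hyn : ‖y' - e i‖ ≤ 1 / (4 * n) :=
      le_of_tendsto (hyy.sub_const (e i)).norm (hy'.mono fun k hk => hk.2)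
    have hcoord : ∀ j, |inner ℝ (e j) (y' - e i)| ≤ 1 / (4 * n) := fun j =>
      (abs_real_inner_le_norm _ _).trans (by simpa using hyn)
    refine ⟨fun j => inner ℝ (e j) y', ?_, ?_, fun j hj => ?_⟩
    · have h1 : Tendsto (fun k => ∑ j, q j * inner ℝ (e j) (y k) ^ 2 + τ k * inner ℝ b (y k)
          - ‖y k‖ ^ 2) U (𝓝 (∑ j, q j * inner ℝ (e j) y' ^ 2 + 0 * inner ℝ b y' - ‖y'‖ ^ 2)) :=
        ((tendsto_finsetSum _ fun j _ => ((tendsto_const_nhds.inner hyy).pow 2).const_mul _).add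
          (hτ0.mul (tendsto_const_nhds.inner hyy))).sub (hyy.norm.pow 2)
      have h2 : Tendsto (fun k => ∑ j, q j * inner ℝ (e j) (y k) ^ 2 + τ k * inner ℝ b (y k)
          - ‖y k‖ ^ 2) U (𝓝 0) := by
        refine tendsto_const_nhds.congr' ?_
        filter_upwards [hy', hpos] with k hk hp
        rw [quadric_scl hquad hp hk.1, sub_self]
      have h3 := tendsto_nhds_unique h1 h2
      have h4 := e.sum_sq_norm_inner_right y'
      simp only [Real.norm_eq_abs, sq_abs] at h4
      simp only [sub_mul, one_mul, Finset.sum_sub_distrib]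
      rw [h4]
      linarith
    · have := hcoord i
      rwa [inner_sub_right, real_inner_self_eq_norm_sq, e.norm_eq_one, one_pow] at this
    · have := hcoord j
      rwa [inner_sub_right, e.inner_eq_zero hj, sub_zero] at this)
  let g : Fin n ≃ T := (Fintype.equivFinOfCardEq (by simpa using hT)).symm
  have hg : Orthonormal ℝ fun a => e (g a).1 :=
    e.orthonormal.comp _ (Subtype.val_injective.comp g.injective)
  refine ⟨fun a => e (g a).1, b, hg, fun z hz => ?_⟩
  rw [norm_res_sq hg, ← hquad z hz]
  have : ∑ a, inner ℝ (e (g a).1) z ^ 2 = ∑ a, q a * inner ℝ (e a) z ^ 2 := by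
    rw [g.sum_comp (fun t : T => inner ℝ (e t.1) z ^ 2), Finset.sum_coe_sort T
      (fun i => inner ℝ (e i) z ^ 2)]
    simp [hind, ite_mul, Finset.sum_ite_mem]
  rw [this]; ring

/-- The threshold of flatness below which uniform measures are contained in a paraboloid. -/
theorem exists_paraboloid (d : ℕ) (hn : 0 < n) : ∃ δ : ℝ, 0 < δ ∧
    ∀ ν : Measure (Euc d), Unif n ν →
      (∀ k : ℕ, 1 ≤ k → ∃ v : Fin n → Euc d, Orthonormal ℝ v ∧
        ∀ z ∈ msupport ν, ‖z‖ < 2 ^ k → ‖res v z‖ ≤ δ * 2 ^ k) →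
      ∃ (e : Fin n → Euc d) (b : Euc d), Orthonormal ℝ e ∧
        ∀ z ∈ msupport ν, ‖res e z‖ ^ 2 = inner ℝ b z := by
  obtain ⟨η, hη, H⟩ := exists_paraboloid_threshold d hn
  obtain ⟨A, hA0, hA⟩ : ∃ A : ℝ, 0 < A ∧ 2 * Real.exp (-A) * expMom n 2 < η / 2 := by
    have h1 : Tendsto (fun A : ℝ => 2 * Real.exp (-A) * expMom n 2) atTop (𝓝 0) := by
      simpa using ((Real.tendsto_exp_neg_atTop_nhds_zero).const_mul 2).mul_const (expMom n 2)
    exact ((eventually_gt_atTop 0).and (h1.eventually (eventually_lt_nhds (half_pos hη)))).exists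
  refine ⟨Real.sqrt (η / 2) / A, by positivity, fun ν h hf => ?_⟩
  choose v hv hvf using fun k : ℕ => hf (k + 1) (by omega)
  have hτpos : ∀ k : ℕ, 0 < A * (1 / 2 : ℝ) ^ (k + 1) := fun k => by positivity
  refine H ν h (fun k => A * (1 / 2) ^ (k + 1)) ?_ v hv fun k => ?_
  · refine tendsto_nhdsWithin_iff.2 ⟨?_, Eventually.of_forall hτpos⟩
    have := (tendsto_pow_atTop_nhds_zero_of_lt_one (r := (1 / 2 : ℝ)) (by norm_num)
      (by norm_num)).comp (tendsto_add_atTop_nat 1)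
    simpa using this.const_mul A
  · have h1 := (h.scl (hτpos k)).integral_res_le_of_near (hv k) (A := A)
      (δ := Real.sqrt (η / 2) / A) hA0.le (fun z hz hzA => by
        have h2 := hvf k _ ((mem_msupport_scl (hτpos k)).1 hz) (by
          rw [norm_smul, norm_inv, Real.norm_of_nonneg (hτpos k).le, inv_mul_lt_iff₀ (hτpos k)]
          rw [mul_assoc, ← mul_pow]
          simpa using hzA)
        rw [res_smul, norm_smul, norm_inv, Real.norm_of_nonneg (hτpos k).le,
          inv_mul_le_iff₀ (hτpos k)] at h2
        refine h2.trans (le_of_eq ?_)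
        have : (1 / 2 : ℝ) ^ (k + 1) * 2 ^ (k + 1) = 1 := by rw [← mul_pow]; norm_num
        calc _ = Real.sqrt (η / 2) / A * A * ((1 / 2 : ℝ) ^ (k + 1) * 2 ^ (k + 1)) := by ring
          _ = _ := by rw [this, mul_one])
    rw [div_mul_cancel₀ _ hA0.ne', Real.sq_sqrt (by positivity)] at h1
    linarith

end

section

variable {d n : ℕ} {ν : Measure (Euc d)} {τ : ℝ}

/-- The Gaussian probability measure with density proportional to `exp (-τ² ‖z‖²)`. -/
def gau (n : ℕ) (ν : Measure (Euc d)) (τ : ℝ) : Measure (Euc d) :=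
  (gam n (scl n τ ν)).map (τ⁻¹ • ·)

theorem measurableEmbedding_smul (hτ : τ ≠ 0) :
    MeasurableEmbedding fun z : Euc d => τ⁻¹ • z :=
  (Homeomorph.smulOfNeZero τ⁻¹ (inv_ne_zero hτ)).measurableEmbedding

theorem integral_gau {E : Type*} [NormedAddCommGroup E] [NormedSpace ℝ E] (hτ : 0 < τ)
    (f : Euc d → E) : ∫ z, f z ∂gau n ν τ = ∫ z, f (τ⁻¹ • z) ∂gam n (scl n τ ν) :=
  (measurableEmbedding_smul hτ.ne').integral_map f

theorem integral_gau_smul {E : Type*} [NormedAddCommGroup E] [NormedSpace ℝ E] (hτ : 0 < τ)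
    (f : Euc d → E) : ∫ z, f (τ • z) ∂gau n ν τ = ∫ z, f z ∂gam n (scl n τ ν) := by
  rw [integral_gau hτ]
  simp [smul_smul, hτ.ne']

theorem Unif.isProbabilityMeasure_gau (h : Unif n ν) (hτ : 0 < τ) :
    IsProbabilityMeasure (gau n ν τ) := by
  have := (h.scl hτ).isProbabilityMeasure
  exact Measure.isProbabilityMeasure_map (by fun_prop)

theorem Unif.integrable_gau (h : Unif n ν) (hτ : 0 < τ) {f : Euc d → ℝ} (hf : ExpGrowth f) :
    Integrable f (gau n ν τ) :=
  (measurableEmbedding_smul hτ.ne').integrable_map_iff.2 ((h.scl hτ).integrable (hf.comp_smul _))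

theorem Unif.integrable_gau_of_norm {E : Type*} [NormedAddCommGroup E] [NormedSpace ℝ E]
    [SecondCountableTopology E]
    (h : Unif n ν) (hτ : 0 < τ) {f : Euc d → E} (hc : Continuous f)
    (hf : ExpGrowth fun z => ‖f z‖) : Integrable f (gau n ν τ) :=
  (integrable_norm_iff hc.aestronglyMeasurable).1 (h.integrable_gau hτ hf)

theorem Unif.ae_mem_gau (h : Unif n ν) (hτ : 0 < τ) : ∀ᵐ z ∂gau n ν τ, z ∈ msupport ν := by
  rw [gau, (measurableEmbedding_smul hτ.ne').ae_map_iff]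
  filter_upwards [(h.scl hτ).ae_mem] with z hz
  exact (mem_msupport_scl hτ).1 hz

theorem Unif.integral_gau_congr (h : Unif n ν) (hτ : 0 < τ) {f g : Euc d → ℝ}
    (hfg : ∀ z ∈ msupport ν, f z = g z) : ∫ z, f z ∂gau n ν τ = ∫ z, g z ∂gau n ν τ :=
  integral_congr_ae ((h.ae_mem_gau hτ).mono hfg)

theorem Unif.integral_gau_density (h : Unif n ν) (hτ : 0 < τ) (f : Euc d → ℝ) :
    ∫ z, f z ∂gau n ν τ =
      τ ^ n * (∫ z, f z * Real.exp (-(τ ^ 2 * ‖z‖ ^ 2)) ∂ν) / gaussMass n := by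
  rw [integral_gau hτ, (h.scl hτ).integral_gam, integral_scl hτ]
  congr 3
  ext z
  rw [smul_smul, inv_mul_cancel₀ hτ.ne', one_smul, norm_smul, Real.norm_of_nonneg hτ.le, mul_pow]

theorem Unif.pow_mul_abs_integral_gau_le (h : Unif n ν) (hτ : 0 < τ) {f : Euc d → ℝ} {C : ℝ}
    {m : ℕ} (hC : 0 ≤ C) (hf : ∀ z ∈ msupport ν, |f z| ≤ C * ‖z‖ ^ m) :
    τ ^ m * |∫ z, f z ∂gau n ν τ| ≤ C * m.factorial * expMom n 1 := by
  rw [← abs_of_pos (pow_pos hτ m), ← abs_mul, ← integral_const_mul, integral_gau hτ,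
    ← (h.scl hτ).integral_exp, ← integral_const_mul]
  refine (abs_integral_le_integral_abs).trans ?_
  refine integral_mono_of_nonneg (Eventually.of_forall fun z => abs_nonneg _)
    (((h.scl hτ).integrable_exp 1).const_mul _) ?_
  filter_upwards [(h.scl hτ).ae_mem] with z hz
  have h1 := hf _ ((mem_msupport_scl hτ).1 hz)
  rw [norm_smul, norm_inv, Real.norm_of_nonneg hτ.le, mul_pow, inv_pow] at h1
  simp only [abs_mul, abs_of_pos (pow_pos hτ m)]
  have h2 := Real.pow_div_factorial_le_exp ‖z‖ (norm_nonneg z) m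
  rw [div_le_iff₀ (by positivity)] at h2
  calc τ ^ m * |f (τ⁻¹ • z)| ≤ τ ^ m * (C * ((τ ^ m)⁻¹ * ‖z‖ ^ m)) := by gcongr
    _ = C * ‖z‖ ^ m := by field_simp
    _ ≤ C * (Real.exp ‖z‖ * m.factorial) := by gcongr
    _ = _ := by rw [one_mul]; ring

theorem Unif.tendsto_pow_mul_integral_gau (h : Unif n ν) {f : Euc d → ℝ} {C : ℝ} {m k : ℕ}
    (hC : 0 ≤ C) (hf : ∀ z ∈ msupport ν, |f z| ≤ C * ‖z‖ ^ m) (hmk : m < k) :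
    Tendsto (fun τ : ℝ => τ ^ k * ∫ z, f z ∂gau n ν τ) (𝓝[>] 0) (𝓝 0) := by
  have h0 : Tendsto (fun τ : ℝ => τ ^ (k - m) * (C * m.factorial * expMom n 1)) (𝓝[>] 0)
      (𝓝 0) := by
    have : Tendsto (fun τ : ℝ => τ ^ (k - m) * (C * m.factorial * expMom n 1)) (𝓝 0)
        (𝓝 (0 ^ (k - m) * (C * m.factorial * expMom n 1))) := by
      exact ((continuous_pow _).mul continuous_const).tendsto 0
    rw [zero_pow (by omega), zero_mul] at this
    exact this.mono_left nhdsWithin_le_nhds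
  refine squeeze_zero_norm' ?_ h0
  filter_upwards [self_mem_nhdsWithin] with τ hτ
  have hτ' : 0 < τ := hτ
  have h1 := h.pow_mul_abs_integral_gau_le hτ hC hf
  rw [Real.norm_eq_abs, abs_mul, abs_of_pos (pow_pos hτ' k)]
  have h2 : τ ^ k = τ ^ (k - m) * τ ^ m := by rw [← pow_add]; congr 1; omega
  rw [h2, mul_assoc]
  gcongr

theorem tendsto_integral_of_plane {ι : Type*} {F : Filter ι} {ν : ι → Measure (Euc d)}
    {v : Fin n → Euc d} (h : ∀ᶠ i in F, Unif n (ν i)) (hv : Orthonormal ℝ v)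
    (h0 : Tendsto (fun i => ∫ z, ‖res v z‖ ^ 2 ∂gam n (ν i)) F (𝓝 0)) {f : Euc d → ℝ}
    (hf : ExpGrowth f) {c : ℝ} (hc : ∀ lam : Measure (Euc d), Unif n lam →
      msupport lam = Submodule.span ℝ (range v) → ∫ z, f z ∂gam n lam = c) :
    Tendsto (fun i => ∫ z, f z ∂gam n (ν i)) F (𝓝 c) := by
  refine (tendsto_iff_ultrafilter _ _ _).2 fun U hU => ?_
  obtain ⟨lam, h1, h2, h3, -⟩ :=
    exists_plane_limit_of_eventually U (hU h) hv (h0.mono_left hU)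
  have := h3 f hf
  rw [hc lam h1 h2] at this
  exact this

theorem integral_inner_pow_of_plane {lam : Measure (Euc d)} (h : Unif n lam)
    {v : Fin n → Euc d} (hv : Orthonormal ℝ v) (hV : msupport lam = Submodule.span ℝ (range v))
    (x : Euc d) (k : ℕ) : ∫ z, inner ℝ z x ^ k ∂gam n lam =
      ∫ z, inner ℝ z (x - res v x) ^ k ∂gam n lam := by
  refine integral_congr_ae ?_
  filter_upwards [h.ae_mem] with z hz
  rw [hV] at hz
  simp only [inner_sub_right, inner_res_of_mem_span hv hz x, sub_zero]

theorem norm_sub_res_sq {v : Fin n → Euc d} (hv : Orthonormal ℝ v) (x : Euc d) :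
    ‖x - res v x‖ ^ 2 = ∑ a, inner ℝ (v a) x ^ 2 := by
  have h1 := inner_res_of_mem_span hv (sub_res_mem_span v x) x
  have h2 := norm_add_sq_real (x - res v x) (res v x)
  rw [h1, sub_add_cancel, norm_res_sq hv] at h2
  linarith

/-- A uniform measure whose support is contained in the paraboloid over the plane spanned by `v`
in the direction `b`, where `b` is the limit of renormalized barycenters. -/
structure Paraboloid (n : ℕ) (ν : Measure (Euc d)) (v : Fin n → Euc d) (b : Euc d) : Prop where
  unif : Unif n ν
  orth : Orthonormal ℝ v
  eq : ∀ z ∈ msupport ν, ‖res v z‖ ^ 2 = inner ℝ b z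
  defect : Tendsto (fun τ => ∫ z, ‖res v z‖ ^ 2 ∂gam n (scl n τ ν)) (𝓝[>] 0) (𝓝 0)
  perp : ∀ a, inner ℝ (v a) b = 0
  lin : ∀ y, Tendsto (fun τ => ∫ z, inner ℝ z y ∂gau n ν τ) (𝓝[>] 0) (𝓝 (inner ℝ b y / 2))

theorem Unif.eventually_scl (h : Unif n ν) : ∀ᶠ τ : ℝ in 𝓝[>] 0, Unif n (FlatnessPropagation.scl n τ ν) := by
  filter_upwards [self_mem_nhdsWithin] with τ hτ using h.scl hτ

theorem Unif.defect_of_eq (h : Unif n ν) {v : Fin n → Euc d} {b : Euc d}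
    (heq : ∀ z ∈ msupport ν, ‖res v z‖ ^ 2 = inner ℝ b z) :
    Tendsto (fun τ => ∫ z, ‖res v z‖ ^ 2 ∂gam n (FlatnessPropagation.scl n τ ν)) (𝓝[>] 0) (𝓝 0) := by
  have h1 := h.tendsto_pow_mul_integral_gau (f := fun z => ‖res v z‖ ^ 2) (C := ‖b‖) (m := 1)
    (k := 2) (norm_nonneg b) (fun z hz => by
      rw [heq z hz, pow_one]; exact abs_real_inner_le_norm _ _) (by norm_num)
  refine h1.congr' ?_
  filter_upwards [self_mem_nhdsWithin] with τ hτ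
  have hτ' : 0 < τ := hτ
  rw [← integral_gau_smul hτ', ← integral_const_mul]
  simp only [res_smul, norm_smul, mul_pow, Real.norm_eq_abs, sq_abs]

theorem Unif.exists_paraboloid_barycenter (h : Unif n ν) {v : Fin n → Euc d} {b : Euc d}
    (hv : Orthonormal ℝ v) (heq : ∀ z ∈ msupport ν, ‖res v z‖ ^ 2 = inner ℝ b z) :
    ∃ b', Paraboloid n ν v b' := by
  have hdef := h.defect_of_eq heq
  have hlin1 : ∀ x ∈ msupport ν, Tendsto (fun τ => ∫ z, inner ℝ z x ∂gau n ν τ) (𝓝[>] 0)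
      (𝓝 (inner ℝ b x / 2)) := fun x hx => by
    have hQ : Tendsto (fun τ => 2 * ∫ z, inner ℝ z x ^ 2 ∂gam n (FlatnessPropagation.scl n τ ν))
        (𝓝[>] 0) (𝓝 (2 * (‖x - res v x‖ ^ 2 / 2))) :=
      (tendsto_integral_of_plane h.eventually_scl hv hdef ((ExpGrowth.inner_right x).pow 2)
        fun lam hl hV => by
          rw [integral_inner_pow_of_plane hl hv hV,
            (hl.moment_two_four hV (sub_res_mem_span v x)).1]).const_mul 2
    have h1 := (h.tendsto_linear_part (F := 𝓝[>] (0 : ℝ)) tendsto_id hx hQ).div_const 2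
    have h2 : ‖x‖ ^ 2 - 2 * (‖x - res v x‖ ^ 2 / 2) = inner ℝ b x := by
      rw [← heq x hx, norm_res_sq hv, norm_sub_res_sq hv]; ring
    rw [h2] at h1
    refine h1.congr' ?_
    filter_upwards [self_mem_nhdsWithin] with τ hτ
    rw [integral_gau hτ]
    simp only [inner_smul_left, integral_const_mul, id]
    simp
    ring
  let S := Submodule.span ℝ (msupport ν)
  have hSmem : ∀ z ∈ msupport ν, z ∈ S := fun z hz => Submodule.subset_span hz
  let b' : Euc d := S.starProjection b
  have hb' : ∀ z ∈ S, inner ℝ b' z = inner ℝ b z := fun z hz => by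
    have := Submodule.starProjection_inner_eq_zero (K := S) b z hz
    rw [inner_sub_left] at this
    linarith
  have heq' : ∀ z ∈ msupport ν, ‖res v z‖ ^ 2 = inner ℝ b' z := fun z hz => by
    rw [hb' z (hSmem z hz), heq z hz]
  have hinner : ∀ (τ : ℝ) (y : Euc d), 0 < τ → Integrable (fun z => inner ℝ z y) (gau n ν τ) :=
    fun τ y hτ => h.integrable_gau hτ (ExpGrowth.inner_right y)
  refine ⟨b', h, hv, heq', hdef, fun a => ?_, fun y => ?_⟩
  · have hnn : ∀ x ∈ Submodule.span ℝ (range v), 0 ≤ inner ℝ b' x := fun x hx => by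
      refine le_of_forall_pos_le_add fun ε hε => ?_
      obtain ⟨τ, ⟨y, hy, hyx⟩, hτ⟩ := ((eventually_exists_near h.eventually_scl hv hdef hx
        (ε := ε / (‖b'‖ + 1)) (by positivity)).and self_mem_nhdsWithin).exists
      have hτ' : 0 < τ := hτ
      have h1 := heq' _ ((mem_msupport_scl hτ').1 hy)
      rw [inner_smul_right] at h1
      have h2 : 0 ≤ inner ℝ b' y := by
        have : 0 ≤ τ⁻¹ * inner ℝ b' y := h1 ▸ sq_nonneg _
        exact nonneg_of_mul_nonneg_right this (by positivity)
      have h3 : inner ℝ b' y - inner ℝ b' x ≤ ε := by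
        rw [← inner_sub_right]
        refine (real_inner_le_norm _ _).trans ?_
        rw [dist_eq_norm, lt_div_iff₀ (by positivity)] at hyx
        nlinarith [norm_nonneg (y - x)]
      linarith
    have h1 := hnn (v a) (Submodule.subset_span ⟨a, rfl⟩)
    have h2 := hnn (-v a) (Submodule.neg_mem _ (Submodule.subset_span ⟨a, rfl⟩))
    rw [inner_neg_right] at h2
    rw [real_inner_comm]
    linarith
  · have hS : ∀ y ∈ S, Tendsto (fun τ => ∫ z, inner ℝ z y ∂gau n ν τ) (𝓝[>] 0)
        (𝓝 (inner ℝ b' y / 2)) := fun y hy => by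
      induction hy using Submodule.span_induction with
      | mem x hx => rw [hb' x (hSmem x hx)]; exact hlin1 x hx
      | zero => simp
      | add x y _ _ h1 h2 =>
        rw [inner_add_right, add_div]
        refine (h1.add h2).congr' ?_
        filter_upwards [self_mem_nhdsWithin] with τ hτ
        rw [← integral_add (hinner τ x hτ) (hinner τ y hτ)]
        simp only [inner_add_right]
      | smul c x _ h1 =>
        rw [inner_smul_right, mul_div_assoc]
        refine (h1.const_mul c).congr fun τ => ?_
        rw [← integral_const_mul]
        simp only [inner_smul_right]
    have h0 := hS _ (S.starProjection_apply_mem y)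
    have hy : ∀ z ∈ S, inner ℝ z (S.starProjection y) = inner ℝ z y := fun z hz => by
      have := Submodule.starProjection_inner_eq_zero (K := S) y z hz
      rw [inner_sub_left, real_inner_comm, real_inner_comm z] at this
      linarith
    rw [hy b' (S.starProjection_apply_mem b)] at h0
    refine h0.congr' ?_
    filter_upwards [self_mem_nhdsWithin] with τ hτ
    exact h.integral_gau_congr hτ fun z hz => hy z (hSmem z hz)

end

section

variable {d n : ℕ} {ν : Measure (Euc d)} {τ : ℝ}

theorem Unif.integrable_gau_iff (h : Unif n ν) (hτ : 0 < τ) {f : Euc d → ℝ} :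
    Integrable f (gau n ν τ) ↔ Integrable (fun z => f z * Real.exp (-(τ ^ 2 * ‖z‖ ^ 2))) ν := by
  have h1 : Integrable f (gau n ν τ) ↔
      Integrable (fun z => f (τ⁻¹ • z)) (gam n (FlatnessPropagation.scl n τ ν)) :=
    (measurableEmbedding_smul hτ.ne').integrable_map_iff
  have hm : MeasurableEmbedding fun z : Euc d => τ • z :=
    (Homeomorph.smulOfNeZero τ hτ.ne').measurableEmbedding
  rw [h1, (h.scl hτ).integrable_gam_iff, FlatnessPropagation.scl,
    integrable_smul_measure (by simp; positivity) ENNReal.ofReal_ne_top, hm.integrable_map_iff]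
  refine integrable_congr (Eventually.of_forall fun z => ?_)
  simp [smul_smul, hτ.ne', norm_smul, mul_pow]

theorem Unif.pow_mul_le_integral_gau (h : Unif n ν) (hτ : 0 < τ) {ρ : ℝ} (hρ : 0 < ρ)
    {f : Euc d → ℝ} (hf : ExpGrowth f) (hf0 : ∀ z ∈ msupport ν, 0 ≤ f z) :
    ρ ^ n * (∫ z, f z ∂gau n ν τ - (ρ ^ 2 - 1) * (τ ^ 2 * ∫ z, ‖z‖ ^ 2 * f z ∂gau n ν τ)) ≤
      ∫ z, f z ∂gau n ν (ρ * τ) := by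
  have i1 : Integrable f (gau n ν τ) := h.integrable_gau hτ hf
  have i2 : Integrable (fun z => ‖z‖ ^ 2 * f z) (gau n ν τ) :=
    h.integrable_gau hτ ((ExpGrowth.norm.pow 2).mul hf)
  have i3 : Integrable (fun z => f z - (ρ ^ 2 - 1) * (τ ^ 2 * (‖z‖ ^ 2 * f z))) (gau n ν τ) :=
    i1.sub ((i2.const_mul _).const_mul _)
  have e1 : ∫ z, f z ∂gau n ν τ - (ρ ^ 2 - 1) * (τ ^ 2 * ∫ z, ‖z‖ ^ 2 * f z ∂gau n ν τ) =
      ∫ z, f z - (ρ ^ 2 - 1) * (τ ^ 2 * (‖z‖ ^ 2 * f z)) ∂gau n ν τ := by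
    rw [integral_sub i1 ((i2.const_mul _).const_mul _), integral_const_mul, integral_const_mul]
  rw [e1, h.integral_gau_density hτ, h.integral_gau_density (by positivity : 0 < ρ * τ), mul_pow]
  have hg := h.gaussMass_pos
  rw [← mul_div_assoc, ← mul_assoc]
  refine div_le_div_of_nonneg_right (mul_le_mul_of_nonneg_left ?_ (by positivity)) hg.le
  refine integral_mono_ae ((h.integrable_gau_iff hτ).1 i3)
    ((h.integrable_gau_iff (by positivity : 0 < ρ * τ)).1
      (h.integrable_gau (by positivity : 0 < ρ * τ) hf)) ?_
  have := h.isLocallyFinite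
  filter_upwards [ae_mem_msupport ν] with z hz
  have hexp : Real.exp (-((ρ * τ) ^ 2 * ‖z‖ ^ 2)) =
      Real.exp (-((ρ ^ 2 - 1) * τ ^ 2 * ‖z‖ ^ 2)) * Real.exp (-(τ ^ 2 * ‖z‖ ^ 2)) := by
    rw [← Real.exp_add]; congr 1; ring
  rw [hexp, ← mul_assoc (f z)]
  refine mul_le_mul_of_nonneg_right ?_ (Real.exp_pos _).le
  have h1 := Real.add_one_le_exp (-((ρ ^ 2 - 1) * τ ^ 2 * ‖z‖ ^ 2))
  have h2 := mul_le_mul_of_nonneg_left h1 (hf0 z hz)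
  linarith

/-- Differentiating Gaussian averages with respect to the scale. -/
theorem Unif.tendsto_norm_sq_mul (h : Unif n ν) {f : Euc d → ℝ} (hf : ExpGrowth f) {C c : ℝ}
    (hf0 : ∀ z ∈ msupport ν, 0 ≤ f z) (hfC : ∀ z ∈ msupport ν, f z ≤ C)
    (hc : Tendsto (fun τ => ∫ z, f z ∂gau n ν τ) (𝓝[>] 0) (𝓝 c)) :
    Tendsto (fun τ : ℝ => τ ^ 2 * ∫ z, ‖z‖ ^ 2 * f z ∂gau n ν τ) (𝓝[>] 0) (𝓝 (n * c / 2)) := by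
  refine (tendsto_iff_ultrafilter _ _ _).2 fun U hU => ?_
  have hC : 0 ≤ C := (hf0 0 h.zero_mem).trans (hfC 0 h.zero_mem)
  have hpos : ∀ᶠ τ : ℝ in U, 0 < τ := hU self_mem_nhdsWithin
  obtain ⟨L, hL⟩ := exists_ultralimit_real U
    (f := fun τ : ℝ => τ ^ 2 * ∫ z, ‖z‖ ^ 2 * f z ∂gau n ν τ)
    (M := C * (2 : ℕ).factorial * expMom n 1) (by
      filter_upwards [hpos] with τ hτ
      rw [abs_mul, abs_of_pos (pow_pos hτ 2)]
      refine h.pow_mul_abs_integral_gau_le hτ hC fun z hz => ?_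
      rw [abs_of_nonneg (mul_nonneg (sq_nonneg _) (hf0 z hz)), mul_comm]
      exact mul_le_mul_of_nonneg_right (hfC z hz) (sq_nonneg _))
  have key : ∀ ρ : ℝ, 0 < ρ → ρ ^ n * (c - (ρ ^ 2 - 1) * L) ≤ c := fun ρ hρ => by
    have h1 : Tendsto (fun τ : ℝ => ρ * τ) (𝓝[>] 0) (𝓝[>] 0) := by
      refine tendsto_nhdsWithin_iff.2 ⟨?_, ?_⟩
      · have : Tendsto (fun τ : ℝ => ρ * τ) (𝓝 0) (𝓝 (ρ * 0)) :=
          (continuous_const.mul continuous_id).tendsto 0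
        rw [mul_zero] at this
        exact this.mono_left nhdsWithin_le_nhds
      · filter_upwards [self_mem_nhdsWithin] with τ hτ using mul_pos hρ hτ
    refine le_of_tendsto_of_tendsto
      (((hc.mono_left hU).sub (hL.const_mul (ρ ^ 2 - 1))).const_mul (ρ ^ n))
      ((hc.comp h1).mono_left hU) ?_
    filter_upwards [hpos] with τ hτ
    exact h.pow_mul_le_integral_gau hτ hρ hf hf0
  have hmax : IsLocalMax (fun ρ : ℝ => ρ ^ n * (c - (ρ ^ 2 - 1) * L)) 1 := by
    filter_upwards [eventually_gt_nhds (zero_lt_one' ℝ)] with ρ hρ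
    simpa using key ρ hρ
  have hder : HasDerivAt (fun ρ : ℝ => ρ ^ n * (c - (ρ ^ 2 - 1) * L))
      (n * c - 2 * L) 1 := by
    have := (hasDerivAt_pow n (1 : ℝ)).mul
      ((((hasDerivAt_pow 2 (1 : ℝ)).sub_const 1).mul_const L).const_sub c)
    refine this.congr_deriv ?_
    simp
    ring
  have := hmax.hasDerivAt_eq_zero hder
  rwa [show (n * c / 2 : ℝ) = L by linarith]

theorem inner_res_comm (v : Fin n → Euc d) (x y : Euc d) :
    inner ℝ (res v x) y = inner ℝ x (res v y) := by
  simp only [res, inner_sub_left, inner_sub_right, sum_inner, inner_sum, inner_smul_left,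
    inner_smul_right]
  simp only [conj_trivial, real_inner_comm x]
  congr 1
  exact Finset.sum_congr rfl fun a _ => mul_comm _ _

theorem inner_decomp (v : Fin n → Euc d) (x y : Euc d) (hv : Orthonormal ℝ v) :
    inner ℝ x y = ∑ a, inner ℝ x (v a) * inner ℝ y (v a) + inner ℝ (res v x) (res v y) := by
  have h1 : inner ℝ (res v x) (res v y) = inner ℝ x (res v y) := by
    rw [inner_res_comm]
    congr 1
    have : res v y - res v (res v y) = 0 := by simp [res, inner_sub_right, inner_sum,
      inner_smul_right, orthonormal_iff_ite.1 hv]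
    exact (sub_eq_zero.1 this).symm
  rw [h1, res, inner_sub_right, inner_sum]
  simp only [inner_smul_right, real_inner_comm y]
  rw [← sub_eq_zero]
  simp only [mul_comm]
  ring

namespace Paraboloid
variable {v : Fin n → Euc d} {b : Euc d}

theorem res_eq (P : Paraboloid n ν v b) : res v b = b := by
  simp [res, P.perp]

theorem inner_eq (P : Paraboloid n ν v b) (z : Euc d) : inner ℝ b (res v z) = inner ℝ b z := by
  rw [← inner_res_comm, P.res_eq]

theorem norm_res_le (P : Paraboloid n ν v b) {z : Euc d} (hz : z ∈ msupport ν) :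
    ‖res v z‖ ≤ ‖b‖ := by
  have h1 := P.eq z hz
  rw [← P.inner_eq] at h1
  have h2 := real_inner_le_norm b (res v z)
  by_contra! hlt
  nlinarith [norm_nonneg b]

theorem norm_res_sub (P : Paraboloid n ν v b) {z : Euc d} (hz : z ∈ msupport ν) :
    ‖res v z - (1 / 2 : ℝ) • b‖ = ‖b‖ / 2 := by
  have h1 := P.eq z hz
  rw [← P.inner_eq] at h1
  have h2 := norm_sub_sq_real (res v z) ((1 / 2 : ℝ) • b)
  rw [inner_smul_right, real_inner_comm, norm_smul, h1] at h2
  refine (sq_eq_sq₀ (norm_nonneg _) (by positivity)).1 ?_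
  rw [h2]
  norm_num
  ring

theorem tendsto_pair (P : Paraboloid n ν v b) (i j : Fin n) :
    Tendsto (fun τ : ℝ => τ ^ 2 * ∫ z, inner ℝ z (v i) * inner ℝ z (v j) ∂gau n ν τ) (𝓝[>] 0)
      (𝓝 (kr i j / 2)) := by
  refine (tendsto_moment_pair P.unif.eventually_scl P.orth P.defect i j).congr' ?_
  filter_upwards [self_mem_nhdsWithin] with τ hτ
  rw [← integral_gau_smul hτ, ← integral_const_mul]
  simp only [inner_smul_left, conj_trivial]
  congr 1; ext z; ring

theorem tendsto_four (P : Paraboloid n ν v b) (i j k l : Fin n) :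
    Tendsto (fun τ : ℝ => τ ^ 4 * ∫ z, inner ℝ z (v i) * inner ℝ z (v j) *
      (inner ℝ z (v k) * inner ℝ z (v l)) ∂gau n ν τ) (𝓝[>] 0)
      (𝓝 (1 / 4 * (kr i j * kr k l + kr i k * kr j l + kr i l * kr j k))) := by
  refine (tendsto_moment_four P.unif.eventually_scl P.orth P.defect i j k l).congr' ?_
  filter_upwards [self_mem_nhdsWithin] with τ hτ
  rw [← integral_gau_smul hτ, ← integral_const_mul]
  simp only [inner_smul_left, conj_trivial]
  congr 1; ext z; ring

theorem tendsto_inner_pow_four (P : Paraboloid n ν v b) (x : Euc d) :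
    Tendsto (fun τ : ℝ => τ ^ 4 * ∫ z, inner ℝ z x ^ 4 ∂gau n ν τ) (𝓝[>] 0)
      (𝓝 (3 / 4 * (∑ a, inner ℝ x (v a) ^ 2) ^ 2)) := by
  have h1 := tendsto_integral_of_plane P.unif.eventually_scl P.orth P.defect
    ((ExpGrowth.inner_right x).pow 4) (c := 3 / 4 * (∑ a, inner ℝ x (v a) ^ 2) ^ 2)
      fun lam hl hV => by
        rw [integral_inner_pow_of_plane hl P.orth hV,
          (hl.moment_two_four hV (sub_res_mem_span v x)).2, norm_sub_res_sq P.orth]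
        simp only [real_inner_comm x]
  refine h1.congr' ?_
  filter_upwards [self_mem_nhdsWithin] with τ hτ
  rw [← integral_gau_smul hτ, ← integral_const_mul]
  simp only [inner_smul_left, conj_trivial]
  congr 1; ext z; ring

theorem tendsto_norm_res_sq (P : Paraboloid n ν v b) :
    Tendsto (fun τ : ℝ => ∫ z, ‖res v z‖ ^ 2 ∂gau n ν τ) (𝓝[>] 0) (𝓝 (‖b‖ ^ 2 / 2)) := by
  have h1 := P.lin b
  rw [real_inner_self_eq_norm_sq] at h1
  refine h1.congr' ?_
  filter_upwards [self_mem_nhdsWithin] with τ hτ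
  exact P.unif.integral_gau_congr hτ fun z hz => by rw [P.eq z hz, real_inner_comm]

theorem sum_sq_eq (P : Paraboloid n ν v b) (z : Euc d) :
    ∑ a, inner ℝ z (v a) * inner ℝ z (v a) = ‖z‖ ^ 2 - ‖res v z‖ ^ 2 := by
  rw [norm_res_sq P.orth]
  simp [sq, real_inner_comm]

theorem tendsto_trace (P : Paraboloid n ν v b) :
    Tendsto (fun τ : ℝ => ∑ a, (2 * ∫ z, inner ℝ z (v a) * inner ℝ z (v a) ∂gau n ν τ - 1 / τ ^ 2))
      (𝓝[>] 0) (𝓝 (-‖b‖ ^ 2)) := by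
  have h1 := P.tendsto_norm_res_sq.const_mul (-2)
  rw [show -2 * (‖b‖ ^ 2 / 2) = -‖b‖ ^ 2 by ring] at h1
  refine h1.congr' ?_
  filter_upwards [self_mem_nhdsWithin] with τ hτ
  have hτ' : 0 < τ := hτ
  have hi : ∀ a ∈ Finset.univ, Integrable (fun z => inner ℝ z (v a) * inner ℝ z (v a))
      (gau n ν τ) := fun a _ =>
    P.unif.integrable_gau hτ ((ExpGrowth.inner_right _).mul (ExpGrowth.inner_right _))
  rw [Finset.sum_sub_distrib, ← Finset.mul_sum, ← integral_finsetSum _ hi]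
  simp only [P.sum_sq_eq]
  have h2 : ∫ z, ‖z‖ ^ 2 ∂gau n ν τ = n / 2 / τ ^ 2 := by
    rw [← (P.unif.scl hτ).integral_norm_sq, ← integral_gau_smul hτ, ← integral_div]
    simp only [norm_smul, mul_pow, Real.norm_eq_abs, sq_abs]
    congr 1; ext z; field_simp
  rw [integral_sub (P.unif.integrable_gau hτ (ExpGrowth.norm.pow 2))
    (P.unif.integrable_gau hτ (ExpGrowth.norm_res_sq P.orth)), h2]
  simp
  field_simp
  ring

theorem abs_inner_res_le (P : Paraboloid n ν v b) {z : Euc d} (hz : z ∈ msupport ν) (e : Euc d) :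
    |inner ℝ (res v z) e| ≤ ‖b‖ * ‖e‖ :=
  (abs_real_inner_le_norm _ _).trans
    (mul_le_mul_of_nonneg_right (P.norm_res_le hz) (norm_nonneg _))

theorem expGrowth_inner_res (e : Euc d) : ExpGrowth fun z => inner ℝ (res v z) e := by
  simp only [inner_res_comm]
  exact ExpGrowth.inner_right _

theorem tendsto_inner_res (P : Paraboloid n ν v b) (e : Euc d) :
    Tendsto (fun τ => ∫ z, inner ℝ (res v z) e ∂gau n ν τ) (𝓝[>] 0) (𝓝 (inner ℝ b e / 2)) := by
  simp only [inner_res_comm]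
  have := P.lin (res v e)
  rwa [P.inner_eq] at this

theorem tendsto_sum_sq_mul_res (P : Paraboloid n ν v b) (e : Euc d) :
    Tendsto (fun τ : ℝ => ∑ a, τ ^ 2 * ∫ z, inner ℝ z (v a) * inner ℝ z (v a) *
      inner ℝ (res v z) e ∂gau n ν τ) (𝓝[>] 0) (𝓝 (n * inner ℝ b e / 4)) := by
  have hg := expGrowth_inner_res (v := v) e
  have h1 := P.unif.tendsto_norm_sq_mul (f := fun z => ‖b‖ * ‖e‖ + inner ℝ (res v z) e)
    (C := 2 * (‖b‖ * ‖e‖)) (c := ‖b‖ * ‖e‖ + inner ℝ b e / 2)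
    ((ExpGrowth.const _).add hg)
    (fun z hz => by linarith [abs_le.1 (P.abs_inner_res_le hz e)])
    (fun z hz => by linarith [abs_le.1 (P.abs_inner_res_le hz e)]) (by
      refine ((P.tendsto_inner_res e).const_add (‖b‖ * ‖e‖)).congr' ?_
      filter_upwards [self_mem_nhdsWithin] with τ hτ
      have := P.unif.isProbabilityMeasure_gau hτ
      rw [integral_add (integrable_const _) (P.unif.integrable_gau hτ hg)]
      simp)
  have h2 := P.unif.tendsto_pow_mul_integral_gau (f := fun z => ‖res v z‖ ^ 2 * inner ℝ (res v z) e)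
    (C := ‖b‖ ^ 2 * (‖b‖ * ‖e‖)) (m := 0) (k := 2) (by positivity) (fun z hz => by
      rw [pow_zero, mul_one, abs_mul, abs_of_nonneg (sq_nonneg _)]
      have := P.abs_inner_res_le hz e
      have := P.norm_res_le hz
      gcongr) (by norm_num)
  have h3 := (h1.sub_const (n / 2 * (‖b‖ * ‖e‖))).sub h2
  rw [show (n * (‖b‖ * ‖e‖ + inner ℝ b e / 2) / 2 - n / 2 * (‖b‖ * ‖e‖) - 0 : ℝ) =
    n * inner ℝ b e / 4 by ring] at h3
  refine h3.congr' ?_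
  filter_upwards [self_mem_nhdsWithin] with τ hτ
  have hτ' : 0 < τ := hτ
  have hi : ∀ a ∈ Finset.univ, Integrable (fun z => inner ℝ z (v a) * inner ℝ z (v a) *
      inner ℝ (res v z) e) (gau n ν τ) := fun a _ =>
    P.unif.integrable_gau hτ (((ExpGrowth.inner_right _).mul (ExpGrowth.inner_right _)).mul hg)
  have h4 : ∫ z, ‖z‖ ^ 2 ∂gau n ν τ = n / 2 / τ ^ 2 := by
    rw [← (P.unif.scl hτ).integral_norm_sq, ← integral_gau_smul hτ, ← integral_div]
    simp only [norm_smul, mul_pow, Real.norm_eq_abs, sq_abs]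
    congr 1; ext z; field_simp
  rw [← Finset.mul_sum, ← integral_finsetSum _ hi]
  simp only [← Finset.sum_mul, P.sum_sq_eq, mul_add, sub_mul]
  have i1 : Integrable (fun z : Euc d => ‖z‖ ^ 2) (gau n ν τ) :=
    P.unif.integrable_gau hτ (ExpGrowth.norm.pow 2)
  have i2 : Integrable (fun z : Euc d => ‖z‖ ^ 2 * inner ℝ (res v z) e) (gau n ν τ) :=
    P.unif.integrable_gau hτ ((ExpGrowth.norm.pow 2).mul hg)
  rw [integral_add (i1.mul_const _) i2, integral_mul_const, h4,
    integral_sub i2 (P.unif.integrable_gau hτ ((ExpGrowth.norm_res_sq P.orth).mul hg))]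
  field_simp
  ring

end Paraboloid

end

section

variable {d n : ℕ} {ν : Measure (Euc d)} {τ : ℝ}

theorem integral_add_add {μ : Measure (Euc d)} {f g k : Euc d → ℝ} (hf : Integrable f μ)
    (hg : Integrable g μ) (hk : Integrable k μ) :
    ∫ z, f z + g z + k z ∂μ = ∫ z, f z ∂μ + ∫ z, g z ∂μ + ∫ z, k z ∂μ := by
  rw [← integral_add hf hg]
  exact integral_add (hf.add hg) hk

theorem Unif.integral_sum_mul_gau (h : Unif n ν) (hτ : 0 < τ) {ι : Type*} [Fintype ι] (c : ι → ℝ)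
    {f : ι → Euc d → ℝ} (hf : ∀ i, ExpGrowth (f i)) :
    ∫ z, ∑ i, c i * f i z ∂gau n ν τ = ∑ i, c i * ∫ z, f i z ∂gau n ν τ := by
  rw [integral_finsetSum _ fun i _ => (h.integrable_gau hτ (hf i)).const_mul _]
  simp only [integral_const_mul]

theorem Unif.abs_quartic_le (h : Unif n ν) {x : Euc d} (hx : x ∈ msupport ν) :
    ∃ C, ∀ τ : ℝ, 0 < τ → τ ≤ 1 →
      |2 / τ ^ 2 * ∫ z, inner ℝ z x ∂gau n ν τ + 2 * ∫ z, inner ℝ z x ^ 2 ∂gau n ν τ +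
        4 / 3 * τ ^ 2 * ∫ z, inner ℝ z x ^ 3 ∂gau n ν τ +
        2 / 3 * τ ^ 4 * ∫ z, inner ℝ z x ^ 4 ∂gau n ν τ - ‖x‖ ^ 2 / τ ^ 2 - ‖x‖ ^ 4 / 2| ≤
        C * τ := by
  refine ⟨120 * expMom n (4 * ‖x‖) + (‖x‖ ^ 2) ^ 3 * Real.exp (‖x‖ ^ 2), fun τ hτ hτ1 => ?_⟩
  have hs := h.scl hτ
  have := hs.isProbabilityMeasure
  have h1 := hs.taylor x 5 hτ.le hτ1
  rw [h.mgf_scl hτ hx] at h1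
  have h2 := abs_exp_sub_sum_le (τ ^ 2 * ‖x‖ ^ 2) 3
  have hm : ∀ k : ℕ, ∫ z, inner ℝ z x ^ k ∂gam n (FlatnessPropagation.scl n τ ν) =
      τ ^ k * ∫ z, inner ℝ z x ^ k ∂gau n ν τ := fun k => by
    rw [← integral_gau_smul hτ, ← integral_const_mul]
    simp only [inner_smul_left, mul_pow, conj_trivial]
  simp only [Finset.sum_range_succ, Finset.sum_range_zero, Nat.factorial] at h1 h2
  rw [show (∫ z, inner ℝ z x ^ 0 ∂gam n (FlatnessPropagation.scl n τ ν)) = 1 by simp, hm 1, hm 2,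
    hm 3, hm 4] at h1
  simp only [pow_zero, pow_one] at h1 h2
  set m1 := ∫ z, inner ℝ z x ∂gau n ν τ
  set m2 := ∫ z, inner ℝ z x ^ 2 ∂gau n ν τ
  set m3 := ∫ z, inner ℝ z x ^ 3 ∂gau n ν τ
  set m4 := ∫ z, inner ℝ z x ^ 4 ∂gau n ν τ
  have h3 : |τ ^ 2 * ‖x‖ ^ 2| ^ 3 * Real.exp |τ ^ 2 * ‖x‖ ^ 2| ≤
      (‖x‖ ^ 2) ^ 3 * Real.exp (‖x‖ ^ 2) * τ ^ 5 := by
    rw [abs_of_nonneg (by positivity)]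
    have e1 : Real.exp (τ ^ 2 * ‖x‖ ^ 2) ≤ Real.exp (‖x‖ ^ 2) :=
      Real.exp_le_exp.2 (mul_le_of_le_one_left (by positivity) (pow_le_one₀ hτ.le hτ1))
    have e2 : (τ ^ 2 * ‖x‖ ^ 2) ^ 3 ≤ (‖x‖ ^ 2) ^ 3 * τ ^ 5 := by
      have : τ ^ 6 ≤ τ ^ 5 := pow_le_pow_of_le_one hτ.le hτ1 (by norm_num)
      calc (τ ^ 2 * ‖x‖ ^ 2) ^ 3 = (‖x‖ ^ 2) ^ 3 * τ ^ 6 := by ring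
        _ ≤ _ := by gcongr
    calc _ ≤ ((‖x‖ ^ 2) ^ 3 * τ ^ 5) * Real.exp (‖x‖ ^ 2) := by gcongr
      _ = _ := by ring
  have h4 : |2 * τ ^ 2 * m1 + 2 * τ ^ 4 * m2 + 4 / 3 * τ ^ 6 * m3 + 2 / 3 * τ ^ 8 * m4 -
      τ ^ 2 * ‖x‖ ^ 2 - τ ^ 4 * ‖x‖ ^ 4 / 2| ≤
      (120 * expMom n (4 * ‖x‖) + (‖x‖ ^ 2) ^ 3 * Real.exp (‖x‖ ^ 2)) * τ ^ 5 := by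
    have h2' := h2.trans h3
    rw [abs_le] at h1 h2' ⊢
    push_cast at h1 h2'
    ring_nf at h1 h2' ⊢
    constructor <;> linarith
  rw [show 2 / τ ^ 2 * m1 + 2 * m2 + 4 / 3 * τ ^ 2 * m3 + 2 / 3 * τ ^ 4 * m4 - ‖x‖ ^ 2 / τ ^ 2 -
      ‖x‖ ^ 4 / 2 = (2 * τ ^ 2 * m1 + 2 * τ ^ 4 * m2 + 4 / 3 * τ ^ 6 * m3 + 2 / 3 * τ ^ 8 * m4 -
      τ ^ 2 * ‖x‖ ^ 2 - τ ^ 4 * ‖x‖ ^ 4 / 2) / τ ^ 4 by field_simp, abs_div,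
    abs_of_pos (by positivity : 0 < τ ^ 4), div_le_iff₀ (by positivity)]
  linarith

theorem Unif.tendsto_quartic (h : Unif n ν) {x : Euc d} (hx : x ∈ msupport ν) :
    Tendsto (fun τ : ℝ => 2 / τ ^ 2 * ∫ z, inner ℝ z x ∂gau n ν τ +
        2 * ∫ z, inner ℝ z x ^ 2 ∂gau n ν τ + 4 / 3 * τ ^ 2 * ∫ z, inner ℝ z x ^ 3 ∂gau n ν τ +
        2 / 3 * τ ^ 4 * ∫ z, inner ℝ z x ^ 4 ∂gau n ν τ - ‖x‖ ^ 2 / τ ^ 2 - ‖x‖ ^ 4 / 2)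
      (𝓝[>] 0) (𝓝 0) := by
  obtain ⟨C, hC⟩ := h.abs_quartic_le hx
  have h0 : Tendsto (fun τ : ℝ => C * τ) (𝓝[>] 0) (𝓝 0) := by
    have : Tendsto (fun τ : ℝ => C * τ) (𝓝 0) (𝓝 (C * 0)) :=
      (continuous_const.mul continuous_id).tendsto 0
    rw [mul_zero] at this
    exact this.mono_left nhdsWithin_le_nhds
  refine squeeze_zero_norm' ?_ h0
  filter_upwards [Ioc_mem_nhdsGT (zero_lt_one' ℝ)] with τ hτ
  exact hC τ hτ.1 hτ.2

namespace Paraboloid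
variable {v : Fin n → Euc d} {b : Euc d}

theorem expGrowth_norm_res (v : Fin n → Euc d) : ExpGrowth fun z => ‖res v z‖ := by
  have h1 : ExpGrowth fun z : Euc d => ‖z‖ + ∑ a, ‖v a‖ * ‖z‖ * ‖v a‖ :=
    ExpGrowth.norm.add (ExpGrowth.sum _ fun a _ =>
      ((ExpGrowth.const _).mul ExpGrowth.norm).mul (ExpGrowth.const _))
  obtain ⟨C, a, hC, ha, hb⟩ := h1.bound
  refine ⟨(continuous_res v).norm, C, a, hC, ha, fun z => ?_⟩
  refine le_trans ?_ ((le_abs_self _).trans (hb z))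
  rw [abs_norm]
  refine (norm_sub_le _ _).trans (add_le_add_right ((norm_sum_le _ _).trans
    (Finset.sum_le_sum fun c _ => ?_)) _)
  rw [norm_smul]
  gcongr
  exact norm_inner_le_norm _ _

theorem integrable_smul_res (P : Paraboloid n ν v b) (hτ : 0 < τ) {f : Euc d → ℝ}
    (hf : ExpGrowth f) : Integrable (fun z => f z • res v z) (gau n ν τ) := by
  refine P.unif.integrable_gau_of_norm hτ (hf.cont.smul (continuous_res v)) ?_
  have h1 := hf.mul hf
  have h2 : ExpGrowth fun z => |f z| :=
    ⟨hf.cont.abs, by simpa only [abs_abs] using hf.bound⟩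
  simp only [norm_smul, Real.norm_eq_abs]
  exact h2.mul (expGrowth_norm_res v)

theorem inner_integral_smul_res (P : Paraboloid n ν v b) (hτ : 0 < τ) {f : Euc d → ℝ}
    (hf : ExpGrowth f) (y : Euc d) : inner ℝ (∫ z, f z • res v z ∂gau n ν τ) y =
      ∫ z, f z * inner ℝ (res v z) y ∂gau n ν τ := by
  rw [real_inner_comm, ← integral_inner (𝕜 := ℝ) (P.integrable_smul_res hτ hf) y]
  simp only [inner_smul_right, real_inner_comm y]

theorem exists_third_moments (P : Paraboloid n ν v b) (U : Ultrafilter ℝ) (hU : ↑U ≤ 𝓝[>] (0 : ℝ)) :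
    ∃ C : Fin n × Fin n → Euc d, ∀ p e, Tendsto (fun τ : ℝ => 4 * τ ^ 2 *
      ∫ z, inner ℝ z (v p.1) * inner ℝ z (v p.2) * inner ℝ (res v z) e ∂gau n ν τ) U
      (𝓝 (inner ℝ (C p) e)) := by
  have hpos : ∀ᶠ τ : ℝ in U, 0 < τ := hU self_mem_nhdsWithin
  have key : ∀ p : Fin n × Fin n, ∃ C : Euc d, Tendsto (fun τ : ℝ => (4 * τ ^ 2) •
      ∫ z, (inner ℝ z (v p.1) * inner ℝ z (v p.2)) • res v z ∂gau n ν τ) U (𝓝 C) := fun p => by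
    refine exists_ultralimit U (x := 0) (M := 4 * (‖b‖ * (2 : ℕ).factorial * expMom n 1)) ?_
    filter_upwards [hpos] with τ hτ
    rw [dist_zero_right, norm_smul, Real.norm_of_nonneg (by positivity), mul_assoc]
    refine mul_le_mul_of_nonneg_left ?_ (by norm_num)
    refine le_trans ?_ (P.unif.pow_mul_abs_integral_gau_le hτ (norm_nonneg b)
      (f := fun z => ‖b‖ * ‖z‖ ^ 2) fun z hz => by rw [abs_of_nonneg (by positivity)])
    refine mul_le_mul_of_nonneg_left ?_ (by positivity)
    refine le_trans ?_ (le_abs_self _)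
    refine norm_integral_le_of_norm_le
      (P.unif.integrable_gau hτ ((ExpGrowth.const _).mul (ExpGrowth.norm.pow 2))) ?_
    filter_upwards [P.unif.ae_mem_gau hτ] with z hz
    rw [norm_smul, norm_mul, mul_comm, sq]
    have h1 := P.norm_res_le hz
    have h2 : ∀ a, ‖inner ℝ z (v a)‖ ≤ ‖z‖ := fun a => by
      have := norm_inner_le_norm (𝕜 := ℝ) z (v a)
      rwa [P.orth.1, mul_one] at this
    have h3 := h2 p.1
    have h4 := h2 p.2
    gcongr
  choose C hC using key
  refine ⟨C, fun p e => ((hC p).inner tendsto_const_nhds).congr' ?_⟩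
  filter_upwards [hpos] with τ hτ
  rw [inner_smul_left, P.inner_integral_smul_res hτ
    ((ExpGrowth.inner_right _).mul (ExpGrowth.inner_right _))]
  simp

theorem integral_inner_sq (P : Paraboloid n ν v b) (hτ : 0 < τ) (x : Euc d) :
    ∫ z, inner ℝ z x ^ 2 ∂gau n ν τ =
      ∑ p : Fin n × Fin n, inner ℝ x (v p.1) * inner ℝ x (v p.2) *
        ∫ z, inner ℝ z (v p.1) * inner ℝ z (v p.2) ∂gau n ν τ +
      2 * ∑ a, inner ℝ x (v a) * ∫ z, inner ℝ z (v a) * inner ℝ (res v z) (res v x) ∂gau n ν τ +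
      ∫ z, inner ℝ (res v z) (res v x) ^ 2 ∂gau n ν τ := by
  have hw : ∀ a, ExpGrowth fun z => inner ℝ z (v a) := fun a => ExpGrowth.inner_right _
  have hq := expGrowth_inner_res (v := v) (res v x)
  have hww : ∀ p : Fin n × Fin n, ExpGrowth fun z => inner ℝ z (v p.1) * inner ℝ z (v p.2) :=
    fun p => (hw _).mul (hw _)
  have hwq : ∀ a, ExpGrowth fun z => inner ℝ z (v a) * inner ℝ (res v z) (res v x) :=
    fun a => (hw a).mul hq
  have i1 : Integrable (fun z => ∑ p : Fin n × Fin n, inner ℝ x (v p.1) * inner ℝ x (v p.2) *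
      (inner ℝ z (v p.1) * inner ℝ z (v p.2))) (gau n ν τ) :=
    P.unif.integrable_gau hτ (ExpGrowth.sum _ fun p _ => (ExpGrowth.const _).mul (hww p))
  have i2 : Integrable (fun z => 2 * ∑ a, inner ℝ x (v a) *
      (inner ℝ z (v a) * inner ℝ (res v z) (res v x))) (gau n ν τ) :=
    P.unif.integrable_gau hτ ((ExpGrowth.const _).mul
      (ExpGrowth.sum _ fun p _ => (ExpGrowth.const _).mul (hwq p)))
  have i3 : Integrable (fun z => inner ℝ (res v z) (res v x) ^ 2) (gau n ν τ) :=
    P.unif.integrable_gau hτ (hq.pow 2)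
  rw [← P.unif.integral_sum_mul_gau hτ _ hww, ← P.unif.integral_sum_mul_gau hτ _ hwq,
    ← integral_const_mul, ← integral_add_add i1 i2 i3]
  congr 1
  ext z
  rw [inner_decomp v z x P.orth, Fintype.sum_prod_type, add_sq, sq (∑ a, _), Finset.sum_mul_sum,
    mul_assoc 2, Finset.sum_mul]
  congr 2
  · exact Finset.sum_congr rfl fun i _ => Finset.sum_congr rfl fun j _ => by ring
  · exact congrArg _ (Finset.sum_congr rfl fun i _ => by ring)

theorem integral_inner_cube (P : Paraboloid n ν v b) (hτ : 0 < τ) (x : Euc d) :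
    ∫ z, inner ℝ z x ^ 3 ∂gau n ν τ =
      ∑ p : Fin n × Fin n × Fin n, inner ℝ x (v p.1) * inner ℝ x (v p.2.1) * inner ℝ x (v p.2.2) *
        ∫ z, inner ℝ z (v p.1) * inner ℝ z (v p.2.1) * inner ℝ z (v p.2.2) ∂gau n ν τ +
      3 * ∑ p : Fin n × Fin n, inner ℝ x (v p.1) * inner ℝ x (v p.2) *
        ∫ z, inner ℝ z (v p.1) * inner ℝ z (v p.2) * inner ℝ (res v z) (res v x) ∂gau n ν τ +
      ∫ z, inner ℝ (res v z) (res v x) ^ 2 * (3 * inner ℝ z x - 2 * inner ℝ (res v z) (res v x))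
        ∂gau n ν τ := by
  have hw : ∀ a, ExpGrowth fun z => inner ℝ z (v a) := fun a => ExpGrowth.inner_right _
  have hq := expGrowth_inner_res (v := v) (res v x)
  have hww : ∀ p : Fin n × Fin n × Fin n,
      ExpGrowth fun z => inner ℝ z (v p.1) * inner ℝ z (v p.2.1) * inner ℝ z (v p.2.2) :=
    fun p => ((hw _).mul (hw _)).mul (hw _)
  have hwq : ∀ p : Fin n × Fin n, ExpGrowth fun z =>
      inner ℝ z (v p.1) * inner ℝ z (v p.2) * inner ℝ (res v z) (res v x) :=
    fun a => ((hw _).mul (hw _)).mul hq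
  have i1 : Integrable (fun z => ∑ p : Fin n × Fin n × Fin n,
      inner ℝ x (v p.1) * inner ℝ x (v p.2.1) * inner ℝ x (v p.2.2) *
      (inner ℝ z (v p.1) * inner ℝ z (v p.2.1) * inner ℝ z (v p.2.2))) (gau n ν τ) :=
    P.unif.integrable_gau hτ (ExpGrowth.sum _ fun p _ => (ExpGrowth.const _).mul (hww p))
  have i2 : Integrable (fun z => 3 * ∑ p : Fin n × Fin n, inner ℝ x (v p.1) * inner ℝ x (v p.2) *
      (inner ℝ z (v p.1) * inner ℝ z (v p.2) * inner ℝ (res v z) (res v x))) (gau n ν τ) :=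
    P.unif.integrable_gau hτ ((ExpGrowth.const _).mul
      (ExpGrowth.sum _ fun p _ => (ExpGrowth.const _).mul (hwq p)))
  have i3 : Integrable (fun z => inner ℝ (res v z) (res v x) ^ 2 *
      (3 * inner ℝ z x - 2 * inner ℝ (res v z) (res v x))) (gau n ν τ) :=
    P.unif.integrable_gau hτ ((hq.pow 2).mul
      (((ExpGrowth.const _).mul (ExpGrowth.inner_right _)).sub ((ExpGrowth.const _).mul hq)))
  rw [← P.unif.integral_sum_mul_gau hτ _ hww, ← P.unif.integral_sum_mul_gau hτ _ hwq,
    ← integral_const_mul, ← integral_add_add i1 i2 i3]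
  congr 1
  ext z
  have e2 : ∑ p : Fin n × Fin n, inner ℝ x (v p.1) * inner ℝ x (v p.2) *
      (inner ℝ z (v p.1) * inner ℝ z (v p.2) * inner ℝ (res v z) (res v x)) =
      (∑ a, inner ℝ z (v a) * inner ℝ x (v a)) ^ 2 * inner ℝ (res v z) (res v x) := by
    rw [sq, Finset.sum_mul_sum, Fintype.sum_prod_type, Finset.sum_mul]
    refine Finset.sum_congr rfl fun i _ => ?_
    rw [Finset.sum_mul]
    exact Finset.sum_congr rfl fun j _ => by ring
  have e3 : ∑ p : Fin n × Fin n × Fin n,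
      inner ℝ x (v p.1) * inner ℝ x (v p.2.1) * inner ℝ x (v p.2.2) *
      (inner ℝ z (v p.1) * inner ℝ z (v p.2.1) * inner ℝ z (v p.2.2)) =
      (∑ a, inner ℝ z (v a) * inner ℝ x (v a)) ^ 3 := by
    rw [pow_succ', sq, Finset.sum_mul_sum, Finset.sum_mul, Fintype.sum_prod_type]
    refine Finset.sum_congr rfl fun i _ => ?_
    rw [Fintype.sum_prod_type, Finset.mul_sum]
    refine Finset.sum_congr rfl fun j _ => ?_
    rw [Finset.mul_sum]
    exact Finset.sum_congr rfl fun k _ => by ring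
  rw [e2, e3, inner_decomp v z x P.orth]
  ring

end Paraboloid

end

section

variable {d n : ℕ} {ν : Measure (Euc d)} {τ : ℝ}

theorem sum_kr_mul (f : Fin n → Fin n → ℝ) :
    ∑ p : Fin n × Fin n, kr p.1 p.2 * f p.1 p.2 = ∑ a, f a a := by
  rw [Fintype.sum_prod_type]
  simp [kr]

/-- The polynomial of degree three with coefficients `l`, `H`, `c`, `E` in the coordinates
along `v` and orthogonal to `v`. -/
def cubicForm (v : Fin n → Euc d) (w : Euc d × (Fin n × Fin n → ℝ) ×
    (Fin n × Fin n × Fin n → ℝ) × (Fin n → Euc d)) (x : Euc d) : ℝ :=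
  inner ℝ w.1 x + ∑ p, w.2.1 p * (inner ℝ x (v p.1) * inner ℝ x (v p.2)) +
    ∑ p, w.2.2.1 p * (inner ℝ x (v p.1) * inner ℝ x (v p.2.1) * inner ℝ x (v p.2.2)) +
    ∑ a, inner ℝ x (v a) * inner ℝ (w.2.2.2 a) (res v x)

theorem cubicForm_add (v : Fin n → Euc d) (w w' : Euc d × (Fin n × Fin n → ℝ) ×
    (Fin n × Fin n × Fin n → ℝ) × (Fin n → Euc d)) (x : Euc d) :
    cubicForm v (w + w') x = cubicForm v w x + cubicForm v w' x := by
  simp only [cubicForm, Prod.fst_add, Prod.snd_add, Pi.add_apply, inner_add_left, add_mul, mul_add,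
    Finset.sum_add_distrib]
  ring

theorem cubicForm_smul (v : Fin n → Euc d) (t : ℝ) (w : Euc d × (Fin n × Fin n → ℝ) ×
    (Fin n × Fin n × Fin n → ℝ) × (Fin n → Euc d)) (x : Euc d) :
    cubicForm v (t • w) x = t * cubicForm v w x := by
  simp only [cubicForm, Prod.smul_fst, Prod.smul_snd, Pi.smul_apply, smul_eq_mul,
    inner_smul_left, conj_trivial, mul_add, Finset.mul_sum]
  congr 1
  · simp only [mul_assoc]
  · exact Finset.sum_congr rfl fun a _ => by ring

namespace Paraboloid
variable {v : Fin n → Euc d} {b : Euc d}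

theorem exists_second_moment (P : Paraboloid n ν v b) (U : Ultrafilter ℝ)
    (hU : ↑U ≤ 𝓝[>] (0 : ℝ)) (y : Euc d) : ∃ m, |m| ≤ 2 * ‖b‖ ^ 2 * ‖y‖ ^ 2 ∧
      Tendsto (fun τ => 2 * ∫ z, inner ℝ (res v z) y ^ 2 ∂gau n ν τ) U (𝓝 m) := by
  have hpos : ∀ᶠ τ : ℝ in U, 0 < τ := hU self_mem_nhdsWithin
  have hb : ∀ᶠ τ : ℝ in U, |2 * ∫ z, inner ℝ (res v z) y ^ 2 ∂gau n ν τ| ≤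
      2 * ‖b‖ ^ 2 * ‖y‖ ^ 2 := by
    filter_upwards [hpos] with τ hτ
    have := P.unif.isProbabilityMeasure_gau hτ
    rw [abs_mul, abs_two, mul_assoc, ← mul_pow]
    refine mul_le_mul_of_nonneg_left ?_ zero_le_two
    have h1 : ‖∫ z, inner ℝ (res v z) y ^ 2 ∂gau n ν τ‖ ≤
        (‖b‖ * ‖y‖) ^ 2 * (gau n ν τ).real univ := by
      refine norm_integral_le_of_norm_le_const ?_
      filter_upwards [P.unif.ae_mem_gau hτ] with z hz
      rw [norm_pow]
      have := P.abs_inner_res_le hz y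
      rw [← Real.norm_eq_abs] at this
      gcongr
    simpa using h1
  obtain ⟨m, hm⟩ := exists_ultralimit_real U hb
  exact ⟨m, le_of_tendsto hm.abs hb, hm⟩

theorem tendsto_remainder (P : Paraboloid n ν v b) (x : Euc d) :
    Tendsto (fun τ : ℝ => τ ^ 2 * ∫ z, inner ℝ (res v z) (res v x) ^ 2 *
      (3 * inner ℝ z x - 2 * inner ℝ (res v z) (res v x)) ∂gau n ν τ) (𝓝[>] 0) (𝓝 0) := by
  refine P.unif.tendsto_pow_mul_integral_gau (m := 1)
    (C := (‖b‖ * ‖res v x‖) ^ 2 * (3 * ‖x‖ + 2 * ‖res v x‖)) (by positivity)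
    (fun z hz => ?_) (by norm_num)
  have h1 := P.abs_inner_res_le hz (res v x)
  have h2 : |3 * inner ℝ z x - 2 * inner ℝ (res v z) (res v x)| ≤
      (3 * ‖x‖ + 2 * ‖res v x‖) * ‖z‖ := by
    have h3 := abs_real_inner_le_norm z x
    have h4 := abs_real_inner_le_norm (res v z) (res v x)
    have h5 := mul_le_mul_of_nonneg_right (FlatnessPropagation.norm_res_le P.orth z)
      (norm_nonneg (res v x))
    rw [abs_le] at *
    constructor <;> nlinarith
  rw [abs_mul, abs_pow, pow_one, mul_assoc]
  gcongr

theorem exists_cubicForm (P : Paraboloid n ν v b) (U : Ultrafilter ℝ) (hU : ↑U ≤ 𝓝[>] (0 : ℝ))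
    {C : Fin n × Fin n → Euc d} (hC : ∀ p e, Tendsto (fun τ : ℝ => 4 * τ ^ 2 *
      ∫ z, inner ℝ z (v p.1) * inner ℝ z (v p.2) * inner ℝ (res v z) e ∂gau n ν τ) U
      (𝓝 (inner ℝ (C p) e))) :
    ∃ w, ∑ a, w.2.1 (a, a) = -‖b‖ ^ 2 ∧ ∀ x ∈ msupport ν, ∃ m, |m| ≤ 2 * ‖b‖ ^ 2 * ‖res v x‖ ^ 2 ∧
      cubicForm v w x = ‖res v x‖ ^ 4 / 2 - m - ∑ p, inner ℝ x (v p.1) * inner ℝ x (v p.2) *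
        inner ℝ (C p - kr p.1 p.2 • b) (res v x) := by
  have hpos : ∀ᶠ τ : ℝ in U, 0 < τ := hU self_mem_nhdsWithin
  choose M hM1 hM2 using P.exists_second_moment U hU
  let Ψ : (Euc d × (Fin n × Fin n → ℝ) × (Fin n × Fin n × Fin n → ℝ) × (Fin n → Euc d)) →ₗ[ℝ]
      (Option (msupport ν) → ℝ) :=
    { toFun := fun w o => o.elim (∑ a, w.2.1 (a, a)) fun x => cubicForm v w x.1
      map_add' := fun w w' => by
        ext o
        cases o with
        | none => simp [Finset.sum_add_distrib]
        | some x => exact cubicForm_add v w w' x.1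
      map_smul' := fun t w => by
        ext o
        cases o with
        | none => simp [Finset.mul_sum]
        | some x => exact cubicForm_smul v t w x.1 }
  let g : Option (msupport ν) → ℝ := fun o => o.elim (-‖b‖ ^ 2) fun x =>
    ‖res v x.1‖ ^ 4 / 2 - M (res v x.1) - ∑ p : Fin n × Fin n,
      inner ℝ x.1 (v p.1) * inner ℝ x.1 (v p.2) * inner ℝ (C p - kr p.1 p.2 • b) (res v x.1)
  obtain ⟨w, hw⟩ := exists_preimage_of_tendsto Ψ (F := (U : Filter ℝ)) (g := g)
    (w := fun τ => ((2 / τ ^ 2) • ∫ z, z ∂gau n ν τ - (1 / τ ^ 2) • b,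
      fun p => 2 * ∫ z, inner ℝ z (v p.1) * inner ℝ z (v p.2) ∂gau n ν τ - kr p.1 p.2 / τ ^ 2,
      fun p => 4 / 3 * τ ^ 2 *
        ∫ z, inner ℝ z (v p.1) * inner ℝ z (v p.2.1) * inner ℝ z (v p.2.2) ∂gau n ν τ,
      fun a => (4 : ℝ) • ∫ z, inner ℝ z (v a) • res v z ∂gau n ν τ)) (by
    rintro (_ | ⟨x, hx⟩)
    · have h1 := P.tendsto_trace.mono_left hU
      simpa [Ψ, g, kr] using h1
    · have h1 := (((((P.unif.tendsto_quartic hx).mono_left hU).sub (hM2 (res v x))).sub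
        (tendsto_finsetSum Finset.univ fun p _ => (hC p (res v x)).const_mul
          (inner ℝ x (v p.1) * inner ℝ x (v p.2)))).sub
        (((P.tendsto_remainder x).mono_left hU).const_mul (4 / 3))).sub
        ((((P.tendsto_inner_pow_four x).mono_left hU).const_mul (2 / 3)).sub_const (‖x‖ ^ 4 / 2))
      have hxi : ∑ a, inner ℝ x (v a) ^ 2 = ‖x‖ ^ 2 - ‖res v x‖ ^ 2 := by
        rw [← P.sum_sq_eq]; simp only [sq]
      have hkr : ∑ p : Fin n × Fin n, kr p.1 p.2 * (inner ℝ x (v p.1) * inner ℝ x (v p.2)) =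
          ‖x‖ ^ 2 - ‖res v x‖ ^ 2 := by
        rw [sum_kr_mul fun a b => inner ℝ x (v a) * inner ℝ x (v b), P.sum_sq_eq]
      have hby : inner ℝ b (res v x) = ‖res v x‖ ^ 2 := by rw [P.inner_eq, P.eq x hx]
      have hg : g (some ⟨x, hx⟩) = 0 - M (res v x) - ∑ p : Fin n × Fin n,
          inner ℝ x (v p.1) * inner ℝ x (v p.2) * inner ℝ (C p) (res v x) - 4 / 3 * 0 -
          (2 / 3 * (3 / 4 * (∑ a, inner ℝ x (v a) ^ 2) ^ 2) - ‖x‖ ^ 4 / 2) := by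
        have : ∀ p : Fin n × Fin n, inner ℝ x (v p.1) * inner ℝ x (v p.2) *
            inner ℝ (C p - kr p.1 p.2 • b) (res v x) =
            inner ℝ x (v p.1) * inner ℝ x (v p.2) * inner ℝ (C p) (res v x) -
            kr p.1 p.2 * (inner ℝ x (v p.1) * inner ℝ x (v p.2)) * ‖res v x‖ ^ 2 := fun p => by
          rw [inner_sub_left, inner_smul_left, hby, conj_trivial]; ring
        simp only [g, Option.elim_some, this, Finset.sum_sub_distrib]
        rw [← Finset.sum_mul, hkr, hxi]
        ring
      rw [hg]
      refine h1.congr' ?_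
      filter_upwards [hpos] with τ hτ
      have hinner : Integrable (fun z : Euc d => z) (gau n ν τ) :=
        P.unif.integrable_gau_of_norm hτ continuous_id ExpGrowth.norm
      have e1 : inner ℝ (∫ z, z ∂gau n ν τ) x = ∫ z, inner ℝ z x ∂gau n ν τ := by
        rw [real_inner_comm, ← integral_inner (𝕜 := ℝ) hinner x]
        simp only [real_inner_comm x]
      have e2 : inner ℝ b x = ‖res v x‖ ^ 2 := (P.eq x hx).symm
      rw [P.integral_inner_sq hτ, P.integral_inner_cube hτ]
      simp only [Ψ, LinearMap.coe_mk, AddHom.coe_mk, Option.elim_some, cubicForm, inner_sub_left,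
        inner_smul_left, conj_trivial, e1, e2,
        P.inner_integral_smul_res hτ (ExpGrowth.inner_right _), sub_mul, Finset.sum_sub_distrib]
      have e3 : ∑ p : Fin n × Fin n, kr p.1 p.2 / τ ^ 2 *
          (inner ℝ x (v p.1) * inner ℝ x (v p.2)) = (‖x‖ ^ 2 - ‖res v x‖ ^ 2) / τ ^ 2 := by
        rw [← hkr, Finset.sum_div]
        exact Finset.sum_congr rfl fun p _ => by ring
      rw [e3]
      have e4 : ∀ c : ℝ, ∀ (ι : Type) [Fintype ι] (f I : ι → ℝ),
          ∑ i, c * I i * f i = c * ∑ i, f i * I i := fun c ι _ f I => by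
        rw [Finset.mul_sum]
        exact Finset.sum_congr rfl fun i _ => by ring
      have e5 : ∀ c : ℝ, ∀ (ι : Type) [Fintype ι] (f I : ι → ℝ),
          ∑ i, f i * (c * I i) = c * ∑ i, f i * I i := fun c ι _ f I => by
        rw [Finset.mul_sum]
        exact Finset.sum_congr rfl fun i _ => by ring
      rw [e4, e4, e5, e5]
      ring)
  exact ⟨w, congrFun hw none, fun x hx => ⟨M (res v x), hM1 _, congrFun hw (some ⟨x, hx⟩)⟩⟩

end Paraboloid

end

section

variable {d n : ℕ} {ν : Measure (Euc d)} {τ : ℝ}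

theorem abs_inner_orthonormal_le {v : Fin n → Euc d} (hv : Orthonormal ℝ v) (x : Euc d)
    (a : Fin n) : |inner ℝ x (v a)| ≤ ‖x‖ := by
  have := abs_real_inner_le_norm x (v a)
  rwa [hv.1, mul_one] at this

namespace Paraboloid
variable {v : Fin n → Euc d} {b : Euc d}

/-- A cubic form in the coordinates along the plane of a paraboloid vanishes as soon as it has
quadratic growth on the support. -/
theorem cubic_eq_zero (P : Paraboloid n ν v b) {c : Fin n × Fin n × Fin n → ℝ} {A B : ℝ}
    (hc : ∀ x ∈ msupport ν, |∑ p, c p * (inner ℝ x (v p.1) * inner ℝ x (v p.2.1) *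
      inner ℝ x (v p.2.2))| ≤ A * ‖x‖ + B * ‖x‖ ^ 2) (x : Euc d) :
    ∑ p, c p * (inner ℝ x (v p.1) * inner ℝ x (v p.2.1) * inner ℝ x (v p.2.2)) = 0 := by
  set f : Euc d → ℝ := fun x => ∑ p, c p * (inner ℝ x (v p.1) * inner ℝ x (v p.2.1) *
    inner ℝ x (v p.2.2)) with hf
  have hcont : Continuous f := by rw [hf]; fun_prop
  have hsub : f x = f (x - res v x) := by
    have : ∀ a, inner ℝ (x - res v x) (v a) = inner ℝ x (v a) := fun a => by
      rw [inner_sub_left, real_inner_comm (v a) (res v x), inner_res P.orth, sub_zero]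
    simp only [hf, this]
  change f x = 0
  rw [hsub]
  set y := x - res v x
  have hy : y ∈ Submodule.span ℝ (range v) := sub_res_mem_span v x
  by_contra hne
  have hpos : 0 < |f y| := abs_pos.2 hne
  obtain ⟨δ, hδ, hnear⟩ := Metric.eventually_nhds_iff.1
    ((hcont.abs.tendsto y).eventually (lt_mem_nhds (half_lt_self hpos)))
  have h1 : Tendsto (fun τ : ℝ => τ ^ 2 * (|A| * (‖y‖ + 1)) + τ * (|B| * (‖y‖ + 1) ^ 2)) (𝓝[>] 0)
      (𝓝 0) := by
    have : Tendsto (fun τ : ℝ => τ ^ 2 * (|A| * (‖y‖ + 1)) + τ * (|B| * (‖y‖ + 1) ^ 2)) (𝓝 0)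
        (𝓝 (0 ^ 2 * (|A| * (‖y‖ + 1)) + 0 * (|B| * (‖y‖ + 1) ^ 2))) := by
      have hcont : Continuous fun τ : ℝ =>
        τ ^ 2 * (|A| * (‖y‖ + 1)) + τ * (|B| * (‖y‖ + 1) ^ 2) := by fun_prop
      exact hcont.tendsto 0
    simp only [ne_eq, OfNat.ofNat_ne_zero, not_false_eq_true, zero_pow, zero_mul, add_zero] at this
    exact this.mono_left nhdsWithin_le_nhds
  obtain ⟨τ, ⟨⟨z, hz, hzy⟩, hτ⟩, hlt⟩ := (((eventually_exists_near P.unif.eventually_scl P.orth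
    P.defect hy (ε := min δ 1) (lt_min hδ one_pos)).and self_mem_nhdsWithin).and
      (h1.eventually (gt_mem_nhds (half_pos hpos)))).exists
  have hτ' : 0 < τ := hτ
  have h2 := hc _ ((mem_msupport_scl hτ').1 hz)
  have h3 : f (τ⁻¹ • z) = (τ⁻¹) ^ 3 * f z := by
    simp only [hf, inner_smul_left, conj_trivial, Finset.mul_sum]
    exact Finset.sum_congr rfl fun p _ => by ring
  change |f (τ⁻¹ • z)| ≤ _ at h2
  rw [h3, abs_mul, abs_of_pos (by positivity : 0 < τ⁻¹ ^ 3), norm_smul,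
    Real.norm_of_nonneg (by positivity : 0 ≤ τ⁻¹)] at h2
  have h4 : ‖z‖ ≤ ‖y‖ + 1 := by
    have h5 := norm_le_norm_add_norm_sub' z y
    rw [← dist_eq_norm z y] at h5
    linarith [hzy.le.trans (min_le_right δ 1)]
  have h5 := hnear (hzy.trans_le (min_le_left δ 1))
  have h6 : |f z| ≤ τ ^ 2 * (A * ‖z‖) + τ * (B * ‖z‖ ^ 2) := by
    have := mul_le_mul_of_nonneg_left h2 (by positivity : 0 ≤ τ ^ 3)
    calc |f z| = τ ^ 3 * (τ⁻¹ ^ 3 * |f z|) := by field_simp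
      _ ≤ _ := this
      _ = _ := by field_simp
  have h7 : τ ^ 2 * (A * ‖z‖) + τ * (B * ‖z‖ ^ 2) ≤
      τ ^ 2 * (|A| * (‖y‖ + 1)) + τ * (|B| * (‖y‖ + 1) ^ 2) := by
    have a1 : A * ‖z‖ ≤ |A| * (‖y‖ + 1) := by
      have := le_abs_self A
      gcongr
    have a2 : B * ‖z‖ ^ 2 ≤ |B| * (‖y‖ + 1) ^ 2 := by
      have := le_abs_self B
      gcongr
    gcongr
  linarith

/-- The quadratic relation with linear error satisfied by the support of a paraboloid measure. -/
theorem exists_quadratic (P : Paraboloid n ν v b) (U : Ultrafilter ℝ) (hU : ↑U ≤ 𝓝[>] (0 : ℝ))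
    {C : Fin n × Fin n → Euc d} (hC : ∀ p e, Tendsto (fun τ : ℝ => 4 * τ ^ 2 *
      ∫ z, inner ℝ z (v p.1) * inner ℝ z (v p.2) * inner ℝ (res v z) e ∂gau n ν τ) U
      (𝓝 (inner ℝ (C p) e))) :
    ∃ (H : Fin n × Fin n → ℝ) (K : ℝ), 0 ≤ K ∧ ∑ a, H (a, a) = -‖b‖ ^ 2 ∧ ∀ x ∈ msupport ν,
      |∑ p, inner ℝ x (v p.1) * inner ℝ x (v p.2) *
        (H p + inner ℝ (C p - kr p.1 p.2 • b) (res v x))| ≤ K * ‖x‖ := by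
  obtain ⟨⟨l, H, c, E⟩, htr, hw⟩ := P.exists_cubicForm U hU hC
  set D : Fin n × Fin n → Euc d := fun p => C p - kr p.1 p.2 • b with hD
  set K := ‖b‖ ^ 3 / 2 + 2 * ‖b‖ ^ 3 + ‖l‖ + (∑ a, ‖E a‖) * ‖b‖ with hK
  set K' := ∑ p, (|H p| + ‖D p‖ * ‖b‖) with hK'
  have h1 : ∀ x ∈ msupport ν, |(∑ p, inner ℝ x (v p.1) * inner ℝ x (v p.2) *
      (H p + inner ℝ (D p) (res v x))) + ∑ p, c p * (inner ℝ x (v p.1) * inner ℝ x (v p.2.1) *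
      inner ℝ x (v p.2.2))| ≤ K * ‖x‖ := fun x hx => by
    obtain ⟨m, hm, hx'⟩ := hw x hx
    have hy := P.norm_res_le hx
    have hy' := FlatnessPropagation.norm_res_le P.orth x
    have e1 : (∑ p, inner ℝ x (v p.1) * inner ℝ x (v p.2) *
      (H p + inner ℝ (D p) (res v x))) + ∑ p, c p * (inner ℝ x (v p.1) * inner ℝ x (v p.2.1) *
      inner ℝ x (v p.2.2)) = ‖res v x‖ ^ 4 / 2 - m - inner ℝ l x -
        ∑ a, inner ℝ x (v a) * inner ℝ (E a) (res v x) := by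
      simp only [cubicForm] at hx'
      simp only [mul_add, Finset.sum_add_distrib]
      have : ∑ p, inner ℝ x (v p.1) * inner ℝ x (v p.2) * H p =
        ∑ p, H p * (inner ℝ x (v p.1) * inner ℝ x (v p.2)) :=
          Finset.sum_congr rfl fun p _ => mul_comm _ _
      rw [this]
      linarith
    rw [e1]
    have b1 : ‖res v x‖ ^ 4 / 2 ≤ ‖b‖ ^ 3 / 2 * ‖x‖ := by
      have : ‖res v x‖ ^ 3 * ‖res v x‖ ≤ ‖b‖ ^ 3 * ‖x‖ := by gcongr
      linarith
    have b2 : |m| ≤ 2 * ‖b‖ ^ 3 * ‖x‖ := by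
      refine hm.trans ?_
      have : ‖res v x‖ * ‖res v x‖ ≤ ‖b‖ * ‖x‖ := by gcongr
      nlinarith [sq_nonneg ‖b‖]
    have b3 := abs_real_inner_le_norm l x
    have b4 : |∑ a, inner ℝ x (v a) * inner ℝ (E a) (res v x)| ≤ (∑ a, ‖E a‖) * ‖b‖ * ‖x‖ := by
      rw [Finset.sum_mul, Finset.sum_mul]
      refine (Finset.abs_sum_le_sum_abs _ _).trans (Finset.sum_le_sum fun a _ => ?_)
      rw [abs_mul, mul_comm]
      have := abs_inner_orthonormal_le P.orth x a
      have h2 := (abs_real_inner_le_norm (E a) (res v x)).trans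
        (mul_le_mul_of_nonneg_left hy (norm_nonneg _))
      gcongr
    have b5 : 0 ≤ ‖res v x‖ ^ 4 / 2 := by positivity
    rw [hK, add_mul, add_mul, add_mul]
    rw [abs_le] at *
    constructor <;> linarith
  have h2 : ∀ x ∈ msupport ν, |∑ p, inner ℝ x (v p.1) * inner ℝ x (v p.2) *
      (H p + inner ℝ (D p) (res v x))| ≤ K' * ‖x‖ ^ 2 := fun x hx => by
    rw [hK', Finset.sum_mul]
    refine (Finset.abs_sum_le_sum_abs _ _).trans (Finset.sum_le_sum fun p _ => ?_)
    rw [abs_mul, abs_mul, mul_comm, sq]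
    have h3 := abs_inner_orthonormal_le P.orth x p.1
    have h4 := abs_inner_orthonormal_le P.orth x p.2
    have h5 : |H p + inner ℝ (D p) (res v x)| ≤ |H p| + ‖D p‖ * ‖b‖ :=
      (abs_add_le _ _).trans (add_le_add_right ((abs_real_inner_le_norm _ _).trans
        (mul_le_mul_of_nonneg_left (P.norm_res_le hx) (norm_nonneg _))) _)
    gcongr
  have h3 := P.cubic_eq_zero (c := c) (A := K) (B := K') fun x hx => by
    have a1 := abs_le.1 (h1 x hx)
    have a2 := abs_le.1 (h2 x hx)
    rw [abs_le]
    constructor <;> linarith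
  refine ⟨H, K, by positivity, htr, fun x hx => ?_⟩
  have := h1 x hx
  rwa [h3 x, add_zero] at this

end Paraboloid

end

section

variable {d n : ℕ} {ν : Measure (Euc d)} {τ : ℝ}

theorem Unif.tendsto_integral_add (h : Unif n ν) {F : Filter ℝ} (hF : F ≤ 𝓝[>] (0 : ℝ)) {k : ℕ}
    {f g : Euc d → ℝ} {a b : ℝ} (hf : ExpGrowth f) (hg : ExpGrowth g)
    (ha : Tendsto (fun τ : ℝ => τ ^ k * ∫ z, f z ∂gau n ν τ) F (𝓝 a))
    (hb : Tendsto (fun τ : ℝ => τ ^ k * ∫ z, g z ∂gau n ν τ) F (𝓝 b)) :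
    Tendsto (fun τ : ℝ => τ ^ k * ∫ z, f z + g z ∂gau n ν τ) F (𝓝 (a + b)) := by
  refine (ha.add hb).congr' ?_
  filter_upwards [hF self_mem_nhdsWithin] with τ hτ
  rw [integral_add (h.integrable_gau hτ hf) (h.integrable_gau hτ hg), mul_add]

theorem Unif.tendsto_integral_sum (h : Unif n ν) {F : Filter ℝ} (hF : F ≤ 𝓝[>] (0 : ℝ)) {k : ℕ}
    {ι : Type*} [Fintype ι] (c : ι → ℝ) {f : ι → Euc d → ℝ} {a : ι → ℝ}
    (hf : ∀ i, ExpGrowth (f i))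
    (ha : ∀ i, Tendsto (fun τ : ℝ => τ ^ k * ∫ z, f i z ∂gau n ν τ) F (𝓝 (a i))) :
    Tendsto (fun τ : ℝ => τ ^ k * ∫ z, ∑ i, c i * f i z ∂gau n ν τ) F (𝓝 (∑ i, c i * a i)) := by
  refine (tendsto_finsetSum Finset.univ fun i _ => (ha i).const_mul (c i)).congr' ?_
  filter_upwards [hF self_mem_nhdsWithin] with τ hτ
  rw [h.integral_sum_mul_gau hτ c hf, Finset.mul_sum]
  exact Finset.sum_congr rfl fun i _ => by ring

theorem tendsto_integral_const_mul {F : Filter ℝ} {k : ℕ} {f : Euc d → ℝ} {a : ℝ} (c : ℝ)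
    (ha : Tendsto (fun τ : ℝ => τ ^ k * ∫ z, f z ∂gau n ν τ) F (𝓝 a)) :
    Tendsto (fun τ : ℝ => τ ^ k * ∫ z, c * f z ∂gau n ν τ) F (𝓝 (c * a)) := by
  refine (ha.const_mul c).congr fun τ => ?_
  rw [integral_const_mul]
  ring

namespace Paraboloid
variable {v : Fin n → Euc d} {b : Euc d}

theorem tendsto_sq_mul_pair (P : Paraboloid n ν v b) (i j : Fin n) :
    Tendsto (fun τ : ℝ => τ ^ 4 * ∫ z, ∑ a, 1 * (inner ℝ z (v a) * inner ℝ z (v a) *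
      (inner ℝ z (v i) * inner ℝ z (v j))) ∂gau n ν τ) (𝓝[>] 0)
      (𝓝 ((n + 2) / 4 * kr i j)) := by
  have h1 := P.unif.tendsto_integral_sum le_rfl (fun _ : Fin n => (1 : ℝ)) (k := 4)
    (f := fun a z => inner ℝ z (v a) * inner ℝ z (v a) * (inner ℝ z (v i) * inner ℝ z (v j)))
    (fun a => ((ExpGrowth.inner_right _).mul (ExpGrowth.inner_right _)).mul
      ((ExpGrowth.inner_right _).mul (ExpGrowth.inner_right _)))
    (fun a => P.tendsto_four a a i j)
  convert h1 using 2
  have e1 : ∀ a : Fin n, (1 : ℝ) * (1 / 4 * (kr a a * kr i j + kr a i * kr a j + kr a j * kr a i)) =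
      1 / 4 * kr i j + 1 / 2 * (kr a i * kr a j) := fun a => by
    rw [show (kr a a : ℝ) = 1 by simp [kr]]
    ring
  have e2 : ∑ a : Fin n, kr a i * kr a j = kr i j := by simp [kr, eq_comm]
  simp only [e1, Finset.sum_add_distrib, ← Finset.mul_sum, e2]
  simp
  ring

variable {U : Ultrafilter ℝ} {C : Fin n × Fin n → Euc d}

theorem third_moments_swap (hC : ∀ p e, Tendsto (fun τ : ℝ => 4 * τ ^ 2 *
      ∫ z, inner ℝ z (v p.1) * inner ℝ z (v p.2) * inner ℝ (res v z) e ∂gau n ν τ) U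
      (𝓝 (inner ℝ (C p) e))) (p : Fin n × Fin n) : C p.swap = C p := by
  refine ext_inner_right ℝ fun e => tendsto_nhds_unique (hC p.swap e) ((hC p e).congr fun τ => ?_)
  simp only [Prod.fst_swap, Prod.snd_swap, mul_comm (inner ℝ _ (v p.1)) (inner ℝ _ (v p.2))]

theorem third_moments_trace (P : Paraboloid n ν v b) (hU : ↑U ≤ 𝓝[>] (0 : ℝ))
    (hC : ∀ p e, Tendsto (fun τ : ℝ => 4 * τ ^ 2 *
      ∫ z, inner ℝ z (v p.1) * inner ℝ z (v p.2) * inner ℝ (res v z) e ∂gau n ν τ) U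
      (𝓝 (inner ℝ (C p) e))) : ∑ a, C (a, a) = (n : ℝ) • b := by
  refine ext_inner_right ℝ fun e => ?_
  have h1 := tendsto_finsetSum Finset.univ fun a (_ : a ∈ Finset.univ) => hC (a, a) e
  have h2 := ((P.tendsto_sum_sq_mul_res e).mono_left hU).const_mul 4
  rw [sum_inner, inner_smul_left, conj_trivial]
  refine (tendsto_nhds_unique h1 (h2.congr fun τ => ?_)).trans (by ring)
  rw [Finset.mul_sum]
  exact Finset.sum_congr rfl fun a _ => by ring

theorem eq_zero (P : Paraboloid n ν v b) : b = 0 := by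
  let U : Ultrafilter ℝ := Ultrafilter.of (𝓝[>] (0 : ℝ))
  have hU : ↑U ≤ 𝓝[>] (0 : ℝ) := Ultrafilter.of_le _
  obtain ⟨C, hC⟩ := P.exists_third_moments U hU
  obtain ⟨H, K, hK, htr, hR⟩ := P.exists_quadratic U hU hC
  set D : Fin n × Fin n → Euc d := fun p => C p - kr p.1 p.2 • b with hD
  have hDswap : ∀ p, D p.swap = D p := fun p => by
    simp only [hD, third_moments_swap hC p, Prod.fst_swap, Prod.snd_swap, kr, eq_comm]
  have hDtr : ∑ a, D (a, a) = 0 := by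
    simp only [hD, Finset.sum_sub_distrib, P.third_moments_trace hU hC, kr]
    simp [Nat.cast_smul_eq_nsmul ℝ]
  have hDtr' : ∀ e, ∑ a, inner ℝ (D (a, a)) e = 0 := fun e => by
    rw [← sum_inner, hDtr, inner_zero_left]
  have hw : ∀ a, ExpGrowth fun z => inner ℝ z (v a) := fun a => ExpGrowth.inner_right _
  have hww : ∀ p : Fin n × Fin n, ExpGrowth fun z => inner ℝ z (v p.1) * inner ℝ z (v p.2) :=
    fun p => (hw _).mul (hw _)
  have hR' : ExpGrowth fun z => ∑ p : Fin n × Fin n, inner ℝ z (v p.1) * inner ℝ z (v p.2) *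
      (H p + inner ℝ (D p) (res v z)) := by
    refine ExpGrowth.sum _ fun p _ => (hww p).mul ((ExpGrowth.const _).add ?_)
    simp only [real_inner_comm (res v _)]
    exact expGrowth_inner_res _
  have hnorm : ∑ p, ‖D p‖ ^ 2 = 2 * ‖b‖ ^ 2 := by
    have h1 := (P.unif.tendsto_pow_mul_integral_gau (m := 1) (k := 2) hK
      (fun z hz => by rw [pow_one]; exact hR z hz) (by norm_num)).mono_left hU
    have h2 := P.unif.tendsto_integral_add hU
      (ExpGrowth.sum _ fun p _ => (ExpGrowth.const (H p)).mul (hww p))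
      (ExpGrowth.sum _ fun p _ => (ExpGrowth.const 1).mul ((hww p).mul (expGrowth_inner_res (D p))))
      (P.unif.tendsto_integral_sum hU H hww fun p => (P.tendsto_pair p.1 p.2).mono_left hU)
      (P.unif.tendsto_integral_sum hU (fun _ : Fin n × Fin n => (1 : ℝ))
        (fun p => (hww p).mul (expGrowth_inner_res (D p)))
        (a := fun p => inner ℝ (C p) (D p) / 4) fun p =>
          ((hC p (D p)).div_const 4).congr fun τ => by ring)
    have h3 := tendsto_nhds_unique h1 (h2.congr fun τ => by
      congr 2
      ext z
      rw [← Finset.sum_add_distrib]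
      refine Finset.sum_congr rfl fun p _ => ?_
      rw [real_inner_comm (res v z)]
      ring)
    have e1 : ∑ p : Fin n × Fin n, H p * (kr p.1 p.2 / 2) = -‖b‖ ^ 2 / 2 := by
      rw [← htr, ← sum_kr_mul fun i j => H (i, j), Finset.sum_div]
      exact Finset.sum_congr rfl fun p _ => by ring
    have e2 : ∑ p : Fin n × Fin n, 1 * (inner ℝ (C p) (D p) / 4) = (∑ p, ‖D p‖ ^ 2) / 4 := by
      have e3 : ∀ p : Fin n × Fin n, inner ℝ (C p) (D p) =
          ‖D p‖ ^ 2 + kr p.1 p.2 * inner ℝ (D (p.1, p.2)) b := fun p => by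
        have : C p = D p + kr p.1 p.2 • b := by simp [hD]
        rw [this, inner_add_left, real_inner_self_eq_norm_sq, inner_smul_left, conj_trivial,
          real_inner_comm]
      simp only [e3, one_mul]
      rw [← Finset.sum_div, Finset.sum_add_distrib,
        sum_kr_mul fun i j => inner ℝ (D (i, j)) b, hDtr', add_zero]
    rw [e1, e2] at h3
    linarith
  set s : Euc d → ℝ := fun z => ∑ a, inner ℝ z (v a) * inner ℝ z (v a) with hs
  have hsg : ExpGrowth s := ExpGrowth.sum _ fun a _ => (hw a).mul (hw a)
  have hpair : ∀ p : Fin n × Fin n, Tendsto (fun τ : ℝ => τ ^ 4 *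
      ∫ z, s z * (inner ℝ z (v p.1) * inner ℝ z (v p.2)) ∂gau n ν τ) U
      (𝓝 ((n + 2) / 4 * kr p.1 p.2)) := fun p => by
    refine ((P.tendsto_sq_mul_pair p.1 p.2).mono_left hU).congr fun τ => ?_
    simp only [hs, Finset.sum_mul, one_mul]
  have hs0 : ∀ z, 0 ≤ s z := fun z => Finset.sum_nonneg fun a _ => mul_self_nonneg _
  have hsle : ∀ z, s z ≤ ‖z‖ ^ 2 := fun z => by
    simp only [hs, P.sum_sq_eq]
    linarith [sq_nonneg ‖res v z‖]
  have hlim0 := (P.unif.tendsto_pow_mul_integral_gau (m := 3) (k := 4) hK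
      (f := fun z => s z * ∑ p : Fin n × Fin n, inner ℝ z (v p.1) * inner ℝ z (v p.2) *
        (H p + inner ℝ (D p) (res v z)))
      (fun z hz => by
        rw [abs_mul, abs_of_nonneg (hs0 z)]
        calc _ ≤ ‖z‖ ^ 2 * (K * ‖z‖) := mul_le_mul (hsle z) (hR z hz) (abs_nonneg _) (by positivity)
          _ = _ := by ring) (by norm_num)).mono_left hU
  have hG : Tendsto (fun τ : ℝ => τ ^ 4 * ∫ z, ∑ p : Fin n × Fin n,
      (H p + inner ℝ (D p) b / 2) * (s z * (inner ℝ z (v p.1) * inner ℝ z (v p.2)))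
      ∂gau n ν τ) U (𝓝 (-((n + 2) / 4 * ‖b‖ ^ 2))) := by
    have := P.unif.tendsto_integral_sum hU (fun p : Fin n × Fin n => H p + inner ℝ (D p) b / 2)
      (fun p => hsg.mul (hww p)) hpair
    convert this using 2
    have e1 : ∀ p : Fin n × Fin n, (H p + inner ℝ (D p) b / 2) * (((n : ℝ) + 2) / 4 * kr p.1 p.2) =
        kr p.1 p.2 * ((n + 2) / 4 * (H (p.1, p.2) + inner ℝ (D (p.1, p.2)) b / 2)) :=
      fun p => by ring
    simp only [e1]
    rw [sum_kr_mul fun i j => ((n : ℝ) + 2) / 4 * (H (i, j) + inner ℝ (D (i, j)) b / 2),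
      ← Finset.mul_sum, Finset.sum_add_distrib, htr, ← Finset.sum_div, hDtr']
    ring
  have hS : Tendsto (fun τ : ℝ => τ ^ 4 * ∫ z, ∑ a : Fin n,
      1 * (s z * (inner ℝ z (v a) * inner ℝ z (v a))) ∂gau n ν τ) U
      (𝓝 (n * (n + 2) / 4)) := by
    have := P.unif.tendsto_integral_sum hU (fun _ : Fin n => (1 : ℝ))
      (fun a => hsg.mul (hww (a, a))) (fun a => hpair (a, a))
    convert this using 2
    simp [kr]
    ring
  have hDD : Tendsto (fun τ : ℝ => τ ^ 4 * ∫ z, ∑ r : (Fin n × Fin n) × (Fin n × Fin n),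
      inner ℝ (D r.1) (D r.2) * (inner ℝ z (v r.1.1) * inner ℝ z (v r.1.2) *
        (inner ℝ z (v r.2.1) * inner ℝ z (v r.2.2))) ∂gau n ν τ) U (𝓝 (‖b‖ ^ 2)) := by
    have := P.unif.tendsto_integral_sum hU
      (fun r : (Fin n × Fin n) × (Fin n × Fin n) => inner ℝ (D r.1) (D r.2))
      (fun r => (hww r.1).mul (hww r.2))
      (fun r => (P.tendsto_four r.1.1 r.1.2 r.2.1 r.2.2).mono_left hU)
    convert this using 2
    rw [Fintype.sum_prod_type]
    have e1 : ∀ p : Fin n × Fin n, ∑ q : Fin n × Fin n, inner ℝ (D p) (D q) *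
        (1 / 4 * (kr p.1 p.2 * kr q.1 q.2 + kr p.1 q.1 * kr p.2 q.2 + kr p.1 q.2 * kr p.2 q.1)) =
        ‖D p‖ ^ 2 / 2 := fun p => by
      have a1 : ∑ q : Fin n × Fin n, kr q.1 q.2 * inner ℝ (D p) (D (q.1, q.2)) = 0 := by
        rw [sum_kr_mul fun i j => inner ℝ (D p) (D (i, j)), ← inner_sum, hDtr, inner_zero_right]
      have a2 : ∑ q : Fin n × Fin n, kr p.1 q.1 * kr p.2 q.2 * inner ℝ (D p) (D (q.1, q.2)) =
          ‖D p‖ ^ 2 := by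
        rw [Fintype.sum_prod_type]
        simp [kr]
      have a3 : ∑ q : Fin n × Fin n, kr p.1 q.2 * kr p.2 q.1 * inner ℝ (D p) (D (q.1, q.2)) =
          ‖D p‖ ^ 2 := by
        rw [Fintype.sum_prod_type]
        have : D (p.2, p.1) = D p := hDswap p
        simp [kr, this]
      have a4 : ∀ q : Fin n × Fin n, inner ℝ (D p) (D q) *
        (1 / 4 * (kr p.1 p.2 * kr q.1 q.2 + kr p.1 q.1 * kr p.2 q.2 + kr p.1 q.2 * kr p.2 q.1)) =
        1 / 4 * kr p.1 p.2 * (kr q.1 q.2 * inner ℝ (D p) (D (q.1, q.2))) +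
        1 / 4 * (kr p.1 q.1 * kr p.2 q.2 * inner ℝ (D p) (D (q.1, q.2))) +
        1 / 4 * (kr p.1 q.2 * kr p.2 q.1 * inner ℝ (D p) (D (q.1, q.2))) := fun q => by ring
      simp only [a4, Finset.sum_add_distrib, ← Finset.mul_sum, a1, a2, a3]
      ring
    simp only [e1]
    rw [← Finset.sum_div, hnorm]
    ring
  have hGg : ExpGrowth fun z => ∑ p : Fin n × Fin n,
      (H p + inner ℝ (D p) b / 2) * (s z * (inner ℝ z (v p.1) * inner ℝ z (v p.2))) :=
    ExpGrowth.sum _ fun p _ => (ExpGrowth.const _).mul (hsg.mul (hww p))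
  have hSg : ExpGrowth fun z => ∑ a : Fin n, 1 * (s z * (inner ℝ z (v a) * inner ℝ z (v a))) :=
    ExpGrowth.sum _ fun a _ => (ExpGrowth.const _).mul (hsg.mul (hww (a, a)))
  have hDg : ExpGrowth fun z => ∑ r : (Fin n × Fin n) × (Fin n × Fin n),
      inner ℝ (D r.1) (D r.2) * (inner ℝ z (v r.1.1) * inner ℝ z (v r.1.2) *
        (inner ℝ z (v r.2.1) * inner ℝ z (v r.2.2))) :=
    ExpGrowth.sum _ fun r _ => (ExpGrowth.const _).mul ((hww r.1).mul (hww r.2))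
  have hSD := P.unif.tendsto_integral_add hU
    ((ExpGrowth.const (‖b‖ ^ 2 / (2 * (n + 1)))).mul hSg)
    ((ExpGrowth.const (((n : ℝ) + 1) / 8)).mul hDg)
    (tendsto_integral_const_mul (‖b‖ ^ 2 / (2 * (n + 1))) hS)
    (tendsto_integral_const_mul (((n : ℝ) + 1) / 8) hDD)
  have hSDg := ((ExpGrowth.const (‖b‖ ^ 2 / (2 * (n + 1)))).mul hSg).add
    ((ExpGrowth.const (((n : ℝ) + 1) / 8)).mul hDg)
  have hall := P.unif.tendsto_integral_add hU hGg hSDg hG hSD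
  have hle := le_of_tendsto_of_tendsto hlim0 hall (by
    filter_upwards [hU self_mem_nhdsWithin] with τ hτ
    have hτ' : 0 < τ := hτ
    refine mul_le_mul_of_nonneg_left ?_ (by positivity)
    refine integral_mono_ae (P.unif.integrable_gau hτ (hsg.mul hR'))
      (P.unif.integrable_gau hτ (hGg.add hSDg)) ?_
    filter_upwards [P.unif.ae_mem_gau hτ] with z hz
    set X : Euc d := ∑ p : Fin n × Fin n, (inner ℝ z (v p.1) * inner ℝ z (v p.2)) • D p with hX
    have e1 : s z * ∑ p : Fin n × Fin n, inner ℝ z (v p.1) * inner ℝ z (v p.2) *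
        (H p + inner ℝ (D p) (res v z)) = ∑ p : Fin n × Fin n,
        (H p + inner ℝ (D p) b / 2) * (s z * (inner ℝ z (v p.1) * inner ℝ z (v p.2))) +
        s z * inner ℝ X (res v z - (1 / 2 : ℝ) • b) := by
      rw [hX, sum_inner, ← mul_comm (∑ p, _) (s z), ← mul_comm (∑ p, _) (s z), Finset.sum_mul,
        Finset.sum_mul, ← Finset.sum_add_distrib]
      refine Finset.sum_congr rfl fun p _ => ?_
      rw [inner_smul_left, inner_sub_right, inner_smul_right, conj_trivial]
      ring
    have e2 : ∑ a : Fin n, 1 * (s z * (inner ℝ z (v a) * inner ℝ z (v a))) = s z ^ 2 := by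
      simp only [one_mul, ← Finset.mul_sum]
      rw [sq]
    have e3 : ∑ r : (Fin n × Fin n) × (Fin n × Fin n),
      inner ℝ (D r.1) (D r.2) * (inner ℝ z (v r.1.1) * inner ℝ z (v r.1.2) *
        (inner ℝ z (v r.2.1) * inner ℝ z (v r.2.2))) = ‖X‖ ^ 2 := by
      rw [← real_inner_self_eq_norm_sq, hX, sum_inner, Fintype.sum_prod_type]
      refine Finset.sum_congr rfl fun p _ => ?_
      rw [inner_sum]
      refine Finset.sum_congr rfl fun q _ => ?_
      rw [inner_smul_left, inner_smul_right, conj_trivial]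
      ring
    have e4 : s z * inner ℝ X (res v z - (1 / 2 : ℝ) • b) ≤ s z * (‖X‖ * (‖b‖ / 2)) := by
      refine mul_le_mul_of_nonneg_left ?_ (hs0 z)
      rw [← P.norm_res_sub hz]
      exact real_inner_le_norm _ _
    have e5 : s z * (‖X‖ * (‖b‖ / 2)) ≤
        ‖b‖ ^ 2 / (2 * (n + 1)) * s z ^ 2 + (n + 1) / 8 * ‖X‖ ^ 2 := by
      have hn : (0 : ℝ) < n + 1 := by positivity
      have h5 := sq_nonneg (2 * ‖b‖ * s z - (n + 1) * ‖X‖)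
      rw [← sub_nonneg]
      have : ‖b‖ ^ 2 / (2 * (n + 1)) * s z ^ 2 + (n + 1) / 8 * ‖X‖ ^ 2 -
          s z * (‖X‖ * (‖b‖ / 2)) = (2 * ‖b‖ * s z - (n + 1) * ‖X‖) ^ 2 / (8 * (n + 1)) := by
        field_simp
        ring
      rw [this]
      positivity
    simp only [e1, e2, e3]
    linarith)
  have hn : (0 : ℝ) < n + 1 := by positivity
  have hfin : -((n + 2) / 4 * ‖b‖ ^ 2) + (‖b‖ ^ 2 / (2 * (n + 1)) * (n * (n + 2) / 4) +
      (n + 1) / 8 * ‖b‖ ^ 2) = -(‖b‖ ^ 2 * ((2 * n + 3) / (8 * (n + 1)))) := by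
    field_simp
    ring
  rw [hfin] at hle
  by_contra hb
  have hb' : 0 < ‖b‖ := norm_pos_iff.2 hb
  have : 0 < ‖b‖ ^ 2 * ((2 * n + 3) / (8 * ((n : ℝ) + 1))) := by positivity
  linarith

end Paraboloid

/-- A uniform measure that is contained in a paraboloid is supported on a plane. -/
theorem Unif.msupport_eq_of_paraboloid (h : Unif n ν) {v : Fin n → Euc d} {b : Euc d}
    (hv : Orthonormal ℝ v) (heq : ∀ z ∈ msupport ν, ‖res v z‖ ^ 2 = inner ℝ b z) :
    msupport ν = Submodule.span ℝ (range v) := by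
  obtain ⟨b', P⟩ := h.exists_paraboloid_barycenter hv heq
  refine msupport_eq_of_subset h _ (finrank_span_orthonormal hv) fun z hz => ?_
  have := P.eq z hz
  rw [P.eq_zero, inner_zero_left, sq_eq_zero_iff, norm_eq_zero] at this
  exact (res_eq_zero_iff hv z).1 this

/-- A uniform measure that is close to a plane at all large dyadic scales is supported on a
plane. -/
theorem exists_flat (d : ℕ) {n : ℕ} (hn : 0 < n) : ∃ δ > 0, ∀ ν : Measure (Euc d), Unif n ν →
    (∀ k : ℕ, 1 ≤ k → ∃ v : Fin n → Euc d, Orthonormal ℝ v ∧ ∀ z ∈ msupport ν, ‖z‖ < 2 ^ k →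
      ‖res v z‖ ≤ δ * 2 ^ k) →
    ∃ v : Fin n → Euc d, Orthonormal ℝ v ∧ msupport ν = Submodule.span ℝ (range v) := by
  obtain ⟨δ, hδ, H⟩ := exists_paraboloid d hn
  refine ⟨δ, hδ, fun ν h hk => ?_⟩
  obtain ⟨e, b, he, heq⟩ := H ν h hk
  exact ⟨e, he, h.msupport_eq_of_paraboloid he heq⟩

end

section

variable {d n : ℕ} {μ : Measure (Euc d)}

/-- The blow-up of `μ` that maps `closedBall x r` to a unit ball of measure `1` centered at the
origin. -/
def blowUp (μ : Measure (Euc d)) (x : Euc d) (r : ℝ) : Measure (Euc d) :=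
  (μ (closedBall x r))⁻¹ • μ.map fun y => r⁻¹ • (y - x)

theorem preimage_blowUp_closedBall (x z : Euc d) {r : ℝ} (hr : 0 < r) (s : ℝ) :
    (fun y => r⁻¹ • (y - x)) ⁻¹' closedBall z s = closedBall (x + r • z) (r * s) := by
  ext y
  rw [mem_preimage, mem_closedBall, mem_closedBall, dist_eq_norm, dist_eq_norm]
  rw [show y - (x + r • z) = r • (r⁻¹ • (y - x) - z) by
    rw [smul_sub, smul_inv_smul₀ hr.ne', sub_sub], norm_smul, Real.norm_of_nonneg hr.le,
    mul_le_mul_iff_right₀ hr]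

theorem blowUp_closedBall (x z : Euc d) {r : ℝ} (hr : 0 < r) (s : ℝ) :
    blowUp μ x r (closedBall z s) =
      (μ (closedBall x r))⁻¹ * μ (closedBall (x + r • z) (r * s)) := by
  rw [blowUp, Measure.smul_apply, smul_eq_mul, Measure.map_apply (by fun_prop)
    measurableSet_closedBall, preimage_blowUp_closedBall x z hr]

theorem measure_closedBall_ne_top [IsLocallyFiniteMeasure μ] (x : Euc d) (r : ℝ) :
    μ (closedBall x r) ≠ ∞ :=
  (isCompact_closedBall x r).measure_lt_top.ne

theorem real_closedBall_pos [IsLocallyFiniteMeasure μ] {x : Euc d} (hx : x ∈ msupport μ) {r : ℝ}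
    (hr : 0 < r) : 0 < μ.real (closedBall x r) :=
  ENNReal.toReal_pos (hx r hr).ne' (measure_closedBall_ne_top x r)

theorem blowUp_real_closedBall (x z : Euc d) {r : ℝ} (hr : 0 < r) (s : ℝ) :
    (blowUp μ x r).real (closedBall z s) =
      μ.real (closedBall (x + r • z) (s * r)) / μ.real (closedBall x r) := by
  rw [measureReal_def, blowUp_closedBall x z hr, ENNReal.toReal_mul, ENNReal.toReal_inv,
    mul_comm r s, div_eq_inv_mul]
  rfl

theorem mem_msupport_blowUp [IsLocallyFiniteMeasure μ] {x : Euc d} {r : ℝ} (hr : 0 < r)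
    {z : Euc d} : z ∈ msupport (blowUp μ x r) ↔ x + r • z ∈ msupport μ := by
  have h : ∀ s, 0 < blowUp μ x r (closedBall z s) ↔ 0 < μ (closedBall (x + r • z) (r * s)) := by
    intro s
    rw [blowUp_closedBall x z hr, ENNReal.mul_pos_iff]
    simp [measure_closedBall_ne_top]
  refine ⟨fun hz s hs => ?_, fun hz s hs => (h s).2 (hz _ (by positivity))⟩
  have := (h (s / r)).1 (hz _ (by positivity))
  rwa [mul_div_cancel₀ _ hr.ne'] at this

theorem isLocallyFiniteMeasure_blowUp [IsLocallyFiniteMeasure μ] {x : Euc d}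
    (hx : x ∈ msupport μ) {r : ℝ} (hr : 0 < r) : IsLocallyFiniteMeasure (blowUp μ x r) := by
  refine ⟨fun z => ⟨closedBall z 1, closedBall_mem_nhds z one_pos, ?_⟩⟩
  rw [blowUp_closedBall x z hr]
  exact ENNReal.mul_lt_top (ENNReal.inv_lt_top.2 (hx r hr))
    (measure_closedBall_ne_top _ _).lt_top

variable {ι : Type*} {F : Filter ι} {K : Set (Euc d)} {ρ : ι → ℝ} {p : ι → Euc d}

theorem tendsto_ratio_half [IsLocallyFiniteMeasure μ] (h : AsympOptDoubling n μ)
    (hK : IsCompact K) (hKμ : K ⊆ msupport μ) {t : ℝ} (ht : t ∈ Icc (1 / 2) 1)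
    (hρ : Tendsto ρ F (𝓝[>] 0)) (hp : ∀ᶠ i in F, p i ∈ K) :
    Tendsto (fun i => μ.real (closedBall (p i) (t * ρ i)) / μ.real (closedBall (p i) (ρ i))) F
      (𝓝 (t ^ n)) := by
  rw [tendsto_iff_dist_tendsto_zero]
  refine squeeze_zero' (Eventually.of_forall fun _ => dist_nonneg) ?_ ((h K hK hKμ t ht).comp hρ)
  have hρ0 : ∀ᶠ i in F, 0 < ρ i := hρ.eventually self_mem_nhdsWithin
  filter_upwards [hρ0, hp] with i hi hpi
  have hb : BddAbove (range fun x : K =>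
      |(μ (closedBall x.1 (t * ρ i)) / μ (closedBall x.1 (ρ i))).toReal - t ^ n|) := by
    refine ⟨1, ?_⟩
    rintro _ ⟨x, rfl⟩
    have ht0 : 0 ≤ t := by linarith [ht.1]
    have h1 : t ^ n ≤ 1 := pow_le_one₀ ht0 ht.2
    have h2 : 0 ≤ t ^ n := pow_nonneg ht0 n
    have h3 : (μ (closedBall x.1 (t * ρ i)) / μ (closedBall x.1 (ρ i))).toReal ≤ 1 := by
      refine ENNReal.toReal_le_of_le_ofReal zero_le_one ?_
      rw [ENNReal.ofReal_one]
      refine ENNReal.div_le_of_le_mul ?_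
      rw [one_mul]
      exact measure_mono (closedBall_subset_closedBall (mul_le_of_le_one_left hi.le ht.2))
    have h4 := ENNReal.toReal_nonneg
      (a := μ (closedBall x.1 (t * ρ i)) / μ (closedBall x.1 (ρ i)))
    rw [abs_le]
    constructor <;> linarith
  have := le_ciSup hb ⟨p i, hpi⟩
  rw [Real.dist_eq, measureReal_def, measureReal_def, ← ENNReal.toReal_div]
  exact this

theorem tendsto_mul_nhdsGT {t : ℝ} (ht : 0 < t) (hρ : Tendsto ρ F (𝓝[>] 0)) :
    Tendsto (fun i => t * ρ i) F (𝓝[>] 0) := by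
  rw [tendsto_nhdsWithin_iff] at hρ ⊢
  refine ⟨by simpa using hρ.1.const_mul t, ?_⟩
  filter_upwards [hρ.2] with i hi
  exact mul_pos ht hi

theorem tendsto_ratio_of_le_one [IsLocallyFiniteMeasure μ] (h : AsympOptDoubling n μ)
    (hK : IsCompact K) (hKμ : K ⊆ msupport μ) (k : ℕ) : ∀ {t : ℝ}, t ∈ Icc ((1 / 2) ^ k) 1 →
    ∀ {ρ : ι → ℝ}, Tendsto ρ F (𝓝[>] 0) → (∀ᶠ i in F, p i ∈ K) →
    Tendsto (fun i => μ.real (closedBall (p i) (t * ρ i)) / μ.real (closedBall (p i) (ρ i))) F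
      (𝓝 (t ^ n)) := by
  induction k with
  | zero =>
    intro t ht ρ hρ hp
    rw [pow_zero, Icc_self, mem_singleton_iff] at ht
    exact tendsto_ratio_half h hK hKμ (by rw [ht]; norm_num) hρ hp
  | succ k ih =>
    intro t ht ρ hρ hp
    rcases le_total (1 / 2) t with ht2 | ht2
    · exact tendsto_ratio_half h hK hKμ ⟨ht2, ht.2⟩ hρ hp
    · have h1 := ih (t := 2 * t) ⟨by rw [pow_succ] at ht; linarith [ht.1], by linarith⟩
        (tendsto_mul_nhdsGT (by norm_num : (0 : ℝ) < 1 / 2) hρ) hp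
      have h2 := h1.mul (tendsto_ratio_half h hK hKμ (by norm_num : (1 / 2 : ℝ) ∈ Icc (1 / 2) 1)
        hρ hp)
      rw [← mul_pow, show 2 * t * (1 / 2) = t by ring] at h2
      refine h2.congr' ?_
      have hρ0 : ∀ᶠ i in F, 0 < ρ i := hρ.eventually self_mem_nhdsWithin
      filter_upwards [hρ0, hp] with i hi hpi
      have := real_closedBall_pos (hKμ hpi) (show 0 < 1 / 2 * ρ i by positivity)
      rw [div_mul_div_cancel₀ this.ne', show 2 * t * (1 / 2 * ρ i) = t * ρ i by ring]

theorem tendsto_ratio [IsLocallyFiniteMeasure μ] (h : AsympOptDoubling n μ)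
    (hK : IsCompact K) (hKμ : K ⊆ msupport μ) {t : ℝ} (ht : 0 < t)
    (hρ : Tendsto ρ F (𝓝[>] 0)) (hp : ∀ᶠ i in F, p i ∈ K) :
    Tendsto (fun i => μ.real (closedBall (p i) (t * ρ i)) / μ.real (closedBall (p i) (ρ i))) F
      (𝓝 (t ^ n)) := by
  have key : ∀ {t : ℝ}, 0 < t → t ≤ 1 → ∀ {ρ : ι → ℝ}, Tendsto ρ F (𝓝[>] 0) →
      Tendsto (fun i => μ.real (closedBall (p i) (t * ρ i)) / μ.real (closedBall (p i) (ρ i))) F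
      (𝓝 (t ^ n)) := fun {t} ht0 ht1 {ρ} hρ => by
    obtain ⟨k, hk⟩ := exists_pow_lt_of_lt_one ht0 (by norm_num : (1 / 2 : ℝ) < 1)
    exact tendsto_ratio_of_le_one h hK hKμ k ⟨hk.le, ht1⟩ hρ hp
  rcases le_total t 1 with ht1 | ht1
  · exact key ht ht1 hρ
  · have h1 := (key (inv_pos.2 ht) (inv_le_one_of_one_le₀ ht1) (tendsto_mul_nhdsGT ht hρ)).inv₀
      (by positivity)
    rw [inv_pow, inv_inv] at h1
    refine h1.congr fun i => ?_
    rw [inv_div, inv_mul_cancel_left₀ ht.ne']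

theorem tendsto_ratio_centers [IsLocallyFiniteMeasure μ] (h : AsympOptDoubling n μ)
    (hK : IsCompact K) (hKμ : K ⊆ msupport μ) {U : Ultrafilter ι} {x : ι → Euc d}
    {s R : ℝ} (hs : 0 < s) (hR : 0 ≤ R) (hρ : Tendsto ρ U (𝓝[>] 0)) (hp : ∀ᶠ i in U, p i ∈ K)
    (hx : ∀ᶠ i in U, x i ∈ K) (hd : ∀ᶠ i in U, dist (p i) (x i) ≤ R * ρ i) :
    Tendsto (fun i => μ.real (closedBall (p i) (s * ρ i)) / μ.real (closedBall (x i) (ρ i))) U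
      (𝓝 (s ^ n)) := by
  have hρ0 : ∀ᶠ i in U, 0 < ρ i := hρ.eventually self_mem_nhdsWithin
  have mono : ∀ (y : Euc d) {a b : ℝ} (z : Euc d), a + dist y z ≤ b →
      μ.real (closedBall y a) ≤ μ.real (closedBall z b) := fun y a b z hab =>
    measureReal_mono (closedBall_subset_closedBall' hab) (measure_closedBall_ne_top _ _)
  have up : ∀ T : ℝ, 0 < T → Tendsto (fun i =>
      μ.real (closedBall (p i) (s * ρ i)) / μ.real (closedBall (p i) (T * ρ i)) *
        (μ.real (closedBall (x i) ((T + R) * ρ i)) / μ.real (closedBall (x i) (ρ i)))) U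
      (𝓝 ((s / T) ^ n * (T + R) ^ n)) := fun T hT => by
    refine Tendsto.mul ?_ (tendsto_ratio h hK hKμ (by positivity) hρ hx)
    refine (tendsto_ratio h hK hKμ (div_pos hs hT) (tendsto_mul_nhdsGT hT hρ) hp).congr fun i => ?_
    rw [← mul_assoc, div_mul_cancel₀ _ hT.ne']
  have lo : ∀ T : ℝ, R < T → Tendsto (fun i =>
      μ.real (closedBall (p i) (s * ρ i)) / μ.real (closedBall (p i) (T * ρ i)) *
        (μ.real (closedBall (x i) ((T - R) * ρ i)) / μ.real (closedBall (x i) (ρ i)))) U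
      (𝓝 ((s / T) ^ n * (T - R) ^ n)) := fun T hT => by
    have hT0 : 0 < T := hR.trans_lt hT
    refine Tendsto.mul ?_ (tendsto_ratio h hK hKμ (sub_pos.2 hT) hρ hx)
    refine (tendsto_ratio h hK hKμ (div_pos hs hT0) (tendsto_mul_nhdsGT hT0 hρ) hp).congr
      fun i => ?_
    rw [← mul_assoc, div_mul_cancel₀ _ hT0.ne']
  have hle : ∀ T : ℝ, 0 < T → ∀ᶠ i in U,
      μ.real (closedBall (p i) (s * ρ i)) / μ.real (closedBall (x i) (ρ i)) ≤
      μ.real (closedBall (p i) (s * ρ i)) / μ.real (closedBall (p i) (T * ρ i)) *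
        (μ.real (closedBall (x i) ((T + R) * ρ i)) / μ.real (closedBall (x i) (ρ i))) := by
    intro T hT
    filter_upwards [hρ0, hp, hx, hd] with i hi hpi hxi hdi
    have h1 := real_closedBall_pos (hKμ hpi) (show 0 < T * ρ i by positivity)
    have h2 := real_closedBall_pos (hKμ hxi) hi
    refine (div_mul_div_cancel₀ h1.ne').symm.trans_le ?_
    refine mul_le_mul_of_nonneg_left ?_ (by positivity)
    exact div_le_div_of_nonneg_right (mono _ _ (by linarith)) h2.le
  have hge : ∀ T : ℝ, 0 < T → ∀ᶠ i in U,
      μ.real (closedBall (p i) (s * ρ i)) / μ.real (closedBall (p i) (T * ρ i)) *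
        (μ.real (closedBall (x i) ((T - R) * ρ i)) / μ.real (closedBall (x i) (ρ i))) ≤
      μ.real (closedBall (p i) (s * ρ i)) / μ.real (closedBall (x i) (ρ i)) := by
    intro T hT
    filter_upwards [hρ0, hp, hx, hd] with i hi hpi hxi hdi
    have h1 := real_closedBall_pos (hKμ hpi) (show 0 < T * ρ i by positivity)
    have h2 := real_closedBall_pos (hKμ hxi) hi
    refine le_of_le_of_eq ?_ (div_mul_div_cancel₀ h1.ne')
    refine mul_le_mul_of_nonneg_left ?_ (by positivity)
    exact div_le_div_of_nonneg_right (mono _ _ (by rw [dist_comm]; linarith)) h2.le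
  obtain ⟨a, ha⟩ := exists_ultralimit_real U (M := (s / 1) ^ n * (1 + R) ^ n + 1)
    (f := fun i => μ.real (closedBall (p i) (s * ρ i)) / μ.real (closedBall (x i) (ρ i))) (by
      filter_upwards [hle 1 one_pos, (up 1 one_pos).eventually_le_const (lt_add_one _)]
        with i h1 h2
      rw [abs_of_nonneg (by positivity)]
      exact h1.trans h2)
  have h1 : Tendsto (fun T : ℝ => (s / T) ^ n * (T + R) ^ n) atTop (𝓝 (s ^ n)) := by
    have : Tendsto (fun T : ℝ => (s * (1 + R / T)) ^ n) atTop (𝓝 ((s * (1 + 0)) ^ n)) :=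
      ((tendsto_const_nhds.add (tendsto_const_nhds.div_atTop tendsto_id)).const_mul s).pow n
    rw [add_zero, mul_one] at this
    refine this.congr' ?_
    filter_upwards [eventually_gt_atTop 0] with T hT
    rw [← mul_pow]
    congr 1
    field_simp
  have h2 : Tendsto (fun T : ℝ => (s / T) ^ n * (T - R) ^ n) atTop (𝓝 (s ^ n)) := by
    have : Tendsto (fun T : ℝ => (s * (1 - R / T)) ^ n) atTop (𝓝 ((s * (1 - 0)) ^ n)) :=
      ((tendsto_const_nhds.sub (tendsto_const_nhds.div_atTop tendsto_id)).const_mul s).pow n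
    rw [sub_zero, mul_one] at this
    refine this.congr' ?_
    filter_upwards [eventually_gt_atTop 0] with T hT
    rw [← mul_pow]
    congr 1
    field_simp
  have h3 : a ≤ s ^ n := ge_of_tendsto h1 <| by
    filter_upwards [eventually_gt_atTop 0] with T hT
    exact le_of_tendsto_of_tendsto ha (up T hT) (hle T hT)
  have h4 : s ^ n ≤ a := le_of_tendsto h2 <| by
    filter_upwards [eventually_gt_atTop R] with T hT
    exact le_of_tendsto_of_tendsto (lo T hT) ha (hge T (hR.trans_lt hT))
  rwa [le_antisymm h3 h4] at ha

theorem asympUnif_blowUp [IsLocallyFiniteMeasure μ] (hn : 0 < n) (h : AsympOptDoubling n μ)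
    {U : Ultrafilter ι} {x : ι → Euc d} {M : ℝ} (hx : ∀ i, x i ∈ msupport μ)
    (hM : ∀ i, ‖x i‖ ≤ M) (hρ0 : ∀ i, 0 < ρ i) (hρ : Tendsto ρ U (𝓝 0)) :
    AsympUnif n U fun i => blowUp μ (x i) (ρ i) := by
  have hρ' : Tendsto ρ U (𝓝[>] 0) :=
    tendsto_nhdsWithin_iff.2 ⟨hρ, Eventually.of_forall hρ0⟩
  refine ⟨hn, fun i => isLocallyFiniteMeasure_blowUp (hx i) (hρ0 i),
    Eventually.of_forall fun i => ?_, fun R r hr ε hε => ?_⟩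
  · rw [mem_msupport_blowUp (hρ0 i), smul_zero, add_zero]
    exact hx i
  · by_contra hcon
    rw [← Ultrafilter.eventually_not] at hcon
    push Not at hcon
    have hex : ∀ i, ∃ z, z ∈ msupport (blowUp μ (x i) (ρ i)) ∧
        ((∃ y ∈ msupport (blowUp μ (x i) (ρ i)) ∩ closedBall 0 R,
          ε < |(blowUp μ (x i) (ρ i)).real (closedBall y r) - r ^ n|) → ‖z‖ ≤ R ∧
          ε < |(blowUp μ (x i) (ρ i)).real (closedBall z r) - r ^ n|) := fun i => by
      by_cases hi : ∃ y ∈ msupport (blowUp μ (x i) (ρ i)) ∩ closedBall 0 R,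
          ε < |(blowUp μ (x i) (ρ i)).real (closedBall y r) - r ^ n|
      · obtain ⟨y, hy, hy'⟩ := hi
        exact ⟨y, hy.1, fun _ => ⟨by simpa using hy.2, hy'⟩⟩
      · refine ⟨0, ?_, fun h => absurd h hi⟩
        rw [mem_msupport_blowUp (hρ0 i), smul_zero, add_zero]
        exact hx i
    choose z hz hz' using hex
    have hzR : ∀ᶠ i in U, ‖z i‖ ≤ R := hcon.mono fun i hi => (hz' i hi).1
    have hR : 0 ≤ R := by
      obtain ⟨i, hi⟩ := hzR.exists
      exact (norm_nonneg _).trans hi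
    have hK : IsCompact (msupport μ ∩ closedBall 0 (M + 1)) :=
      (isCompact_closedBall _ _).inter_left (isClosed_msupport μ)
    have hsmall : ∀ᶠ i in U, R * ρ i ≤ 1 := by
      have := hρ.const_mul R
      rw [mul_zero] at this
      exact this.eventually_le_const one_pos
    have hnorm : ∀ i, ‖z i‖ ≤ R → ‖ρ i • z i‖ ≤ R * ρ i := fun i hi => by
      rw [norm_smul, Real.norm_of_nonneg (hρ0 i).le, mul_comm]
      exact mul_le_mul_of_nonneg_right hi (hρ0 i).le
    have hlim := tendsto_ratio_centers h hK inter_subset_left (p := fun i => x i + ρ i • z i)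
      (x := x) hr hR hρ' (by
        filter_upwards [hzR, hsmall] with i h1 h2
        refine ⟨(mem_msupport_blowUp (hρ0 i)).1 (hz i), ?_⟩
        rw [mem_closedBall_zero_iff]
        exact (norm_add_le _ _).trans (by linarith [hM i, hnorm i h1]))
      (Eventually.of_forall fun i => ⟨hx i, by
        rw [mem_closedBall_zero_iff]; linarith [hM i]⟩) (by
        filter_upwards [hzR] with i h1
        rw [dist_eq_norm, add_sub_cancel_left]
        exact hnorm i h1)
    obtain ⟨i, hi1, hi2⟩ := (hcon.and (hlim.eventually (closedBall_mem_nhds _ hε))).exists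
    have := (hz' i hi1).2
    rw [blowUp_real_closedBall _ _ (hρ0 i), ← Real.dist_eq] at this
    exact absurd hi2 (not_le.2 this)

end

section

variable {d n : ℕ} {μ : Measure (Euc d)}

theorem exists_orthonormal_span (V : Submodule ℝ (Euc d)) (hV : Module.finrank ℝ V = n) :
    ∃ v : Fin n → Euc d, Orthonormal ℝ v ∧ Submodule.span ℝ (range v) = V := by
  let b := (stdOrthonormalBasis ℝ V).reindex (finCongr hV)
  refine ⟨fun a => b a, b.orthonormal.comp_linearIsometry V.subtypeₗᵢ, ?_⟩
  have h := congrArg (Submodule.map V.subtype) b.toBasis.span_eq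
  rw [Submodule.map_top, Submodule.range_subtype, Submodule.map_span, ← range_comp] at h
  simpa [Function.comp_def] using h

theorem mk'_mem_nPlanes (x : Euc d) {v : Fin n → Euc d} (hv : Orthonormal ℝ v) :
    AffineSubspace.mk' x (Submodule.span ℝ (range v)) ∈ nPlanes d n :=
  ⟨AffineSubspace.mk'_nonempty _ _, by
    rw [AffineSubspace.direction_mk', finrank_span_orthonormal hv]⟩

theorem nonempty_nPlanes (hnd : n ≤ d) : Nonempty (nPlanes d n) := by
  have hv : Orthonormal ℝ fun a : Fin n => EuclideanSpace.basisFun (Fin d) ℝ (Fin.castLE hnd a) :=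
    (EuclideanSpace.basisFun (Fin d) ℝ).orthonormal.comp _ (Fin.castLE_injective hnd)
  exact ⟨⟨_, mk'_mem_nPlanes 0 hv⟩⟩

theorem exists_nPlane_of_jonesBeta_lt (hnd : n ≤ d) {x : Euc d} {r β : ℝ} (hr : 0 < r)
    (h : jonesBeta n μ x r < β) : ∃ L ∈ nPlanes d n, ∀ y ∈ msupport μ ∩ closedBall x r,
      infDist y (L : Set (Euc d)) < β * r := by
  have := nonempty_nPlanes hnd
  obtain ⟨⟨L, hL⟩, hLβ⟩ := exists_lt_of_ciInf_lt h
  refine ⟨L, hL, fun y hy => ?_⟩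
  rw [← div_lt_iff₀ hr]
  refine lt_of_le_of_lt ?_ hLβ
  have hb : BddAbove (range fun y : (msupport μ ∩ closedBall x r : Set (Euc d)) =>
      infDist y.1 (L : Set (Euc d)) / r) := by
    obtain ⟨q, hq⟩ := hL.1
    refine ⟨(r + dist x q) / r, ?_⟩
    rintro _ ⟨z, rfl⟩
    refine div_le_div_of_nonneg_right ((infDist_le_dist_of_mem hq).trans
      ((dist_triangle _ x _).trans ?_)) hr.le
    have := mem_closedBall.1 z.2.2
    linarith
  exact le_ciSup hb ⟨y, hy⟩

theorem norm_res_le_of_jonesBeta [IsLocallyFiniteMeasure μ] (hnd : n ≤ d) {x : Euc d}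
    (hx : x ∈ msupport μ) {r s δ : ℝ} (hr : 0 < r) (hs : 0 < s) (hδ : 0 < δ)
    (h : jonesBeta n μ x (s * r) ≤ δ / 4) :
    ∃ v : Fin n → Euc d, Orthonormal ℝ v ∧ ∀ z ∈ msupport (blowUp μ x r), ‖z‖ ≤ s →
      ‖res v z‖ ≤ δ * s := by
  have hsr := mul_pos hs hr
  obtain ⟨L, hL, hLs⟩ := exists_nPlane_of_jonesBeta_lt hnd hsr
    (h.trans_lt (show δ / 4 < δ / 2 by linarith))
  obtain ⟨v, hv, hvL⟩ := exists_orthonormal_span L.direction hL.2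
  refine ⟨v, hv, fun z hz hzs => ?_⟩
  rw [mem_msupport_blowUp hr] at hz
  obtain ⟨p, hp, hp'⟩ := (infDist_lt_iff hL.1).1
    (hLs x ⟨hx, mem_closedBall_self hsr.le⟩)
  obtain ⟨q, hq, hq'⟩ := (infDist_lt_iff hL.1).1 (hLs (x + r • z) ⟨hz, by
    rw [mem_closedBall, dist_eq_norm, add_sub_cancel_left, norm_smul, Real.norm_of_nonneg hr.le,
      mul_comm]
    exact mul_le_mul_of_nonneg_right hzs hr.le⟩)
  have hqp : res v (q - p) = 0 := by
    rw [res_eq_zero_iff hv, hvL]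
    exact AffineSubspace.vsub_mem_direction hq hp
  have h1 : r • res v z = res v ((x + r • z - q) - (x - p)) := by
    rw [← res_smul, ← add_zero (res v ((x + r • z - q) - (x - p))), ← hqp, ← res_add]
    congr 1
    abel
  have h2 : r * ‖res v z‖ ≤ r * (δ * s) := by
    rw [← Real.norm_of_nonneg hr.le, ← norm_smul, h1, Real.norm_of_nonneg hr.le]
    refine (norm_res_le hv _).trans ((norm_sub_le _ _).trans ?_)
    rw [← dist_eq_norm, ← dist_eq_norm]
    linarith
  exact le_of_mul_le_mul_left h2 hr

theorem exists_frame_of_tendsto {ι : Type*} {U : Ultrafilter ι} {ν : ι → Measure (Euc d)}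
    {lam : Measure (Euc d)} {s c : ℝ}
    (hlam : ∀ x ∈ msupport lam, ∀ ε > 0, ∀ᶠ i in U, ∃ y ∈ msupport (ν i), dist y x < ε)
    (h : ∀ᶠ i in U, ∃ v : Fin n → Euc d, Orthonormal ℝ v ∧ ∀ z ∈ msupport (ν i), ‖z‖ ≤ s →
      ‖res v z‖ ≤ c) :
    ∃ v : Fin n → Euc d, Orthonormal ℝ v ∧ ∀ z ∈ msupport lam, ‖z‖ < s → ‖res v z‖ ≤ c := by
  have hex : ∀ i, ∃ v : Fin n → Euc d, (∃ v : Fin n → Euc d, Orthonormal ℝ v ∧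
      ∀ z ∈ msupport (ν i), ‖z‖ ≤ s → ‖res v z‖ ≤ c) →
      Orthonormal ℝ v ∧ ∀ z ∈ msupport (ν i), ‖z‖ ≤ s → ‖res v z‖ ≤ c := fun i => by
    by_cases hi : ∃ v : Fin n → Euc d, Orthonormal ℝ v ∧
        ∀ z ∈ msupport (ν i), ‖z‖ ≤ s → ‖res v z‖ ≤ c
    · exact ⟨hi.choose, fun _ => hi.choose_spec⟩
    · exact ⟨0, fun h => absurd h hi⟩
  choose v hv using hex
  have hv' := h.mono fun i hi => hv i hi
  obtain ⟨w, hw, hvw⟩ := exists_ultralimit_orthonormal U (hv'.mono fun i hi => hi.1)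
  refine ⟨w, hw, fun z hz hzs => le_of_forall_pos_le_add fun ε hε => ?_⟩
  have hlim : Tendsto (fun i => ‖res (v i) z‖) U (𝓝 ‖res w z‖) :=
    (tendsto_const_nhds.sub (tendsto_finsetSum _ fun a _ =>
      ((hvw a).inner tendsto_const_nhds).smul (hvw a))).norm
  refine le_of_tendsto hlim ?_
  filter_upwards [hv', hlam z hz (min ε (s - ‖z‖)) (lt_min hε (sub_pos.2 hzs))]
    with i hi ⟨y, hy, hyz⟩
  rw [dist_eq_norm] at hyz
  have h1 : ‖y - z‖ < s - ‖z‖ := hyz.trans_le (min_le_right _ _)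
  have h2 : ‖y - z‖ < ε := hyz.trans_le (min_le_left _ _)
  have h3 : ‖y‖ ≤ ‖z‖ + ‖y - z‖ := by simpa using norm_add_le z (y - z)
  have h4 := hi.2 y hy (by linarith)
  have h5 : res (v i) z = res (v i) y + res (v i) (z - y) := by rw [← res_add]; congr 1; abel
  have h6 := FlatnessPropagation.norm_res_le hi.1 (z - y)
  rw [norm_sub_rev] at h6
  rw [h5]
  exact (norm_add_le _ _).trans (by linarith)

theorem bilateralBeta_le {x : Euc d} {r ε : ℝ} (hr : 0 < r) (hε : 0 ≤ ε)
    {v : Fin n → Euc d} (hv : Orthonormal ℝ v) [IsLocallyFiniteMeasure μ]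
    (h1 : ∀ z ∈ msupport (blowUp μ x r) ∩ closedBall 0 1,
      ∃ y ∈ Submodule.span ℝ (range v), dist z y ≤ ε)
    (h2 : ∀ y ∈ Submodule.span ℝ (range v), ‖y‖ ≤ 1 →
      ∃ z ∈ msupport (blowUp μ x r), dist y z ≤ ε) :
    bilateralBeta n μ x r ≤ ε + ε := by
  have hbl : ∀ y : Euc d, x + r • (r⁻¹ • (y - x)) = y := fun y => by
    rw [smul_inv_smul₀ hr.ne', add_sub_cancel]
  have hdist : ∀ y z : Euc d, dist y (x + r • z) = dist (r⁻¹ • (y - x)) z * r := fun y z => by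
    nth_rw 1 [← hbl y]
    rw [dist_add_left, dist_smul₀, Real.norm_of_nonneg hr.le, mul_comm]
  have hunit : ∀ y ∈ closedBall x r, ‖r⁻¹ • (y - x)‖ ≤ 1 := fun y hy => by
    rw [norm_smul, ← dist_eq_norm, norm_inv, Real.norm_of_nonneg hr.le, inv_mul_le_iff₀ hr,
      mul_one]
    exact hy
  have hbdd : BddBelow (range fun L : nPlanes d n =>
      ((⨆ y : (msupport μ ∩ closedBall x r : Set (Euc d)),
        infDist y.1 (L.1 : Set (Euc d)) / r) +
      (⨆ p : ((L.1 : Set (Euc d)) ∩ closedBall x r : Set (Euc d)),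
        infDist p.1 (msupport μ) / r))) := by
    refine ⟨0, ?_⟩
    rintro _ ⟨L, rfl⟩
    exact add_nonneg (Real.iSup_nonneg fun _ => div_nonneg infDist_nonneg hr.le)
      (Real.iSup_nonneg fun _ => div_nonneg infDist_nonneg hr.le)
  refine (ciInf_le hbdd ⟨_, mk'_mem_nPlanes x hv⟩).trans (add_le_add ?_ ?_)
  · refine Real.iSup_le (fun ⟨y, hy, hyr⟩ => ?_) hε
    obtain ⟨z, hz, hyz⟩ := h1 (r⁻¹ • (y - x)) ⟨(mem_msupport_blowUp hr).2 (by rwa [hbl]), by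
      rw [mem_closedBall_zero_iff]; exact hunit y hyr⟩
    rw [div_le_iff₀ hr]
    refine (infDist_le_dist_of_mem (y := x + r • z) ?_).trans ?_
    · rw [SetLike.mem_coe, AffineSubspace.mem_mk', vsub_eq_sub, add_sub_cancel_left]
      exact Submodule.smul_mem _ _ hz
    · rw [hdist]
      exact mul_le_mul_of_nonneg_right hyz hr.le
  · refine Real.iSup_le (fun ⟨p, hp, hpr⟩ => ?_) hε
    obtain ⟨z, hz, hpz⟩ := h2 (r⁻¹ • (p - x)) (Submodule.smul_mem _ _ (by
      rwa [SetLike.mem_coe, AffineSubspace.mem_mk', vsub_eq_sub] at hp)) (hunit p hpr)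
    rw [div_le_iff₀ hr]
    refine (infDist_le_dist_of_mem ((mem_msupport_blowUp hr).1 hz)).trans ?_
    rw [hdist]
    exact mul_le_mul_of_nonneg_right hpz hr.le

theorem eventually_near_plane {ι : Type*} {U : Ultrafilter ι} {ν : ι → Measure (Euc d)}
    {lam : Measure (Euc d)} {V : Submodule ℝ (Euc d)} (hV : msupport lam = V)
    (hlam : ∀ x, x ∈ msupport lam ↔ ∀ ε > 0, ∀ᶠ i in U, ∃ y ∈ msupport (ν i), dist y x < ε)
    {ε : ℝ} (hε : 0 < ε) :
    ∀ᶠ i in U, ∀ z ∈ msupport (ν i) ∩ closedBall 0 1, ∃ y ∈ V, dist z y ≤ ε := by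
  by_contra hcon
  rw [← Ultrafilter.eventually_not] at hcon
  push Not at hcon
  have hex : ∀ i, ∃ z, (∃ z ∈ msupport (ν i) ∩ closedBall 0 1, ∀ y ∈ V, ε < dist z y) →
      z ∈ msupport (ν i) ∩ closedBall 0 1 ∧ ∀ y ∈ V, ε < dist z y := fun i => by
    by_cases hi : ∃ z ∈ msupport (ν i) ∩ closedBall 0 1, ∀ y ∈ V, ε < dist z y
    · exact ⟨hi.choose, fun _ => hi.choose_spec⟩
    · exact ⟨0, fun h => absurd h hi⟩
  choose z hz using hex
  have hz' := hcon.mono fun i hi => hz i hi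
  obtain ⟨w, hw⟩ := exists_ultralimit U (hz'.mono fun i hi => mem_closedBall.1 hi.1.2)
  have hwV : w ∈ V := by
    rw [← SetLike.mem_coe, ← hV, hlam]
    intro η hη
    filter_upwards [hz', hw.eventually (ball_mem_nhds w hη)] with i hi h2
    exact ⟨z i, hi.1.1, h2⟩
  obtain ⟨i, h1, h2⟩ := (hz'.and (hw.eventually (ball_mem_nhds w hε))).exists
  exact absurd (h1.2 w hwV) (not_lt.2 (mem_ball.1 h2).le)

theorem eventually_near_msupport {ι : Type*} {U : Ultrafilter ι} {ν : ι → Measure (Euc d)}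
    {V : Submodule ℝ (Euc d)}
    (hlam : ∀ x ∈ V, ∀ ε > 0, ∀ᶠ i in U, ∃ y ∈ msupport (ν i), dist y x < ε)
    {ε : ℝ} (hε : 0 < ε) :
    ∀ᶠ i in U, ∀ y ∈ V, ‖y‖ ≤ 1 → ∃ z ∈ msupport (ν i), dist y z ≤ ε := by
  by_contra hcon
  rw [← Ultrafilter.eventually_not] at hcon
  push Not at hcon
  have hex : ∀ i, ∃ y, (∃ y ∈ V, ‖y‖ ≤ 1 ∧ ∀ z ∈ msupport (ν i), ε < dist y z) →
      y ∈ V ∧ ‖y‖ ≤ 1 ∧ ∀ z ∈ msupport (ν i), ε < dist y z := fun i => by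
    by_cases hi : ∃ y ∈ V, ‖y‖ ≤ 1 ∧ ∀ z ∈ msupport (ν i), ε < dist y z
    · exact ⟨hi.choose, fun _ => hi.choose_spec⟩
    · exact ⟨0, fun h => absurd h hi⟩
  choose y hy using hex
  have hy' := hcon.mono fun i hi => hy i hi
  obtain ⟨w, hw⟩ := exists_ultralimit U (f := y) (x := 0) (M := 1)
    (hy'.mono fun i hi => by simpa using hi.2.1)
  have hwV : w ∈ V := V.closed_of_finiteDimensional.mem_of_tendsto hw (hy'.mono fun i hi => hi.1)
  obtain ⟨i, h1, h2, z, hz, hzw⟩ := (hy'.and ((hw.eventually (ball_mem_nhds w (half_pos hε))).and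
    (hlam w hwV _ (half_pos hε)))).exists
  have h3 := h1.2.2 z hz
  have h4 := dist_triangle_right (y i) z w
  linarith

theorem radius_le_of_closedBall_subset (hd : 0 < d) {x : Euc d} {r R : ℝ} (hr : 0 ≤ r)
    (h : closedBall x r ⊆ closedBall 0 R) : r ≤ 2 * R := by
  have : Nonempty (Fin d) := ⟨⟨0, hd⟩⟩
  obtain ⟨e, he⟩ := exists_norm_eq (Euc d) hr
  have h1 := mem_closedBall_zero_iff.1 (h (mem_closedBall_self hr))
  have h2 := mem_closedBall_zero_iff.1 (h (show x + e ∈ closedBall x r by simp [he]))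
  have h3 := norm_sub_le (x + e) x
  rw [add_sub_cancel_left, he] at h3
  linarith

end

end FlatnessPropagation

theorem flatness_propagation {d n : ℕ} (hn : 0 < n) (hnd : n ≤ d) :
    ∃ δ₀ : ℝ, 0 < δ₀ ∧
      ∀ μ : Measure (Euc d), IsLocallyFiniteMeasure μ → (msupport μ).Nonempty →
        Doubling μ → AsympOptDoubling n μ →
        ∀ ε : ℝ, 0 < ε → ∀ K : Set (Euc d), IsCompact K →
          ∃ N : ℕ, 0 < N ∧
            ∀ x ∈ msupport μ ∩ K, ∀ r : ℝ, 0 < r →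
              Metric.closedBall x ((2:ℝ) ^ N * r) ⊆ K →
              (∀ k : ℕ, 1 ≤ k → k ≤ N → jonesBeta n μ x ((2:ℝ) ^ k * r) ≤ δ₀ / 4) →
              bilateralBeta n μ x r ≤ ε := by
  obtain ⟨δ, hδ, H⟩ := FlatnessPropagation.exists_flat d hn
  refine ⟨δ, hδ, fun μ hμ _ _ hAOD ε hε K hK => ?_⟩
  by_contra! hcon
  choose x hx r hr hball hβ hbig using fun j : ℕ => hcon (j + 1) j.succ_pos
  obtain ⟨R, hR⟩ := hK.isBounded.subset_closedBall (0 : Euc d)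
  have hrad : ∀ j, r j ≤ 2 * R * (1 / 2) ^ j := fun j => by
    have h1 := FlatnessPropagation.radius_le_of_closedBall_subset (hn.trans_le hnd)
      (by have := hr j; positivity) ((hball j).trans hR)
    have h2 : (2 : ℝ) ^ j * r j ≤ 2 ^ (j + 1) * r j := mul_le_mul_of_nonneg_right
      (pow_le_pow_right₀ one_le_two j.le_succ) (hr j).le
    rw [one_div, inv_pow, ← div_eq_mul_inv, le_div_iff₀ (by positivity), mul_comm]
    exact h2.trans h1
  have hr0 : Tendsto r atTop (nhds 0) := by
    refine squeeze_zero (fun j => (hr j).le) hrad ?_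
    simpa using (tendsto_pow_atTop_nhds_zero_of_lt_one (by norm_num : (0 : ℝ) ≤ 1 / 2)
      (by norm_num)).const_mul (2 * R)
  let U : Ultrafilter ℕ := Ultrafilter.of atTop
  have hU : (U : Filter ℕ) ≤ atTop := Ultrafilter.of_le _
  have hA := FlatnessPropagation.asympUnif_blowUp (U := U) (x := x) (ρ := r) (M := R) hn hAOD
    (fun j => (hx j).1) (fun j => mem_closedBall_zero_iff.1 (hR (hx j).2)) hr (hr0.mono_left hU)
  obtain ⟨lam, hlam, -, hsupp⟩ := hA.exists_limit
  obtain ⟨v, hv, hflat⟩ := H lam hlam fun k hk =>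
    FlatnessPropagation.exists_frame_of_tendsto (fun z hz => (hsupp z).1 hz) (by
      filter_upwards [hU (eventually_ge_atTop k)] with j hj
      exact FlatnessPropagation.norm_res_le_of_jonesBeta hnd (hx j).1 (hr j)
        (by positivity) hδ (hβ j k hk (hj.trans j.le_succ)))
  obtain ⟨j, h1, h2⟩ := ((FlatnessPropagation.eventually_near_plane hflat hsupp
    (half_pos hε)).and (FlatnessPropagation.eventually_near_msupport
      (V := Submodule.span ℝ (range v)) (fun z hz => (hsupp z).1 (by rw [hflat]; exact hz))
      (half_pos hε))).exists
  have := FlatnessPropagation.bilateralBeta_le (hr j) (half_pos hε).le hv h1 h2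
  rw [add_halves] at this
  exact absurd this (not_le.2 (hbig j))
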